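/- Let β ∈ {0, 1}, d ≥ 1, λ ∈ 2^ℤ, and let (q, r) satisfy 2 < q ≤ ∞, 2 ≤ r ≤ ∞ and 2/q + d/r = d/2. Then for every Schwartz function F on ℝ^{d+1} and either choice of sign, ‖∫_0^t S_{m_β}(±(t−s)) P_λ F(s) ds‖_{L^q_t L^r_x(ℝ^{d+1})} ≲ [c_{β,d}(λ)]^{2/(qd)} ‖P_λ F‖_{L^1_t L^2_x(ℝ^{d+1})}, where c_{β,d}(λ) = λ^{d/2-1} ⟨√β λ⟩^{-d/2} ⟨λ⟩^{d/4+1} and the implicit constant is independent of λ and F. -/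

import Mathlib

noncomputable section

open MeasureTheory Complex Real
open scoped FourierTransform ENNReal

/-- Euclidean space `ℝ^d`. -/
abbrev Euc (d : ℕ) := EuclideanSpace ℝ (Fin d)

/-- Japanese bracket `⟨x⟩ = (1+|x|²)^{1/2}`. -/
def jap (x : ℝ) : ℝ := Real.sqrt (1 + x ^ 2)

/-- The symbol `m_β(r) = √(r(1+βr²)tanh r)`. -/
def mSymb (β r : ℝ) : ℝ := Real.sqrt (r * (1 + β * r ^ 2) * Real.tanh r)

/-- The constant `c_{β,d}(λ) = λ^{d/2-1}⟨√β λ⟩^{-d/2}⟨λ⟩^{d/4+1}`. -/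
def cFactor (β : ℝ) (d : ℕ) (lam : ℝ) : ℝ :=
  lam ^ ((d : ℝ) / 2 - 1) * jap (Real.sqrt β * lam) ^ (-(d : ℝ) / 2) *
    jap lam ^ ((d : ℝ) / 4 + 1)

/-- `χ ∈ C_0^∞(ℝ)`, `0 ≤ χ ≤ 1`, `χ ≡ 1` on `[-1,1]`, `supp χ ⊆ [-2,2]`. -/
def IsCutoff (χ : ℝ → ℝ) : Prop :=
  ContDiff ℝ (⊤ : ℕ∞) χ ∧ HasCompactSupport χ ∧ (∀ s, 0 ≤ χ s ∧ χ s ≤ 1) ∧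
    (∀ s ∈ Set.Icc (-1 : ℝ) 1, χ s = 1) ∧ Function.support χ ⊆ Set.Icc (-2 : ℝ) 2

/-- `ρ(s) = χ(s) - χ(2s)`. -/
def rho (χ : ℝ → ℝ) (s : ℝ) : ℝ := χ s - χ (2 * s)

/-- Fourier multiplier operator with symbol `m`. -/
def mulOp {d : ℕ} (m : Euc d → ℂ) (f : Euc d → ℂ) : Euc d → ℂ :=
  𝓕⁻ fun ξ => m ξ * 𝓕 f ξ

/-- The Littlewood–Paley type projection `P_λ` with multiplier `ρ(|ξ|/λ)`. -/
def proj {d : ℕ} (χ : ℝ → ℝ) (lam : ℝ) (f : Euc d → ℂ) : Euc d → ℂ :=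
  mulOp (fun ξ => (rho χ (‖ξ‖ / lam) : ℂ)) f

/-- The propagator `S_{m_β}(t) = exp(-it m_β(D))`, so that `S_{m_β}(±t) = prop β (±t)`. -/
def propg (β : ℝ) {d : ℕ} (t : ℝ) (f : Euc d → ℂ) : Euc d → ℂ :=
  mulOp (fun ξ => Complex.exp (-Complex.I * (t * mSymb β ‖ξ‖))) f

/-- The `L^q` norm in time of an `ℝ≥0∞`-valued function (with the usual modification
for `q = ∞`). -/
def timeLp (q : ℝ≥0∞) (φ : ℝ → ℝ≥0∞) : ℝ≥0∞ :=
  if q = ∞ then essSup φ volume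
  else (∫⁻ t, φ t ^ q.toReal) ^ (1 / q.toReal)

/-- The mixed norm `‖u‖_{L^q_t L^r_x(ℝ^{d+1})}`. -/
def mixedNorm {d : ℕ} (q r : ℝ≥0∞) (u : ℝ → Euc d → ℂ) : ℝ≥0∞ :=
  timeLp q fun t => eLpNorm (u t) r volume

/-! ### Hyperbolic inequalities -/

lemma nonneg_of_hasDerivAt_nonneg {f f' : ℝ → ℝ} (hf : ∀ x, HasDerivAt f (f' x) x)
    (h0 : 0 ≤ f 0) (hf' : ∀ x, 0 < x → 0 ≤ f' x) {x : ℝ} (hx : 0 ≤ x) : 0 ≤ f x := by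
  have hmono : MonotoneOn f (Set.Ici 0) := by
    refine monotoneOn_of_deriv_nonneg (convex_Ici 0)
      (fun y _ => (hf y).continuousAt.continuousWithinAt)
      (fun y _ => (hf y).differentiableAt.differentiableWithinAt) fun y hy => ?_
    rw [interior_Ici, Set.mem_Ioi] at hy
    rw [(hf y).deriv]
    exact hf' y hy
  exact h0.trans (hmono Set.self_mem_Ici hx hx)

lemma sinh_ge_quintic {x : ℝ} (hx : 0 ≤ x) : x + x ^ 3 / 6 + x ^ 5 / 120 ≤ Real.sinh x := by
  have h := sum_le_hasSum (Finset.range 3) (fun n _ => by positivity) (Real.hasSum_sinh x)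
  simp only [Finset.sum_range_succ, Finset.sum_range_zero, Nat.factorial] at h
  norm_num at h
  linarith

lemma sinh_le_mul_cosh {x : ℝ} (hx : 0 ≤ x) : Real.sinh x ≤ x * Real.cosh x := by
  have := nonneg_of_hasDerivAt_nonneg (f := fun x => x * Real.cosh x - Real.sinh x)
    (f' := fun x => x * Real.sinh x) (fun x => by
      refine HasDerivAt.congr_deriv (((hasDerivAt_id x).mul (Real.hasDerivAt_cosh x)).sub (Real.hasDerivAt_sinh x)) ?_
      simp) (by simp) (fun x hx => mul_nonneg hx.le (Real.sinh_nonneg_iff.2 hx.le)) hx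
  linarith

lemma mul_cosh_le_cubic {x : ℝ} (hx : 0 ≤ x) :
    x * Real.cosh x ≤ Real.sinh x * (1 + x ^ 2 / 3) := by
  have := nonneg_of_hasDerivAt_nonneg
    (f := fun x => Real.sinh x * (1 + x ^ 2 / 3) - x * Real.cosh x)
    (f' := fun x => x / 3 * (x * Real.cosh x - Real.sinh x)) (fun x => by
      refine HasDerivAt.congr_deriv (((Real.hasDerivAt_sinh x).mul (((hasDerivAt_pow 2 x).div_const 3).const_add 1)).sub
        ((hasDerivAt_id x).mul (Real.hasDerivAt_cosh x))) ?_
      simp; ring) (by simp)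
    (fun x hx => mul_nonneg (by positivity) (by linarith [sinh_le_mul_cosh hx.le])) hx
  linarith

lemma mul_cosh_le_linear {x : ℝ} (hx : 0 ≤ x) :
    x * Real.cosh x ≤ Real.sinh x * (1 + x) := by
  have := nonneg_of_hasDerivAt_nonneg
    (f := fun x => Real.sinh x * (1 + x) - x * Real.cosh x)
    (f' := fun x => x * (Real.cosh x - Real.sinh x) + Real.sinh x) (fun x => by
      refine HasDerivAt.congr_deriv (((Real.hasDerivAt_sinh x).mul ((hasDerivAt_id x).const_add 1)).sub
        ((hasDerivAt_id x).mul (Real.hasDerivAt_cosh x))) ?_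
      simp only [id_eq]; ring) (by simp)
    (fun x hx => add_nonneg (mul_nonneg hx.le (by linarith [Real.sinh_lt_cosh x]))
      (Real.sinh_nonneg_iff.2 hx.le)) hx
  linarith

lemma sinh_mul_le_self {x : ℝ} (hx : 0 ≤ x) : Real.sinh x * (1 - x ^ 2 / 6) ≤ x := by
  have h1 : ∀ y : ℝ, 0 ≤ y → 0 ≤ 1 - Real.cosh y * (1 - y ^ 2 / 6) + y / 3 * Real.sinh y := by
    intro y hy
    refine nonneg_of_hasDerivAt_nonneg
      (f := fun y => 1 - Real.cosh y * (1 - y ^ 2 / 6) + y / 3 * Real.sinh y)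
      (f' := fun y => 2 / 3 * (y * Real.cosh y - Real.sinh y) + y ^ 2 / 6 * Real.sinh y)
      (fun y => ?_) (by simp) (fun y hy => ?_) hy
    · refine HasDerivAt.congr_deriv ((((Real.hasDerivAt_cosh y).mul
        (((hasDerivAt_pow 2 y).div_const 6).const_sub 1)).const_sub 1).add
        (((hasDerivAt_id y).div_const 3).mul (Real.hasDerivAt_sinh y))) ?_
      simp; ring
    · have := sinh_le_mul_cosh hy.le
      have := Real.sinh_nonneg_iff.2 hy.le
      have : 0 ≤ y ^ 2 / 6 * Real.sinh y := by positivity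
      linarith
  have := nonneg_of_hasDerivAt_nonneg
    (f := fun x => x - Real.sinh x * (1 - x ^ 2 / 6))
    (f' := fun y => 1 - Real.cosh y * (1 - y ^ 2 / 6) + y / 3 * Real.sinh y) (fun x => by
      refine HasDerivAt.congr_deriv ((hasDerivAt_id x).sub
        ((Real.hasDerivAt_sinh x).mul (((hasDerivAt_pow 2 x).div_const 6).const_sub 1))) ?_
      simp; ring) (by simp) (fun x hx => h1 x hx.le) hx
  linarith

/-! ### Logarithmic derivatives of the symbol -/

/-- `2r / sinh 2r`. -/
def hAux (r : ℝ) : ℝ := 2 * r / Real.sinh (2 * r)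

/-- `2r coth 2r`. -/
def kAux (r : ℝ) : ℝ := 2 * r * Real.cosh (2 * r) / Real.sinh (2 * r)

/-- `βr² / (1 + βr²)`. -/
def gAux (β r : ℝ) : ℝ := β * r ^ 2 / (1 + β * r ^ 2)

/-- The logarithmic derivative `r m'(r) / m(r)`. -/
def pAux (β r : ℝ) : ℝ := (1 + 2 * gAux β r + hAux r) / 2

/-- The quantity `r² m''(r) / m(r)`. -/
def qAux (β r : ℝ) : ℝ :=
  pAux β r ^ 2 - pAux β r + (2 * gAux β r * (1 - gAux β r) + hAux r * (1 - kAux r) / 2)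

lemma sinh_two_mul_pos {r : ℝ} (hr : 0 < r) : 0 < Real.sinh (2 * r) :=
  Real.sinh_pos_iff.2 (by positivity)

lemma hAux_pos {r : ℝ} (hr : 0 < r) : 0 < hAux r :=
  div_pos (by positivity) (sinh_two_mul_pos hr)

lemma hAux_le {r : ℝ} (hr : 0 < r) :
    hAux r * (1 + (2 * r) ^ 2 / 6 + (2 * r) ^ 4 / 120) ≤ 1 := by
  have h := sinh_ge_quintic (x := 2 * r) (by positivity)
  rw [hAux, div_mul_eq_mul_div, div_le_one (sinh_two_mul_pos hr)]
  linarith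

lemma hAux_le_one {r : ℝ} (hr : 0 < r) : hAux r ≤ 1 := by
  have h1 := hAux_le hr
  have h2 := hAux_pos hr
  have h3 : 0 ≤ hAux r * ((2 * r) ^ 2 / 6 + (2 * r) ^ 4 / 120) := by positivity
  linarith

lemma le_hAux {r : ℝ} (hr : 0 < r) : 1 - (2 * r) ^ 2 / 6 ≤ hAux r := by
  rw [hAux, le_div_iff₀ (sinh_two_mul_pos hr)]
  linarith [sinh_mul_le_self (x := 2 * r) (by positivity)]

lemma one_le_kAux {r : ℝ} (hr : 0 < r) : 1 ≤ kAux r := by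
  rw [kAux, one_le_div (sinh_two_mul_pos hr)]
  exact sinh_le_mul_cosh (by positivity)

lemma kAux_le_quadratic {r : ℝ} (hr : 0 < r) : kAux r ≤ 1 + (2 * r) ^ 2 / 3 := by
  rw [kAux, div_le_iff₀ (sinh_two_mul_pos hr)]
  linarith [mul_cosh_le_cubic (x := 2 * r) (by positivity)]

lemma kAux_le_linear {r : ℝ} (hr : 0 < r) : kAux r ≤ 1 + 2 * r := by
  rw [kAux, div_le_iff₀ (sinh_two_mul_pos hr)]
  linarith [mul_cosh_le_linear (x := 2 * r) (by positivity)]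

lemma hasDerivAt_hAux {r : ℝ} (hr : 0 < r) :
    HasDerivAt hAux (hAux r * (1 - kAux r) / r) r := by
  have hs := (sinh_two_mul_pos hr).ne'
  have h2 : HasDerivAt (fun r : ℝ => 2 * r) 2 r := by simpa using (hasDerivAt_id r).const_mul 2
  refine HasDerivAt.congr_deriv (h2.div h2.sinh hs) ?_
  rw [hAux, kAux]
  field_simp

lemma hasDerivAt_kAux {r : ℝ} (hr : 0 < r) :
    HasDerivAt kAux ((kAux r - hAux r ^ 2) / r) r := by
  have hs := (sinh_two_mul_pos hr).ne'
  have h2 : HasDerivAt (fun r : ℝ => 2 * r) 2 r := by simpa using (hasDerivAt_id r).const_mul 2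
  refine HasDerivAt.congr_deriv ((h2.mul h2.cosh).div h2.sinh hs) ?_
  rw [hAux, kAux]
  have := Real.cosh_sq (2 * r)
  simp only [Pi.mul_apply]
  field_simp
  rw [this]
  ring

lemma hasDerivAt_gAux {β r : ℝ} (hβ : 0 ≤ β) (hr : 0 < r) :
    HasDerivAt (gAux β) (2 * gAux β r * (1 - gAux β r) / r) r := by
  have hs : 1 + β * r ^ 2 ≠ 0 := by positivity
  have h2 : HasDerivAt (fun r : ℝ => β * r ^ 2) (β * (2 * r)) r := by
    simpa using (hasDerivAt_pow 2 r).const_mul β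
  refine HasDerivAt.congr_deriv (h2.div (h2.const_add 1) hs) ?_
  rw [gAux]
  field_simp

lemma gAux_nonneg {β r : ℝ} (hβ : 0 ≤ β) : 0 ≤ gAux β r := by
  rw [gAux]; positivity

lemma gAux_le_one {β r : ℝ} (hβ : 0 ≤ β) : gAux β r ≤ 1 := by
  rw [gAux, div_le_one (by positivity)]; linarith

lemma half_le_pAux {β r : ℝ} (hβ : 0 ≤ β) (hr : 0 < r) : 1 / 2 ≤ pAux β r := by
  rw [pAux]; linarith [gAux_nonneg (r := r) hβ, hAux_pos hr]

lemma hasDerivAt_pAux {β r : ℝ} (hβ : 0 ≤ β) (hr : 0 < r) :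
    HasDerivAt (pAux β)
      ((2 * gAux β r * (1 - gAux β r) + hAux r * (1 - kAux r) / 2) / r) r := by
  refine HasDerivAt.congr_deriv (((((hasDerivAt_gAux hβ hr).const_mul 2).const_add 1).add
    (hasDerivAt_hAux hr)).div_const 2) ?_
  ring

lemma tanh_pos_of_pos {r : ℝ} (hr : 0 < r) : 0 < Real.tanh r := by
  rw [Real.tanh_eq_sinh_div_cosh]
  exact div_pos (Real.sinh_pos_iff.2 hr) (Real.cosh_pos r)

lemma mSymb_pos {β r : ℝ} (hβ : 0 ≤ β) (hr : 0 < r) : 0 < mSymb β r :=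
  Real.sqrt_pos.2 (by have := tanh_pos_of_pos hr; positivity)

lemma mSymb_sq {β r : ℝ} (hβ : 0 ≤ β) (hr : 0 < r) :
    mSymb β r ^ 2 = r * (1 + β * r ^ 2) * Real.tanh r :=
  Real.sq_sqrt (by have := tanh_pos_of_pos hr; positivity)

lemma hasDerivAt_mSymb {β r : ℝ} (hβ : 0 ≤ β) (hr : 0 < r) :
    HasDerivAt (mSymb β) (mSymb β r * pAux β r / r) r := by
  have hc := (Real.cosh_pos r).ne'
  have hs := (Real.sinh_pos_iff.2 hr).ne'
  have htanh : HasDerivAt Real.tanh (1 / Real.cosh r ^ 2) r := by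
    have : Real.tanh = fun x => Real.sinh x / Real.cosh x :=
      funext fun x => Real.tanh_eq_sinh_div_cosh x
    rw [this]
    refine HasDerivAt.congr_deriv ((Real.hasDerivAt_sinh r).div (Real.hasDerivAt_cosh r) hc) ?_
    have := Real.cosh_sq r
    field_simp
    linarith
  have h1 : HasDerivAt (fun r : ℝ => r * (1 + β * r ^ 2)) (1 + 3 * β * r ^ 2) r := by
    refine HasDerivAt.congr_deriv ((hasDerivAt_id r).mul (((hasDerivAt_pow 2 r).const_mul β).const_add 1)) ?_
    simp; ring
  have hpos : 0 < r * (1 + β * r ^ 2) * Real.tanh r := by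
    have := tanh_pos_of_pos hr; positivity
  have hm := mSymb_pos hβ hr
  have hm2 := mSymb_sq hβ hr
  refine HasDerivAt.congr_deriv ((h1.mul htanh).sqrt hpos.ne') ?_
  change _ / (2 * mSymb β r) = _
  rw [div_eq_iff (by positivity)]
  have : mSymb β r * pAux β r / r * (2 * mSymb β r) = mSymb β r ^ 2 * (2 * pAux β r / r) := by ring
  rw [this, hm2, pAux, gAux, hAux, Real.sinh_two_mul, Real.tanh_eq_sinh_div_cosh]
  have : (1 + β * r ^ 2) ≠ 0 := by positivity
  field_simp
  ring

/-- The second derivative of the symbol does not degenerate on `(0, ∞)`. -/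
lemma exists_qAux_lower {β : ℝ} (hβ : β = 0 ∨ β = 1) :
    ∃ ε : ℝ, (ε = 1 ∨ ε = -1) ∧ ∀ r > 0, 1 / 100 * (r ^ 2 / (1 + r ^ 2)) ≤ ε * qAux β r := by
  rcases hβ with rfl | rfl
  · refine ⟨-1, Or.inr rfl, fun r hr => ?_⟩
    have hh := hAux_pos hr
    have hk := one_le_kAux hr
    have hq : qAux 0 r = -((1 - hAux r ^ 2) + 2 * hAux r * (kAux r - 1)) / 4 := by
      rw [qAux, pAux, gAux]; ring
    have h1 : 0 ≤ 2 * hAux r * (kAux r - 1) := by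
      have : 0 ≤ kAux r - 1 := by linarith
      positivity
    have h2 := hAux_le hr
    have h3 := hAux_le_one hr
    have h4 : hAux r ^ 2 ≤ hAux r := by nlinarith
    have h5 : hAux r * (1 + r ^ 2 / 2) ≤ 1 := by
      have : 0 ≤ hAux r * (r ^ 2 / 6 + (2 * r) ^ 4 / 120) := by positivity
      nlinarith
    have h6 : hAux r ≤ 1 / (1 + r ^ 2 / 2) := by rwa [le_div_iff₀ (by positivity)]
    have h7 : 4 / 100 * (r ^ 2 / (1 + r ^ 2)) ≤ 1 - 1 / (1 + r ^ 2 / 2) := by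
      rw [← sub_nonneg]
      have : 1 - 1 / (1 + r ^ 2 / 2) - 4 / 100 * (r ^ 2 / (1 + r ^ 2))
          = r ^ 2 * (46 + 48 * r ^ 2) / (100 * (1 + r ^ 2 / 2) * (1 + r ^ 2)) := by
        field_simp; ring
      rw [this]; positivity
    rw [hq]
    linarith
  · refine ⟨1, Or.inl rfl, fun r hr => ?_⟩
    have hh := hAux_pos hr
    have hk := one_le_kAux hr
    have h2 := hAux_le hr
    have h3 := hAux_le_one hr
    set y : ℝ := (2 * r) ^ 2 with hy
    have hy0 : 0 < y := by positivity
    have hg : gAux 1 r = y / (4 + y) := by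
      rw [gAux, hy]; field_simp; ring
    have hrg : r ^ 2 / (1 + r ^ 2) = y / (4 + y) := by
      rw [hy]; field_simp; ring
    have hq : qAux 1 r = (8 * (y / (4 + y)) - 4 * (y / (4 + y)) ^ 2 + 4 * (y / (4 + y)) * hAux r
        - (1 - hAux r ^ 2) - 2 * hAux r * (kAux r - 1)) / 4 := by
      rw [qAux, pAux, hg]; ring
    have hgh : 0 ≤ 4 * (y / (4 + y)) * hAux r := by positivity
    have hh6 : hAux r ≤ 1 / (1 + y / 6) := by
      rw [le_div_iff₀ (by positivity)]
      have : 0 ≤ hAux r * ((2 * r) ^ 4 / 120) := by positivity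
      linarith
    have hk2 : 2 * hAux r * (kAux r - 1) ≤ 4 * y / (6 + y) := by
      calc 2 * hAux r * (kAux r - 1) ≤ 2 * hAux r * (y / 3) := by
            gcongr; linarith [kAux_le_quadratic hr]
        _ ≤ 2 * (1 / (1 + y / 6)) * (y / 3) := by gcongr
        _ = 4 * y / (6 + y) := by field_simp; ring
    rw [one_mul, hrg, hq]
    rcases le_total y 3 with hy3 | hy3
    · have h8 : 1 - hAux r ^ 2 ≤ y / 3 := by
        have := le_hAux hr
        rw [← hy] at this
        nlinarith
      have h9 : 0 ≤ 8 * (y / (4 + y)) - 4 * (y / (4 + y)) ^ 2 - y / 3 - 4 * y / (6 + y)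
          - 1 / 25 * (y / (4 + y)) := by
        have : 8 * (y / (4 + y)) - 4 * (y / (4 + y)) ^ 2 - y / 3 - 4 * y / (6 + y)
          - 1 / 25 * (y / (4 + y)) = y * ((8 * (4 + y) - 4 * y - 1 / 25 * (4 + y)) * 3 * (6 + y)
            - (4 + y) ^ 2 * (6 + y) - 12 * (4 + y) ^ 2) / (3 * (4 + y) ^ 2 * (6 + y)) := by
          field_simp; ring
        rw [this]
        refine div_nonneg (mul_nonneg hy0.le ?_) (by positivity)
        nlinarith [mul_nonneg hy0.le (sub_nonneg.2 hy3), mul_nonneg (mul_nonneg hy0.le hy0.le) (sub_nonneg.2 hy3)]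
      linarith
    · rcases le_total y 9 with hy9 | hy9
      · have h8 : 1 - hAux r ^ 2 ≤ 1 := by nlinarith
        have h9 : 0 ≤ 8 * (y / (4 + y)) - 4 * (y / (4 + y)) ^ 2 - 1 - 4 * y / (6 + y)
            - 1 / 25 * (y / (4 + y)) := by
          have : 8 * (y / (4 + y)) - 4 * (y / (4 + y)) ^ 2 - 1 - 4 * y / (6 + y)
            - 1 / 25 * (y / (4 + y)) = ((8 * (4 + y) - 4 * y - 1 / 25 * (4 + y)) * y * (6 + y)
              - (4 + y) ^ 2 * (6 + y) - 4 * y * (4 + y) ^ 2) / ((4 + y) ^ 2 * (6 + y)) := by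
            field_simp; ring
          rw [this]
          refine div_nonneg ?_ (by positivity)
          nlinarith [mul_nonneg (sub_nonneg.2 hy3) (sub_nonneg.2 hy9),
            mul_nonneg hy0.le (mul_nonneg (sub_nonneg.2 hy3) (sub_nonneg.2 hy9))]
        linarith
      · have h8 : 1 - hAux r ^ 2 ≤ 1 := by nlinarith
        have h10 : 2 * hAux r * (kAux r - 1) ≤ 2 := by
          have h11 : kAux r - 1 ≤ 2 * r := by linarith [kAux_le_linear hr]
          have h12 : 2 * (2 * r) ≤ (y + 9) / 3 := by nlinarith [sq_nonneg (2 * r - 3)]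
          have h13 : (y + 9) / 3 ≤ 2 * (1 + y / 6 + (2 * r) ^ 4 / 120) := by
            have : (2 * r) ^ 4 = y ^ 2 := by rw [hy]; ring
            rw [this]; nlinarith
          calc 2 * hAux r * (kAux r - 1) ≤ 2 * hAux r * (2 * r) := by gcongr
            _ = hAux r * (2 * (2 * r)) := by ring
            _ ≤ hAux r * (2 * (1 + y / 6 + (2 * r) ^ 4 / 120)) := by gcongr; linarith
            _ ≤ 2 := by linarith
        have h14 : 9 / 13 ≤ y / (4 + y) := by
          rw [div_le_div_iff₀ (by norm_num) (by positivity)]; linarith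
        have h15 : y / (4 + y) ≤ 1 := by rw [div_le_one (by positivity)]; linarith
        nlinarith

/-! ### Size of the symbol -/

lemma mSymb_sq_bounds {β r : ℝ} (hβ : 0 ≤ β) (hr : 0 < r) :
    r ^ 2 * (1 + β * r ^ 2) / (1 + r) ≤ mSymb β r ^ 2 ∧
      mSymb β r ^ 2 ≤ 2 * (r ^ 2 * (1 + β * r ^ 2) / (1 + r)) := by
  have hs := Real.sinh_pos_iff.2 hr
  have hc := Real.cosh_pos r
  have h1 : r / (1 + r) ≤ Real.tanh r := by
    rw [Real.tanh_eq_sinh_div_cosh, div_le_div_iff₀ (by positivity) hc]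
    linarith [mul_cosh_le_linear hr.le]
  have h2 : Real.tanh r ≤ 2 * (r / (1 + r)) := by
    have h3 : Real.tanh r ≤ 1 := by
      rw [Real.tanh_eq_sinh_div_cosh, div_le_one hc]; exact (Real.sinh_lt_cosh r).le
    have h4 : Real.tanh r ≤ r := by
      rw [Real.tanh_eq_sinh_div_cosh, div_le_iff₀ hc]; exact sinh_le_mul_cosh hr.le
    rw [← mul_div_assoc, le_div_iff₀ (by positivity)]
    nlinarith
  rw [mSymb_sq hβ hr]
  constructor
  · calc r ^ 2 * (1 + β * r ^ 2) / (1 + r) = r * (1 + β * r ^ 2) * (r / (1 + r)) := by ring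
      _ ≤ _ := by gcongr
  · calc r * (1 + β * r ^ 2) * Real.tanh r ≤ r * (1 + β * r ^ 2) * (2 * (r / (1 + r))) := by gcongr
      _ = _ := by ring

lemma mSymb_le_of_comparable {β a b : ℝ} (hβ : 0 ≤ β) (ha : 0 < a) (hb : 0 < b)
    (hab : a ≤ 8 * b) (hba : b ≤ 8 * a) : mSymb β a ≤ 512 * mSymb β b := by
  have h1 := (mSymb_sq_bounds hβ ha).2
  have h2 := (mSymb_sq_bounds hβ hb).1
  have h3 : a ^ 2 * (1 + β * a ^ 2) / (1 + a) ≤ 8 ^ 5 * (b ^ 2 * (1 + β * b ^ 2) / (1 + b)) := by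
    have e1 : a ^ 2 ≤ 64 * b ^ 2 := by nlinarith
    have e2 : 1 + β * a ^ 2 ≤ 64 * (1 + β * b ^ 2) := by nlinarith
    have e3 : 1 / (1 + a) ≤ 8 * (1 / (1 + b)) := by
      rw [← mul_div_assoc, div_le_div_iff₀ (by positivity) (by positivity)]; linarith
    calc a ^ 2 * (1 + β * a ^ 2) / (1 + a) = a ^ 2 * (1 + β * a ^ 2) * (1 / (1 + a)) := by ring
      _ ≤ (64 * b ^ 2) * (64 * (1 + β * b ^ 2)) * (8 * (1 / (1 + b))) := by gcongr
      _ = _ := by ring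
  refine le_of_sq_le_sq ?_ (by have := mSymb_pos hβ hb; positivity)
  have : 0 ≤ mSymb β b ^ 2 := sq_nonneg _
  nlinarith

/-! ### Symbol classes -/

/-- Families of functions on `(1/8, 8)` whose first `k` derivatives with respect to `s d/ds` are
bounded uniformly in the parameter. -/
def SymbolClass {ι : Type*} : ℕ → (ι → ℝ → ℝ) → Prop
  | 0, f => ∃ C, ∀ i, ∀ s ∈ Set.Ioo (1 / 8 : ℝ) 8, |f i s| ≤ C
  | k + 1, f => (∃ C, ∀ i, ∀ s ∈ Set.Ioo (1 / 8 : ℝ) 8, |f i s| ≤ C) ∧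
      ∃ f' : ι → ℝ → ℝ, (∀ i, ∀ s ∈ Set.Ioo (1 / 8 : ℝ) 8, HasDerivAt (f i) (f' i s / s) s) ∧
        SymbolClass k f'

namespace SymbolClass

variable {ι : Type*} {f g : ι → ℝ → ℝ} {k : ℕ}

lemma bounded (hf : SymbolClass k f) : ∃ C, ∀ i, ∀ s ∈ Set.Ioo (1 / 8 : ℝ) 8, |f i s| ≤ C := by
  cases k with
  | zero => exact hf
  | succ k => exact hf.1

lemma pred (hf : SymbolClass (k + 1) f) : SymbolClass k f := by
  induction k generalizing f with
  | zero => exact hf.1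
  | succ k ih =>
    obtain ⟨h1, f', h2, h3⟩ := hf
    exact ⟨h1, f', h2, ih h3⟩

lemma mono {l : ℕ} (hl : l ≤ k) (hf : SymbolClass k f) : SymbolClass l f := by
  induction hl with
  | refl => exact hf
  | step _ ih => exact ih hf.pred

lemma add (hf : SymbolClass k f) (hg : SymbolClass k g) :
    SymbolClass k (fun i s => f i s + g i s) := by
  induction k generalizing f g with
  | zero =>
    obtain ⟨A, hA⟩ := hf
    obtain ⟨B, hB⟩ := hg
    exact ⟨A + B, fun i s hs => (abs_add_le _ _).trans (add_le_add (hA i s hs) (hB i s hs))⟩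
  | succ k ih =>
    obtain ⟨A, hA⟩ := hf.bounded
    obtain ⟨B, hB⟩ := hg.bounded
    obtain ⟨_, f', h2, h3⟩ := hf
    obtain ⟨_, g', h2', h3'⟩ := hg
    refine ⟨⟨A + B, fun i s hs => (abs_add_le _ _).trans (add_le_add (hA i s hs) (hB i s hs))⟩,
      _, fun i s hs => ?_, ih h3 h3'⟩
    exact ((h2 i s hs).add (h2' i s hs)).congr_deriv (by ring)

lemma mul (hf : SymbolClass k f) (hg : SymbolClass k g) :
    SymbolClass k (fun i s => f i s * g i s) := by
  induction k generalizing f g with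
  | zero =>
    obtain ⟨A, hA⟩ := hf
    obtain ⟨B, hB⟩ := hg
    exact ⟨A * B, fun i s hs => by
      rw [abs_mul]
      exact mul_le_mul (hA i s hs) (hB i s hs) (abs_nonneg _) ((abs_nonneg _).trans (hA i s hs))⟩
  | succ k ih =>
    have hf0 := hf.pred
    have hg0 := hg.pred
    obtain ⟨A, hA⟩ := hf.bounded
    obtain ⟨B, hB⟩ := hg.bounded
    obtain ⟨_, f', h2, h3⟩ := hf
    obtain ⟨_, g', h2', h3'⟩ := hg
    refine ⟨⟨A * B, fun i s hs => by
      rw [abs_mul]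
      exact mul_le_mul (hA i s hs) (hB i s hs) (abs_nonneg _) ((abs_nonneg _).trans (hA i s hs))⟩,
      _, fun i s hs => ?_, (ih h3 hg0).add (ih hf0 h3')⟩
    exact ((h2 i s hs).mul (h2' i s hs)).congr_deriv (by ring)

lemma of_contDiff {φ : ℝ → ℝ} (hφ : ContDiff ℝ (⊤ : ℕ∞) φ) :
    SymbolClass k (fun _ : ι => φ) := by
  have hb : ∀ φ : ℝ → ℝ, Continuous φ →
      ∃ C, ∀ _ : ι, ∀ s ∈ Set.Ioo (1 / 8 : ℝ) 8, |φ s| ≤ C := fun φ hφ => by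
    obtain ⟨C, hC⟩ := isCompact_Icc.exists_bound_of_continuousOn (s := Set.Icc (1 / 8 : ℝ) 8)
      hφ.continuousOn
    exact ⟨C, fun _ s hs => hC s ⟨hs.1.le, hs.2.le⟩⟩
  induction k generalizing φ with
  | zero => exact hb φ hφ.continuous
  | succ k ih =>
    have h1 : ContDiff ℝ (⊤ : ℕ∞) (deriv φ) := (contDiff_infty_iff_deriv.1 hφ).2
    refine ⟨hb φ hφ.continuous, fun _ s => s * deriv φ s, fun i s hs => ?_,
      ih (contDiff_id.mul h1)⟩
    have hs0 : s ≠ 0 := by have := hs.1; intro h; rw [h] at this; norm_num at this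
    refine ((hφ.differentiable (by simp)) s).hasDerivAt.congr_deriv ?_
    field_simp

lemma const (c : ℝ) : SymbolClass k (fun (_ : ι) _ => c) := of_contDiff contDiff_const

lemma neg (hf : SymbolClass k f) : SymbolClass k (fun i s => -f i s) := by
  simpa using (const (-1)).mul hf

lemma sub (hf : SymbolClass k f) (hg : SymbolClass k g) :
    SymbolClass k (fun i s => f i s - g i s) := by
  simpa [sub_eq_add_neg] using hf.add hg.neg

lemma inv {c : ℝ} (hc : 0 < c) (hf : SymbolClass k f)
    (hfc : ∀ i, ∀ s ∈ Set.Ioo (1 / 8 : ℝ) 8, c ≤ f i s) :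
    SymbolClass k (fun i s => (f i s)⁻¹) := by
  have hb : ∃ C, ∀ i, ∀ s ∈ Set.Ioo (1 / 8 : ℝ) 8, |(f i s)⁻¹| ≤ C :=
    ⟨c⁻¹, fun i s hs => by
      rw [abs_inv, abs_of_pos (hc.trans_le (hfc i s hs))]
      exact inv_anti₀ hc (hfc i s hs)⟩
  induction k generalizing f with
  | zero => exact hb
  | succ k ih =>
    have hf0 := ih hf.pred hfc hb
    obtain ⟨_, f', h2, h3⟩ := hf
    refine ⟨hb, _, fun i s hs => ?_, (h3.mul (hf0.mul hf0)).neg⟩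
    have := (hc.trans_le (hfc i s hs)).ne'
    refine ((h2 i s hs).inv this).congr_deriv ?_
    field_simp

/-- If `s f' = a f` with `a` a symbol and `f` bounded, then `f` is a symbol. -/
lemma of_logDeriv {a : ι → ℝ → ℝ} (ha : SymbolClass k a) (hf : SymbolClass 0 f)
    (h : ∀ i, ∀ s ∈ Set.Ioo (1 / 8 : ℝ) 8, HasDerivAt (f i) (a i s * f i s / s) s) :
    SymbolClass k f := by
  induction k with
  | zero => exact hf
  | succ k ih => exact ⟨hf, _, h, ha.pred.mul (ih ha.pred)⟩

end SymbolClass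

lemma mem_region_pos {s : ℝ} (hs : s ∈ Set.Ioo (1 / 8 : ℝ) 8) : 0 < s :=
  lt_trans (by norm_num) hs.1

/-- Rescaling transports Euler derivatives. -/
lemma HasDerivAt.comp_pos_mul {F : ℝ → ℝ} {D l s : ℝ} (hl : 0 < l)
    (h : HasDerivAt F (D / (l * s)) (l * s)) :
    HasDerivAt (fun s => F (l * s)) (D / s) s := by
  have h2 : HasDerivAt (fun r : ℝ => l * r) l s := by simpa using (hasDerivAt_id s).const_mul l
  refine (h.comp s h2).congr_deriv ?_
  field_simp

lemma hAux_mul_kAux_pow_le (j : ℕ) {r : ℝ} (hr : 0 < r) :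
    hAux r * kAux r ^ j ≤ 2 * Real.exp 1 * (j + 1).factorial := by
  have hx : 0 ≤ 2 * r := by positivity
  have hs := sinh_two_mul_pos hr
  have hh : hAux r ≤ 2 * (1 + 2 * r) * Real.exp (-(2 * r)) := by
    have h1 : hAux r ≤ (1 + 2 * r) / Real.cosh (2 * r) := by
      rw [hAux, div_le_div_iff₀ hs (Real.cosh_pos _)]
      linarith [mul_cosh_le_linear hx]
    refine h1.trans ?_
    rw [div_le_iff₀ (Real.cosh_pos _), Real.cosh_eq]
    have e1 : Real.exp (-(2 * r)) * Real.exp (2 * r) = 1 := by rw [← Real.exp_add]; simp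
    have e2 : 0 ≤ Real.exp (-(2 * r)) * Real.exp (-(2 * r)) := by positivity
    nlinarith
  have hk : kAux r ^ j ≤ (1 + 2 * r) ^ j :=
    pow_le_pow_left₀ (by linarith [one_le_kAux hr]) (kAux_le_linear hr) j
  have hf : (1 + 2 * r) ^ (j + 1) ≤ (j + 1).factorial * Real.exp (1 + 2 * r) := by
    have := Real.pow_div_factorial_le_exp (1 + 2 * r) (by positivity) (j + 1)
    rw [div_le_iff₀ (by positivity)] at this
    linarith
  have hk0 : 0 ≤ kAux r := by linarith [one_le_kAux hr]
  calc hAux r * kAux r ^ j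
      ≤ 2 * (1 + 2 * r) * Real.exp (-(2 * r)) * (1 + 2 * r) ^ j := by
        have := hAux_pos hr
        gcongr
    _ = 2 * Real.exp (-(2 * r)) * (1 + 2 * r) ^ (j + 1) := by ring
    _ ≤ 2 * Real.exp (-(2 * r)) * ((j + 1).factorial * Real.exp (1 + 2 * r)) := by gcongr
    _ = 2 * (Real.exp (-(2 * r)) * Real.exp (1 + 2 * r)) * (j + 1).factorial := by ring
    _ = _ := by rw [← Real.exp_add]; ring_nf

lemma symbolClass_hAux_kAux (n i j : ℕ) : SymbolClass n
    (fun (l : Set.Ioi (0 : ℝ)) s => hAux (l * s) ^ (i + 1) * kAux (l * s) ^ j) := by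
  have hb : ∀ i j : ℕ, ∃ C, ∀ l : Set.Ioi (0 : ℝ), ∀ s ∈ Set.Ioo (1 / 8 : ℝ) 8,
      |hAux (l * s) ^ (i + 1) * kAux (l * s) ^ j| ≤ C := fun i j => by
    refine ⟨2 * Real.exp 1 * (j + 1).factorial, fun l s hs => ?_⟩
    have hl : 0 < (l : ℝ) * s := mul_pos l.2 (mem_region_pos hs)
    have h0 := hAux_pos hl
    have hk0 : 0 ≤ kAux (l * s) := by linarith [one_le_kAux hl]
    rw [abs_of_nonneg (by positivity)]
    refine le_trans ?_ (hAux_mul_kAux_pow_le j hl)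
    gcongr
    exact pow_le_of_le_one h0.le (hAux_le_one hl) (by simp)
  induction n generalizing i j with
  | zero => exact hb i j
  | succ n ih =>
    refine ⟨hb i j, _, fun l s hs => ?_,
      (((SymbolClass.const ((i : ℝ) + 1 + j)).mul (ih i j)).sub
        ((SymbolClass.const ((i : ℝ) + 1)).mul (ih i (j + 1)))).sub
        ((SymbolClass.const (j : ℝ)).mul (ih (i + 2) (j - 1)))⟩
    have hl : 0 < (l : ℝ) * s := mul_pos l.2 (mem_region_pos hs)
    have h1 := (hasDerivAt_hAux hl).comp_pos_mul l.2
    have h2 := (hasDerivAt_kAux hl).comp_pos_mul l.2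
    refine ((h1.pow (i + 1)).mul (h2.pow j)).congr_deriv ?_
    have hs0 := (mem_region_pos hs).ne'
    cases j with
    | zero => simp; field_simp; ring
    | succ j => simp; field_simp; ring

lemma symbolClass_gAux {β : ℝ} (hβ : 0 ≤ β) (n : ℕ) :
    SymbolClass n (fun (l : Set.Ioi (0 : ℝ)) s => gAux β (l * s)) := by
  have h0 : SymbolClass 0 (fun (l : Set.Ioi (0 : ℝ)) s => gAux β (l * s)) :=
    ⟨1, fun l s _ => by rw [abs_of_nonneg (gAux_nonneg hβ)]; exact gAux_le_one hβ⟩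
  induction n with
  | zero => exact h0
  | succ n ih =>
    refine ⟨h0, _, fun l s hs => ?_,
      ((SymbolClass.const 2).mul ih).mul ((SymbolClass.const 1).sub ih)⟩
    exact (hasDerivAt_gAux hβ (mul_pos l.2 (mem_region_pos hs))).comp_pos_mul l.2

lemma symbolClass_pAux {β : ℝ} (hβ : 0 ≤ β) (n : ℕ) :
    SymbolClass n (fun (l : Set.Ioi (0 : ℝ)) s => pAux β (l * s)) := by
  have := ((((SymbolClass.const 2).mul (symbolClass_gAux hβ n)).add
    (symbolClass_hAux_kAux n 0 0)).add (SymbolClass.const 1)).mul (SymbolClass.const (1 / 2))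
  convert this using 3
  simp [pAux]
  ring

/-- The rescaled symbol `m(λ s) / m(λ)`. -/
def mScaled (β : ℝ) (l : Set.Ioi (0 : ℝ)) (s : ℝ) : ℝ := mSymb β (l * s) / mSymb β l

/-- The function `s / mScaled'`. -/
def aScaled (β : ℝ) (l : Set.Ioi (0 : ℝ)) (s : ℝ) : ℝ :=
  s ^ 2 * (mScaled β l s)⁻¹ * (pAux β (l * s))⁻¹

lemma mScaled_pos {β : ℝ} (hβ : 0 ≤ β) (l : Set.Ioi (0 : ℝ)) {s : ℝ} (hs : 0 < s) :
    0 < mScaled β l s :=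
  div_pos (mSymb_pos hβ (mul_pos l.2 hs)) (mSymb_pos hβ l.2)

lemma hasDerivAt_mScaled {β : ℝ} (hβ : 0 ≤ β) (l : Set.Ioi (0 : ℝ)) {s : ℝ} (hs : 0 < s) :
    HasDerivAt (mScaled β l) (mScaled β l s * pAux β (l * s) / s) s := by
  refine (((hasDerivAt_mSymb hβ (mul_pos l.2 hs)).comp_pos_mul l.2).div_const _).congr_deriv ?_
  rw [mScaled]; ring

lemma hasDerivAt_deriv_mScaled {β : ℝ} (hβ : 0 ≤ β) (l : Set.Ioi (0 : ℝ)) {s : ℝ} (hs : 0 < s) :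
    HasDerivAt (fun s => mScaled β l s * pAux β (l * s) / s)
      (mScaled β l s * qAux β (l * s) / s ^ 2) s := by
  refine (((hasDerivAt_mScaled hβ l hs).mul
    ((hasDerivAt_pAux hβ (mul_pos l.2 hs)).comp_pos_mul l.2)).div (hasDerivAt_id s)
      hs.ne').congr_deriv ?_
  simp only [id_eq, qAux, Pi.mul_apply]
  field_simp
  ring

lemma symbolClass_aScaled {β : ℝ} (hβ : 0 ≤ β) (n : ℕ) : SymbolClass n (aScaled β) := by
  have hp := symbolClass_pAux hβ n
  have hν : SymbolClass n (fun (l : Set.Ioi (0 : ℝ)) s => (mScaled β l s)⁻¹) := by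
    refine SymbolClass.of_logDeriv hp.neg ⟨512, fun l s hs => ?_⟩ fun l s hs => ?_
    · have hs0 := mem_region_pos hs
      have hl : 0 < (l : ℝ) := l.2
      rw [abs_of_pos (inv_pos.2 (mScaled_pos hβ l hs0)), mScaled, inv_div,
        div_le_iff₀ (mSymb_pos hβ (mul_pos l.2 hs0))]
      exact mSymb_le_of_comparable hβ l.2 (mul_pos l.2 hs0) (by nlinarith [hs.1])
        (by nlinarith [hs.2])
    · have hs0 := mem_region_pos hs
      have := (mScaled_pos hβ l hs0).ne'
      refine ((hasDerivAt_mScaled hβ l hs0).inv this).congr_deriv ?_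
      field_simp
  exact ((SymbolClass.of_contDiff (contDiff_id.pow 2)).mul hν).mul
    (hp.inv (c := 1 / 2) (by norm_num) fun l s hs =>
      half_le_pAux hβ (mul_pos l.2 (mem_region_pos hs)))

/-- Van der Corput's second derivative test with an amplitude vanishing at the end points. -/
lemma norm_integral_exp_mul_le_of_second_deriv {a b μ ε B B' : ℝ} (hab : a ≤ b) (hμ : 0 < μ)
    (hε : ε = 1 ∨ ε = -1) {φ φ₁ φ₂ w w₁ : ℝ → ℝ}
    (hφ : ∀ r ∈ Set.Icc a b, HasDerivAt φ (φ₁ r) r)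
    (hφ₁ : ∀ r ∈ Set.Icc a b, HasDerivAt φ₁ (φ₂ r) r)
    (hφ₂ : ContinuousOn φ₂ (Set.Icc a b))
    (hlow : ∀ r ∈ Set.Icc a b, μ ≤ ε * φ₂ r)
    (hw : ∀ r ∈ Set.Icc a b, HasDerivAt w (w₁ r) r)
    (hw₁ : ContinuousOn w₁ (Set.Icc a b))
    (hB : ∀ r ∈ Set.Icc a b, |w r| ≤ B) (hB' : ∀ r ∈ Set.Icc a b, |w₁ r| ≤ B')
    (hwa : w a = 0) (hwb : w b = 0) :
    ‖∫ r in a..b, cexp (φ r * I) * w r‖ ≤ (2 * π * B + (b - a) * B' / 2) / √μ := by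
  set δ := √μ with hδdef
  have hδ : 0 < δ := Real.sqrt_pos.2 hμ
  have hδ2 : δ ^ 2 = μ := Real.sq_sqrt hμ.le
  have hB0 : 0 ≤ B := (abs_nonneg _).trans (hB a ⟨le_rfl, hab⟩)
  have hB'0 : 0 ≤ B' := (abs_nonneg _).trans (hB' a ⟨le_rfl, hab⟩)
  have hcφ : ContinuousOn φ (Set.Icc a b) := fun r hr => (hφ r hr).continuousAt.continuousWithinAt
  have hcφ₁ : ContinuousOn φ₁ (Set.Icc a b) :=
    fun r hr => (hφ₁ r hr).continuousAt.continuousWithinAt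
  have hcw : ContinuousOn w (Set.Icc a b) := fun r hr => (hw r hr).continuousAt.continuousWithinAt
  have hden : ∀ r, δ ^ 2 + φ₁ r ^ 2 ≠ 0 := fun r => by positivity
  set G : ℝ → ℝ := fun r => φ₁ r / (δ ^ 2 + φ₁ r ^ 2) with hG
  set G₁ : ℝ → ℝ := fun r => φ₂ r * (δ ^ 2 - φ₁ r ^ 2) / (δ ^ 2 + φ₁ r ^ 2) ^ 2 with hG₁
  have hdG : ∀ r ∈ Set.Icc a b, HasDerivAt G (G₁ r) r := fun r hr => by
    refine ((hφ₁ r hr).div (((hφ₁ r hr).pow 2).const_add (δ ^ 2)) (hden r)).congr_deriv ?_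
    simp only [hG₁, Pi.pow_apply]
    congr 1
    push_cast
    ring
  have hcG₁ : ContinuousOn G₁ (Set.Icc a b) :=
    (hφ₂.mul (continuousOn_const.sub (hcφ₁.pow 2))).div ((continuousOn_const.add (hcφ₁.pow 2)).pow 2)
      fun r _ => pow_ne_zero _ (hden r)
  have hcG : ContinuousOn G (Set.Icc a b) :=
    fun r hr => (hdG r hr).continuousAt.continuousWithinAt
  set Ψ₁ : ℝ → ℂ := fun r => cexp (φ r * I) * ((φ₁ r * G r * w r : ℝ) * I + (G₁ r * w r + G r * w₁ r : ℝ))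
    with hΨ₁
  have hdΨ : ∀ r ∈ Set.Icc a b, HasDerivAt (fun r => cexp (φ r * I) * ((G r * w r : ℝ) : ℂ))
      (Ψ₁ r) r := fun r hr => by
    have h1 := (((hφ r hr).ofReal_comp).mul_const I).cexp
    have h2 := ((hdG r hr).mul (hw r hr)).ofReal_comp
    refine (h1.mul h2).congr_deriv ?_
    simp only [hΨ₁, Pi.mul_apply]
    push_cast
    ring
  have hcE : ContinuousOn (fun r => cexp (φ r * I)) (Set.Icc a b) :=
    ((continuous_ofReal.comp_continuousOn hcφ).mul continuousOn_const).cexp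
  have hcΨ : ContinuousOn Ψ₁ (Set.Icc a b) := by
    refine hcE.mul (((continuous_ofReal.comp_continuousOn ((hcφ₁.mul hcG).mul hcw)).mul
      continuousOn_const).add (continuous_ofReal.comp_continuousOn ((hcG₁.mul hcw).add (hcG.mul hw₁))))
  have hcf : ContinuousOn (fun r => cexp (φ r * I) * (w r : ℂ)) (Set.Icc a b) :=
    hcE.mul (continuous_ofReal.comp_continuousOn hcw)
  have hI1 : ∫ r in a..b, Ψ₁ r = 0 := by
    rw [intervalIntegral.integral_eq_sub_of_hasDerivAt (f := fun r => cexp (φ r * I) * ((G r * w r : ℝ) : ℂ))]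
    · simp [hwa, hwb]
    · rw [Set.uIcc_of_le hab]; exact hdΨ
    · exact ContinuousOn.intervalIntegrable (by rwa [Set.uIcc_of_le hab])
  have hI2 : ∫ r in a..b, ε * φ₂ r / (δ ^ 2 + φ₁ r ^ 2) ≤ π / δ := by
    have hd : ∀ r ∈ Set.uIcc a b, HasDerivAt (fun r => ε * Real.arctan (φ₁ r / δ) / δ)
        (ε * φ₂ r / (δ ^ 2 + φ₁ r ^ 2)) r := fun r hr => by
      rw [Set.uIcc_of_le hab] at hr
      refine ((((hφ₁ r hr).div_const δ).arctan.const_mul ε).div_const δ).congr_deriv ?_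
      have := hden r
      have : 1 + (φ₁ r / δ) ^ 2 ≠ 0 := by positivity
      field_simp
    rw [intervalIntegral.integral_eq_sub_of_hasDerivAt hd]
    · rw [← sub_div]
      gcongr
      have := Real.arctan_lt_pi_div_two (φ₁ b / δ)
      have := Real.arctan_lt_pi_div_two (φ₁ a / δ)
      have := Real.neg_pi_div_two_lt_arctan (φ₁ b / δ)
      have := Real.neg_pi_div_two_lt_arctan (φ₁ a / δ)
      rcases hε with rfl | rfl <;> linarith
    · refine ContinuousOn.intervalIntegrable ?_
      rw [Set.uIcc_of_le hab]
      exact (continuousOn_const.mul hφ₂).div (continuousOn_const.add (hcφ₁.pow 2)) fun r _ => hden r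
  have hpt : ∀ r ∈ Set.Icc a b, ‖cexp (φ r * I) * (w r : ℂ) + I * Ψ₁ r‖ ≤
      2 * B * (ε * φ₂ r / (δ ^ 2 + φ₁ r ^ 2)) + B' / (2 * δ) := fun r hr => by
    have hD : 0 < δ ^ 2 + φ₁ r ^ 2 := by positivity
    have hl := hlow r hr
    have hφa : |φ₂ r| = ε * φ₂ r := by
      rcases hε with rfl | rfl
      · rw [one_mul, abs_of_nonneg (by linarith)]
      · rw [abs_of_nonpos (by linarith)]; ring
    have e1 : cexp (φ r * I) * (w r : ℂ) + I * Ψ₁ r = cexp (φ r * I) *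
        (((δ ^ 2 / (δ ^ 2 + φ₁ r ^ 2) * w r : ℝ) : ℂ) + I * ((G₁ r * w r + G r * w₁ r : ℝ) : ℂ)) := by
      have : δ ^ 2 / (δ ^ 2 + φ₁ r ^ 2) = 1 - φ₁ r * G r := by
        simp only [hG]; field_simp; ring
      rw [this, hΨ₁]
      push_cast
      linear_combination cexp (φ r * I) * φ₁ r * G r * w r * I_sq
    rw [e1, norm_mul, norm_exp_ofReal_mul_I, one_mul]
    refine (norm_add_le _ _).trans ?_
    rw [norm_mul, norm_I, one_mul, norm_real, norm_real, Real.norm_eq_abs, Real.norm_eq_abs]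
    have a1 : |δ ^ 2 / (δ ^ 2 + φ₁ r ^ 2) * w r| ≤ ε * φ₂ r / (δ ^ 2 + φ₁ r ^ 2) * B := by
      rw [abs_mul, abs_of_nonneg (by positivity)]
      gcongr
      · exact div_nonneg (by linarith) hD.le
      · linarith
      · exact hB r hr
    have a2 : |G₁ r * w r| ≤ ε * φ₂ r / (δ ^ 2 + φ₁ r ^ 2) * B := by
      rw [abs_mul]
      refine mul_le_mul ?_ (hB r hr) (abs_nonneg _) (div_nonneg (by linarith) hD.le)
      simp only [hG₁]
      rw [abs_div, abs_mul, hφa, abs_of_pos (pow_pos hD 2), div_le_div_iff₀ (pow_pos hD 2) hD]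
      have : |δ ^ 2 - φ₁ r ^ 2| ≤ δ ^ 2 + φ₁ r ^ 2 :=
        abs_le.2 ⟨by nlinarith, by nlinarith [sq_nonneg (φ₁ r)]⟩
      calc ε * φ₂ r * |δ ^ 2 - φ₁ r ^ 2| * (δ ^ 2 + φ₁ r ^ 2)
          ≤ ε * φ₂ r * (δ ^ 2 + φ₁ r ^ 2) * (δ ^ 2 + φ₁ r ^ 2) := by
            have : 0 ≤ ε * φ₂ r := by linarith
            gcongr
        _ = _ := by ring
    have a3 : |G r * w₁ r| ≤ 1 / (2 * δ) * B' := by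
      rw [abs_mul]
      refine mul_le_mul ?_ (hB' r hr) (abs_nonneg _) (by positivity)
      simp only [hG]
      rw [abs_div, abs_of_pos hD, div_le_div_iff₀ hD (by positivity)]
      nlinarith [sq_nonneg (δ - |φ₁ r|), sq_abs (φ₁ r)]
    have a4 := abs_add_le (G₁ r * w r) (G r * w₁ r)
    have : B' / (2 * δ) = 1 / (2 * δ) * B' := by ring
    rw [this]
    linarith
  have hint : IntervalIntegrable (fun r => ε * φ₂ r / (δ ^ 2 + φ₁ r ^ 2)) volume a b := by
    refine ContinuousOn.intervalIntegrable ?_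
    rw [Set.uIcc_of_le hab]
    exact (continuousOn_const.mul hφ₂).div (continuousOn_const.add (hcφ₁.pow 2)) fun r _ => hden r
  have hE : ∫ r in a..b, cexp (φ r * I) * (w r : ℂ) =
      ∫ r in a..b, (cexp (φ r * I) * (w r : ℂ) + I * Ψ₁ r) := by
    rw [intervalIntegral.integral_add, intervalIntegral.integral_const_mul, hI1]
    · simp
    · exact ContinuousOn.intervalIntegrable (by rwa [Set.uIcc_of_le hab])
    · exact ContinuousOn.intervalIntegrable (by rw [Set.uIcc_of_le hab]; exact continuousOn_const.mul hcΨ)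
  rw [hE]
  refine (intervalIntegral.norm_integral_le_of_norm_le hab
    (Filter.Eventually.of_forall fun r hr => hpt r ⟨hr.1.le, hr.2⟩)
    ((hint.const_mul _).add intervalIntegrable_const)).trans ?_
  rw [intervalIntegral.integral_add (hint.const_mul _) intervalIntegrable_const,
    intervalIntegral.integral_const_mul, intervalIntegral.integral_const, smul_eq_mul]
  have : (2 * π * B + (b - a) * B' / 2) / δ = 2 * B * (π / δ) + (b - a) * (B' / (2 * δ)) := by
    field_simp
  rw [this]
  gcongr

/-! ### Radial kernels -/

/-- Profiles supported in `[1/4, 4]`. -/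
def VanishOff (W : ℝ → ℂ) : Prop := ∀ s ∉ Set.Icc (1 / 4 : ℝ) 4, W s = 0

lemma VanishOff.hasCompactSupport_norm {E : Type*} [NormedAddCommGroup E] [ProperSpace E]
    {W : ℝ → ℂ} (hv : VanishOff W) : HasCompactSupport (fun ξ : E => W ‖ξ‖) :=
  HasCompactSupport.intro (isCompact_closedBall (0 : E) 4) fun ξ hξ => hv _ fun h => hξ (by
    simpa using h.2)

section RadialKernel

variable {V V' : Type*} [NormedAddCommGroup V] [InnerProductSpace ℝ V] [FiniteDimensional ℝ V]
  [MeasurableSpace V] [BorelSpace V]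
  [NormedAddCommGroup V'] [InnerProductSpace ℝ V'] [FiniteDimensional ℝ V']
  [MeasurableSpace V'] [BorelSpace V']

/-- The inverse Fourier transform of the radial function with profile `W`. -/
def radK (V : Type*) [NormedAddCommGroup V] [InnerProductSpace ℝ V] [FiniteDimensional ℝ V]
    [MeasurableSpace V] [BorelSpace V] (W : ℝ → ℂ) (x : V) : ℂ :=
  𝓕⁻ (fun ξ : V => W ‖ξ‖) x

lemma radK_map (L : V ≃ₗᵢ[ℝ] V') (W : ℝ → ℂ) (x : V) : radK V' W (L x) = radK V W x := by
  have : (fun ξ : V => W ‖ξ‖) = (fun ξ : V' => W ‖ξ‖) ∘ L := by ext; simp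
  rw [radK, radK, ← Real.fourierInv_comp_linearIsometry, this]

lemma radK_eq_of_norm_eq (h : Module.finrank ℝ V = Module.finrank ℝ V') (W : ℝ → ℂ) {x : V} {y : V'}
    (hxy : ‖x‖ = ‖y‖) : radK V W x = radK V' W y := by
  let L : V ≃ₗᵢ[ℝ] V' := (stdOrthonormalBasis ℝ V).equiv (stdOrthonormalBasis ℝ V')
    (finCongr h)
  have h1 : ‖L x‖ = ‖y‖ := by rw [L.norm_map, hxy]
  have h2 := Submodule.reflection_sub h1
  rw [← radK_map L W x, ← radK_map (Submodule.reflection (Submodule.span ℝ {L x - y})ᗮ) W (L x), h2]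

lemma fourierInv_toLp_prod {f : WithLp 2 (V × V') → ℂ} (hf : Integrable f) (y : V) (z : V') :
    𝓕⁻ f (WithLp.toLp 2 (y, z)) =
      𝓕⁻ (fun ζ => 𝓕⁻ (fun η => f (WithLp.toLp 2 (ζ, η))) z) y := by
  have hmp := WithLp.volume_preserving_toLp V V'
  have hemb : MeasurableEmbedding (WithLp.toLp 2 : V × V' → WithLp 2 (V × V')) :=
    (MeasurableEquiv.toLp 2 (V × V')).measurableEmbedding
  rw [Real.fourierInv_eq, ← hmp.integral_comp hemb]
  have hint : Integrable (fun p : V × V' => 𝐞 (inner ℝ (WithLp.toLp 2 p) (WithLp.toLp 2 (y, z))) •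
      f (WithLp.toLp 2 p)) := by
    have h1 : Integrable (fun v : WithLp 2 (V × V') =>
        𝐞 (inner ℝ v (WithLp.toLp 2 (y, z))) • f v) := by
      have := (Real.fourierIntegral_convergent_iff (μ := volume) (f := f)
        (-(WithLp.toLp 2 (y, z)))).2 hf
      simpa using this
    exact (hmp.integrable_comp_emb hemb).2 h1
  rw [Measure.volume_eq_prod] at hint ⊢
  rw [integral_prod _ hint, Real.fourierInv_eq]
  congr 1
  ext ζ
  rw [Real.fourierInv_eq, Circle.smul_def, smul_eq_mul, ← integral_const_mul]
  congr 1
  ext η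
  simp only [Circle.smul_def, smul_eq_mul, WithLp.prod_inner_apply, AddChar.map_add_eq_mul,
    Circle.coe_mul]
  ring

lemma VanishOff.hasCompactSupport {W : ℝ → ℂ} (hv : VanishOff W) : HasCompactSupport W :=
  HasCompactSupport.intro isCompact_Icc hv

lemma VanishOff.integrable_norm {W : ℝ → ℂ} (hv : VanishOff W) (hW : Continuous W) :
    Integrable (fun ξ : V => W ‖ξ‖) :=
  (hW.comp continuous_norm).integrable_of_hasCompactSupport hv.hasCompactSupport_norm

lemma VanishOff.bounded {W : ℝ → ℂ} (hv : VanishOff W) (hW : Continuous W) :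
    ∃ C, ∀ s, ‖W s‖ ≤ C :=
  hv.hasCompactSupport.exists_bound_of_continuous hW

lemma integral_Ioi_mul_sqrt {W : ℝ → ℂ} (hW : Continuous W) (hv : VanishOff W) {a : ℝ}
    (ha : 0 ≤ a) :
    ∫ y in Set.Ioi (0 : ℝ), (y : ℂ) * W (√(a ^ 2 + y ^ 2)) = ∫ r in Set.Ioi a, (r : ℂ) * W r := by
  have hf0 : √(a ^ 2 + 0 ^ 2) = a := by simp [Real.sqrt_sq ha]
  have key := integral_deriv_smul_comp_Ioi (f := fun y : ℝ => √(a ^ 2 + y ^ 2))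
    (f' := fun y => y / √(a ^ 2 + y ^ 2)) (g := fun r : ℝ => (r : ℂ) * W r) (a := 0)
    (by fun_prop) ?_ ?_ (by fun_prop) ?_ ?_
  · rw [hf0] at key
    rw [← key]
    refine setIntegral_congr_fun measurableSet_Ioi fun y hy => ?_
    have : 0 < √(a ^ 2 + y ^ 2) := Real.sqrt_pos.2 (by have : 0 < y := hy; positivity)
    have h' : ((√(a ^ 2 + y ^ 2) : ℝ) : ℂ) ≠ 0 := by exact_mod_cast this.ne'
    simp only [Function.comp_apply, real_smul]
    push_cast
    field_simp
  · refine Filter.tendsto_atTop_mono (fun y => ?_) Filter.tendsto_id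
    exact Real.le_sqrt_of_sq_le (by simp only [id]; nlinarith)
  · intro y hy
    have hy' : 0 < y := hy
    have h0 : a ^ 2 + y ^ 2 ≠ 0 := by positivity
    refine HasDerivAt.hasDerivWithinAt ((((hasDerivAt_pow 2 y).const_add (a ^ 2)).sqrt h0).congr_deriv ?_)
    simp; field_simp
  · refine Integrable.integrableOn (Continuous.integrable_of_hasCompactSupport (by fun_prop) ?_)
    exact hv.hasCompactSupport.mul_left
  · have hI : IntegrableOn (fun y : ℝ => (y : ℂ) * W (√(a ^ 2 + y ^ 2))) (Set.Ici 0) := by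
      refine Integrable.integrableOn (Continuous.integrable_of_hasCompactSupport (by fun_prop) ?_)
      refine HasCompactSupport.mul_left
        (HasCompactSupport.intro (isCompact_Icc (a := (-4 : ℝ)) (b := 4)) fun y hy => ?_)
      refine hv _ fun h => hy ?_
      have h4 := h.2
      rw [Real.sqrt_le_left (by norm_num)] at h4
      exact abs_le.1 (abs_le_of_sq_le_sq (by nlinarith) (by norm_num))
    rw [integrableOn_Ici_iff_integrableOn_Ioi] at hI ⊢
    refine hI.congr_fun (fun y hy => ?_) measurableSet_Ioi
    have : 0 < √(a ^ 2 + y ^ 2) := Real.sqrt_pos.2 (by have : 0 < y := hy; positivity)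
    have h' : ((√(a ^ 2 + y ^ 2) : ℝ) : ℂ) ≠ 0 := by exact_mod_cast this.ne'
    simp only [Function.comp_apply, real_smul]
    push_cast
    field_simp

/-- The profile whose radial kernel in dimension `n` is that of `W` in dimension `n + 2`. -/
def descend (W : ℝ → ℂ) (a : ℝ) : ℂ := 2 * π * ∫ r in Set.Ioi a, (r : ℂ) * W r

lemma integral_complex_norm (f : ℝ → ℂ) :
    ∫ η : ℂ, f ‖η‖ = 2 * π * ∫ y in Set.Ioi (0 : ℝ), (y : ℂ) * f y := by
  rw [integral_fun_norm_addHaar volume f]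
  simp [Measure.real, Complex.volume_ball]
  ring

lemma radK_eq_radK_descend (h : Module.finrank ℝ V' = Module.finrank ℝ V + 2)
    {W : ℝ → ℂ} (hW : Continuous W) (hv : VanishOff W) {x : V'} {y : V} (hxy : ‖x‖ = ‖y‖) :
    radK V' W x = radK V (descend W) y := by
  have hnorm : ∀ (ζ : V) (η : ℂ), ‖(WithLp.toLp 2 (ζ, η) : WithLp 2 (V × ℂ))‖ =
      √(‖ζ‖ ^ 2 + ‖η‖ ^ 2) := fun ζ η => by
    rw [WithLp.prod_norm_eq_of_L2]; rfl
  have hfin : Module.finrank ℝ V' = Module.finrank ℝ (WithLp 2 (V × ℂ)) := by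
    rw [h, (WithLp.linearEquiv 2 ℝ (V × ℂ)).finrank_eq, Module.finrank_prod,
      Complex.finrank_real_complex]
  rw [radK_eq_of_norm_eq hfin W (y := WithLp.toLp 2 (y, 0)) (by rw [hnorm, hxy]; simp), radK,
    fourierInv_toLp_prod (hv.integrable_norm hW), radK]
  refine congrArg (fun F : V → ℂ => 𝓕⁻ F y) (funext fun ζ => ?_)
  rw [Real.fourierInv_eq]
  simp only [inner_zero_right, AddChar.map_zero_eq_one, one_smul, hnorm]
  rw [integral_complex_norm (fun s => W (√(‖ζ‖ ^ 2 + s ^ 2))), descend,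
    integral_Ioi_mul_sqrt hW hv (norm_nonneg ζ)]

lemma norm_radK_integral_Ioi_le [Nontrivial V] {f : ℝ → ℂ} (hf : Continuous f) (hv : VanishOff f)
    {B : ℝ} (hB : ∀ x : V, ‖radK V f x‖ ≤ B) (x : V) :
    ‖radK V (fun a => ∫ s in Set.Ioi a, f s / s) x‖ ≤ B := by
  set n := Module.finrank ℝ V with hn
  have hn1 : 1 ≤ n := Module.finrank_pos
  have hB0 : 0 ≤ B := (norm_nonneg _).trans (hB 0)
  set H : V → ℝ → ℂ := fun ξ θ => (𝐞 (inner ℝ ξ x) : ℂ) * (f (‖ξ‖ * θ) / θ) with hH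
  have e1 : radK V (fun a => ∫ s in Set.Ioi a, f s / s) x = ∫ ξ, ∫ θ in Set.Ioi (1 : ℝ), H ξ θ := by
    rw [radK, Real.fourierInv_eq]
    refine integral_congr_ae ?_
    filter_upwards [(volume : Measure V).ae_ne 0] with ξ hξ
    have hb : 0 < ‖ξ‖ := norm_pos_iff.2 hξ
    rw [Circle.smul_def, smul_eq_mul, integral_const_mul]
    congr 1
    have := integral_comp_mul_left_Ioi (fun s : ℝ => f s / s) 1 hb
    rw [mul_one] at this
    have h2 : ∫ s in Set.Ioi ‖ξ‖, f s / s =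
        (‖ξ‖ : ℂ) * ∫ θ in Set.Ioi (1 : ℝ), f (‖ξ‖ * θ) / ((‖ξ‖ * θ : ℝ) : ℂ) := by
      rw [this, real_smul, ← mul_assoc]
      have : (‖ξ‖ : ℂ) ≠ 0 := by exact_mod_cast hb.ne'
      push_cast
      rw [mul_inv_cancel₀ this, one_mul]
    rw [h2, ← integral_const_mul]
    congr 1
    ext θ
    have : (‖ξ‖ : ℂ) ≠ 0 := by exact_mod_cast hb.ne'
    push_cast
    rw [mul_div_assoc', mul_div_mul_left _ _ this]
  have e2 : ∀ θ ∈ Set.Ioi (1 : ℝ), ∫ ξ, H ξ θ = (θ : ℂ)⁻¹ * ((θ : ℂ) ^ n)⁻¹ * radK V f (θ⁻¹ • x) := by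
    intro θ hθ
    have hθ0 : 0 < θ := zero_lt_one.trans hθ
    have := Measure.integral_comp_smul (volume : Measure V)
      (fun η : V => (𝐞 (inner ℝ η (θ⁻¹ • x)) : ℂ) * f ‖η‖) θ
    have h3 : ∀ ξ, H ξ θ = (θ : ℂ)⁻¹ *
        ((𝐞 (inner ℝ (θ • ξ) (θ⁻¹ • x)) : ℂ) * f ‖θ • ξ‖) := fun ξ => by
      rw [inner_smul_left, inner_smul_right, norm_smul, Real.norm_of_nonneg hθ0.le, hH]
      simp only [conj_trivial]
      rw [← mul_assoc θ, mul_inv_cancel₀ hθ0.ne', one_mul, mul_comm ‖ξ‖]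
      ring
    simp_rw [h3]
    rw [integral_const_mul, this, radK, Real.fourierInv_eq, ← hn, abs_of_pos (by positivity)]
    simp only [Circle.smul_def, smul_eq_mul, real_smul]
    push_cast
    ring
  have e3 : ∀ θ ∈ Set.Ioi (1 : ℝ), ∫ ξ, ‖H ξ θ‖ = θ ^ (-(n + 1 : ℝ)) * ∫ η : V, ‖f ‖η‖‖ := by
    intro θ hθ
    have hθ0 : 0 < θ := zero_lt_one.trans hθ
    have := Measure.integral_comp_smul (volume : Measure V) (fun η : V => ‖f ‖η‖‖) θ
    have h3 : ∀ ξ, ‖H ξ θ‖ = θ⁻¹ * ‖f ‖θ • ξ‖‖ := fun ξ => by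
      rw [hH, norm_smul, Real.norm_of_nonneg hθ0.le]
      simp only [norm_mul, norm_div, Circle.norm_coe, one_mul, norm_real,
        Real.norm_of_nonneg hθ0.le, mul_comm ‖ξ‖]
      ring
    simp_rw [h3]
    rw [integral_const_mul, this, ← hn, abs_of_pos (by positivity), Real.rpow_neg hθ0.le,
      Real.rpow_add hθ0, Real.rpow_natCast, Real.rpow_one, smul_eq_mul]
    ring
  have hpow : IntegrableOn (fun θ : ℝ => θ ^ (-(n + 1 : ℝ))) (Set.Ioi 1) :=
    integrableOn_Ioi_rpow_of_lt (by have : (1 : ℝ) ≤ n := by exact_mod_cast hn1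
                                    linarith) one_pos
  have hint : Integrable (Function.uncurry H) (volume.prod (volume.restrict (Set.Ioi 1))) := by
    have hm : AEStronglyMeasurable (Function.uncurry H)
        ((volume : Measure V).prod (volume.restrict (Set.Ioi (1 : ℝ)))) := by
      refine Measurable.aestronglyMeasurable ?_
      have h1 : Continuous (fun p : V × ℝ => (𝐞 (inner ℝ p.1 x) : ℂ) * f (‖p.1‖ * p.2)) := by
        fun_prop
      have h2 : Measurable (fun p : V × ℝ => (p.2 : ℂ)) := by fun_prop
      have h3 : Function.uncurry H = (fun p : V × ℝ =>
          (𝐞 (inner ℝ p.1 x) : ℂ) * f (‖p.1‖ * p.2)) / fun p => (p.2 : ℂ) := by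
        ext p
        simp only [Function.uncurry, hH, Pi.div_apply]
        ring
      rw [h3]
      exact h1.measurable.div h2
    rw [integrable_prod_iff' hm]
    constructor
    · filter_upwards [ae_restrict_mem measurableSet_Ioi] with θ hθ
      have hθ0 : 0 < θ := zero_lt_one.trans hθ
      refine Continuous.integrable_of_hasCompactSupport ?_ ?_
      · simp only [Function.uncurry, hH]
        fun_prop
      · refine HasCompactSupport.intro (isCompact_closedBall (0 : V) 4) fun ξ hξ => ?_
        have : f (‖ξ‖ * θ) = 0 := hv _ fun h => hξ (by
          have h1 := h.2
          have h2 : 1 < θ := hθ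
          simp only [mem_closedBall_zero_iff]
          nlinarith [norm_nonneg ξ])
        simp [Function.uncurry, hH, this]
    · have : IntegrableOn (fun θ : ℝ => θ ^ (-(n + 1 : ℝ)) * ∫ η : V, ‖f ‖η‖‖) (Set.Ioi 1) :=
        hpow.mul_const _
      exact this.congr_fun (fun θ hθ => (e3 θ hθ).symm) measurableSet_Ioi
  rw [e1, integral_integral_swap hint, setIntegral_congr_fun measurableSet_Ioi e2]
  have hI2 : IntegrableOn (fun θ : ℝ => θ ^ (-2 : ℝ)) (Set.Ioi 1) :=
    integrableOn_Ioi_rpow_of_lt (by norm_num) one_pos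
  refine (norm_integral_le_of_norm_le (hI2.mul_const B) ?_).trans ?_
  · filter_upwards [ae_restrict_mem measurableSet_Ioi] with θ hθ
    have hθ1 : 1 < θ := hθ
    have hθ0 : 0 < θ := zero_lt_one.trans hθ1
    rw [norm_mul]
    refine mul_le_mul ?_ (hB _) (norm_nonneg _) (by positivity)
    rw [norm_mul, norm_inv, norm_inv, norm_pow, norm_real, Real.norm_of_nonneg hθ0.le,
      Real.rpow_neg hθ0.le, ← mul_inv]
    refine inv_anti₀ (by positivity) ?_
    have := le_self_pow₀ hθ1.le (show n ≠ 0 by omega)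
    rw [Real.rpow_two]
    nlinarith
  · rw [integral_mul_const, integral_Ioi_rpow_of_lt (by norm_num) one_pos]
    norm_num

end RadialKernel

/-! ### The two-dimensional kernel -/

section DimensionTwo

variable {W : ℝ → ℂ}

lemma VanishOff.apply_abs (hv : VanishOff W) (v : ℝ) : W |v| = W v + W (-v) := by
  have h0 : ∀ s ≤ 0, W s = 0 := fun s hs => hv s fun h => by have := h.1; linarith
  rcases le_total 0 v with h | h
  · rw [abs_of_nonneg h, h0 (-v) (by linarith), add_zero]
  · rw [abs_of_nonpos h, h0 v h, zero_add]

lemma hasDerivAt_descend_abs (hW : Continuous W) (hv : VanishOff W) (v : ℝ) :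
    HasDerivAt (fun v => descend W |v|) (-(2 * π) * (v * W |v|)) v := by
  set g : ℝ → ℂ := fun r => (r : ℂ) * W |r| with hg
  have hgc : Continuous g := by fun_prop
  have hgi : IntegrableOn (fun r : ℝ => (r : ℂ) * W r) (Set.Ioi 0) :=
    Integrable.integrableOn (Continuous.integrable_of_hasCompactSupport (by fun_prop)
      hv.hasCompactSupport.mul_left)
  have hodd : ∀ r, g (-r) = -g r := fun r => by simp [hg]
  have hQ : (fun v : ℝ => descend W |v|) =
      fun v => 2 * π * ((∫ r in Set.Ioi (0 : ℝ), (r : ℂ) * W r) - ∫ r in (0 : ℝ)..v, g r) := by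
    ext v
    have h1 : ∫ r in (0 : ℝ)..|v|, g r = ∫ r in (0 : ℝ)..v, g r := by
      rcases le_total 0 v with h | h
      · rw [abs_of_nonneg h]
      · rw [abs_of_nonpos h]
        have := intervalIntegral.integral_comp_neg (a := 0) (b := v) g
        simp only [hodd, neg_zero, intervalIntegral.integral_neg] at this
        rw [intervalIntegral.integral_symm, ← this, neg_neg]
    have h2 : ∫ r in (0 : ℝ)..|v|, g r = ∫ r in (0 : ℝ)..|v|, (r : ℂ) * W r := by
      refine intervalIntegral.integral_congr fun r hr => ?_
      rw [Set.uIcc_of_le (abs_nonneg v)] at hr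
      simp only [hg, abs_of_nonneg hr.1]
    rw [← h1, h2, descend, ← intervalIntegral.integral_interval_add_Ioi hgi
      (hgi.mono_set (Set.Ioi_subset_Ioi (abs_nonneg v)))]
    ring
  rw [hQ]
  refine (((hgc.integral_hasStrictDerivAt 0 v).hasDerivAt.const_sub _).const_mul _).congr_deriv ?_
  simp only [hg]
  ring

lemma VanishOff.hasCompactSupport_descend_abs (hv : VanishOff W) :
    HasCompactSupport (fun v : ℝ => descend W |v|) := by
  refine HasCompactSupport.intro (isCompact_Icc (a := (-4 : ℝ)) (b := 4)) fun v hv' => ?_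
  have h4 : 4 < |v| := by
    by_contra! h
    exact hv' (abs_le.1 h)
  rw [descend, setIntegral_eq_zero_of_forall_eq_zero, mul_zero]
  intro r hr
  have : |v| < r := hr
  rw [hv r fun h => by linarith [h.2], mul_zero]

lemma radK_real_eq_fourier (W : ℝ → ℂ) : radK ℝ W = 𝓕 (fun v : ℝ => W |v|) := by
  ext x
  simp only [radK, Real.norm_eq_abs]
  rw [Real.fourierInv_eq_fourier_comp_neg]
  simp only [abs_neg]

lemma continuous_radK_real_descend (hW : Continuous W) (hv : VanishOff W) :
    Continuous (radK ℝ (descend W)) := by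
  rw [radK_real_eq_fourier]
  refine VectorFourier.fourierIntegral_continuous Real.continuous_fourierChar (by fun_prop) ?_
  exact Continuous.integrable_of_hasCompactSupport
    (continuous_iff_continuousAt.2 fun v => (hasDerivAt_descend_abs hW hv v).continuousAt)
    hv.hasCompactSupport_descend_abs

lemma hasDerivAt_radK_real (hW : Continuous W) (hv : VanishOff W) (ρ : ℝ) :
    HasDerivAt (radK ℝ W) (-(2 * π * ρ) * radK ℝ (descend W) ρ) ρ := by
  have hQd := hasDerivAt_descend_abs hW hv
  have hderiv : deriv (fun v => descend W |v|) = fun v : ℝ => -(2 * π) * ((v : ℂ) * W |v|) :=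
    funext fun v => (hQd v).deriv
  have hfi : Integrable (fun v : ℝ => W |v|) := hv.integrable_norm (V := ℝ) hW
  have hcs : HasCompactSupport (fun v : ℝ => W |v|) := hv.hasCompactSupport_norm (E := ℝ)
  have hvi : Integrable (fun v : ℝ => (v : ℂ) * W |v|) :=
    Continuous.integrable_of_hasCompactSupport (by fun_prop) hcs.mul_left
  have h1 := Real.hasDerivAt_fourier hfi (by simpa using hvi) ρ
  rw [radK_real_eq_fourier, radK_real_eq_fourier]
  refine h1.congr_deriv ?_
  have h2 := congrFun (Real.fourier_deriv (Continuous.integrable_of_hasCompactSupport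
    (continuous_iff_continuousAt.2 fun v => (hQd v).continuousAt)
    hv.hasCompactSupport_descend_abs) (fun v => (hQd v).differentiableAt)
    (by rw [hderiv]; exact hvi.const_mul _)) ρ
  have h3 : 𝓕 (fun v : ℝ => (-2 * π * I * v) • W |v|) ρ =
      I * 𝓕 (deriv (fun v => descend W |v|)) ρ := by
    rw [hderiv, Real.fourier_eq, Real.fourier_eq, ← integral_const_mul]
    congr 1
    ext v
    simp only [Circle.smul_def, smul_eq_mul]
    ring
  rw [h3, h2, smul_eq_mul]
  linear_combination (2 * π * ρ * 𝓕 (fun v : ℝ => descend W |v|) ρ) * I_sq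

lemma exists_radK_real_descend_decay (hW : ContDiff ℝ 1 W) (hv : VanishOff W) :
    ∃ A, ∀ ρ : ℝ, ρ ^ 2 * ‖radK ℝ (descend W) ρ‖ ≤ A := by
  have hQd := hasDerivAt_descend_abs hW.continuous hv
  have hcs : HasCompactSupport (fun v : ℝ => W |v|) := hv.hasCompactSupport_norm (E := ℝ)
  have hderiv : deriv (fun v => descend W |v|) = fun v : ℝ => -(2 * π) * ((v : ℂ) * W |v|) :=
    funext fun v => (hQd v).deriv
  set Q₁ : ℝ → ℂ := fun v : ℝ => -(2 * π) * ((v : ℂ) * W |v|) with hQ₁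
  have hQ₁c : ContDiff ℝ 1 Q₁ := by
    have : Q₁ = fun v : ℝ => -(2 * π) * ((v : ℂ) * (W v + W (-v))) := by
      ext v; simp only [hQ₁, hv.apply_abs]
    rw [this]
    have h1 : ContDiff ℝ 1 (fun v : ℝ => (v : ℂ)) := ofRealCLM.contDiff
    exact contDiff_const.mul (h1.mul (hW.add (hW.comp contDiff_neg)))
  have hQ₁s : HasCompactSupport Q₁ := (hcs.mul_left (f := fun v : ℝ => (v : ℂ))).mul_left
  have hQi : Integrable (fun v => descend W |v|) := Continuous.integrable_of_hasCompactSupport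
    (continuous_iff_continuousAt.2 fun v => (hQd v).continuousAt) hv.hasCompactSupport_descend_abs
  have hQ₁i := hQ₁c.continuous.integrable_of_hasCompactSupport (μ := volume) hQ₁s
  have hQ₂i := (hQ₁c.continuous_deriv le_rfl).integrable_of_hasCompactSupport (μ := volume)
    hQ₁s.deriv
  have h1 := Real.fourier_deriv hQi (fun v => (hQd v).differentiableAt) (by rw [hderiv]; exact hQ₁i)
  have h2 := Real.fourier_deriv hQ₁i (hQ₁c.differentiable one_ne_zero) hQ₂i
  rw [hderiv] at h1
  refine ⟨∫ v, ‖deriv Q₁ v‖, fun ρ => ?_⟩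
  have h3 : ‖𝓕 (deriv Q₁) ρ‖ ≤ ∫ v, ‖deriv Q₁ v‖ :=
    VectorFourier.norm_fourierIntegral_le_integral_norm _ _ _ _ _
  refine le_trans ?_ h3
  rw [h2, h1, radK_real_eq_fourier]
  beta_reduce
  rw [smul_smul, norm_smul]
  gcongr
  simp only [norm_mul, norm_real, norm_I, Complex.norm_ofNat, Real.norm_eq_abs, mul_one]
  have hpi := Real.two_le_pi
  rw [abs_of_pos Real.pi_pos]
  have h4 : |ρ| ≤ 2 * π * |ρ| := by nlinarith [abs_nonneg ρ]
  rw [← sq_abs ρ, sq]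
  gcongr

lemma norm_sqrt_sq_add_sq_toLp {V : Type*} [NormedAddCommGroup V] (b : ℝ) (ζ : V) :
    ‖(WithLp.toLp 2 (b, ζ) : WithLp 2 (ℝ × V))‖ = √(b ^ 2 + ‖ζ‖ ^ 2) := by
  rw [WithLp.prod_norm_eq_of_L2]
  change √(‖b‖ ^ 2 + ‖ζ‖ ^ 2) = _
  rw [Real.norm_eq_abs, sq_abs]

/-- The planar kernel as an integral of the kernel in dimension three. -/
lemma radK_two_eq_integral (hW : ContDiff ℝ 1 W) (hv : VanishOff W) (y : Euc 2) :
    Integrable (fun h : ℝ => radK ℝ (descend W) (√(h ^ 2 + ‖y‖ ^ 2))) ∧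
    radK (Euc 2) W y = ∫ h : ℝ, radK ℝ (descend W) (√(h ^ 2 + ‖y‖ ^ 2)) := by
  have hWc := hW.continuous
  set G : ℝ → ℂ := fun b => 𝓕⁻ (fun ζ : Euc 2 => W (√(b ^ 2 + ‖ζ‖ ^ 2))) y with hG
  set E : ℝ → ℂ := fun h => radK ℝ (descend W) (√(h ^ 2 + ‖y‖ ^ 2)) with hE
  have hsq : ∀ b t : ℝ, 4 < |b| → W (√(b ^ 2 + t ^ 2)) = 0 := fun b t hb => by
    refine hv _ fun h => ?_
    have := Real.abs_le_sqrt (show b ^ 2 ≤ b ^ 2 + t ^ 2 by nlinarith)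
    linarith [h.2]
  have hsq' : ∀ b t : ℝ, 4 < |t| → W (√(b ^ 2 + t ^ 2)) = 0 := fun b t hb => by
    rw [add_comm]; exact hsq t b hb
  have hGinv : 𝓕⁻ G = E := by
    ext h
    have h1 := fourierInv_toLp_prod (V := ℝ) (V' := Euc 2)
      (hv.integrable_norm (V := WithLp 2 (ℝ × Euc 2)) hWc) h y
    simp only [norm_sqrt_sq_add_sq_toLp] at h1
    rw [hG, ← h1, hE]
    refine radK_eq_radK_descend ?_ hWc hv ?_
    · rw [(WithLp.linearEquiv 2 ℝ (ℝ × Euc 2)).finrank_eq, Module.finrank_prod]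
      simp
    · rw [norm_sqrt_sq_add_sq_toLp, Real.norm_eq_abs, abs_of_nonneg (Real.sqrt_nonneg _)]
  have hGc : Continuous G := by
    obtain ⟨C, hC⟩ := hv.bounded hWc
    have hG' : G = fun b => ∫ ζ : Euc 2, 𝐞 (inner ℝ ζ y) • W (√(b ^ 2 + ‖ζ‖ ^ 2)) := by
      ext b; rw [hG]; exact Real.fourierInv_eq _ _
    rw [hG']
    refine continuous_of_dominated
      (bound := (Metric.closedBall (0 : Euc 2) 4).indicator fun _ => C) (fun b => ?_)
      (fun b => Filter.Eventually.of_forall fun ζ => ?_) ?_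
      (Filter.Eventually.of_forall fun ζ => ?_)
    · exact Continuous.aestronglyMeasurable (by simp only [Circle.smul_def]; fun_prop)
    · rw [Circle.norm_smul]
      by_cases hζ : ζ ∈ Metric.closedBall (0 : Euc 2) 4
      · rw [Set.indicator_of_mem hζ]; exact hC _
      · rw [Set.indicator_of_notMem hζ, hsq' _ _ (by simpa using hζ), norm_zero]
    · exact (integrable_indicator_iff measurableSet_closedBall).2
        (integrableOn_const (by exact measure_closedBall_lt_top.ne))
    · simp only [Circle.smul_def]; fun_prop
  have hGi : Integrable G := by
    refine hGc.integrable_of_hasCompactSupport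
      (HasCompactSupport.intro (isCompact_Icc (a := (-4 : ℝ)) (b := 4)) fun b hb => ?_)
    have hb' : 4 < |b| := by
      by_contra! h
      exact hb (abs_le.1 h)
    simp only [hG, hsq _ _ hb']
    rw [Real.fourierInv_eq]
    simp
  have hκc := continuous_radK_real_descend hWc hv
  have hEc : Continuous E := by
    have : Continuous fun h : ℝ => √(h ^ 2 + ‖y‖ ^ 2) := by fun_prop
    exact hκc.comp this
  obtain ⟨A, hA⟩ := exists_radK_real_descend_decay hW hv
  have hbd : ∃ B, ∀ ρ : ℝ, ‖radK ℝ (descend W) ρ‖ ≤ B :=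
    ⟨∫ v : ℝ, ‖descend W |v|‖, fun ρ => by
      rw [radK_real_eq_fourier]
      exact VectorFourier.norm_fourierIntegral_le_integral_norm _ _ _ _ _⟩
  obtain ⟨B, hB⟩ := hbd
  have hEi : Integrable E := by
    refine (integrable_inv_one_add_sq.const_mul (A + B)).mono' hEc.aestronglyMeasurable
      (Filter.Eventually.of_forall fun h => ?_)
    have h1 := hA (√(h ^ 2 + ‖y‖ ^ 2))
    have h2 := hB (√(h ^ 2 + ‖y‖ ^ 2))
    rw [Real.sq_sqrt (by positivity)] at h1
    rw [← div_eq_mul_inv, le_div_iff₀ (by positivity)]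
    have h3 : 0 ≤ ‖y‖ ^ 2 * ‖radK ℝ (descend W) (√(h ^ 2 + ‖y‖ ^ 2))‖ := by positivity
    simp only [hE]
    nlinarith
  refine ⟨hEi, ?_⟩
  have hFG : 𝓕 G = fun h => E (-h) := by
    ext h
    rw [← hGinv, Real.fourierInv_eq_fourier_neg, neg_neg]
  have hinv := congrFun (hGc.fourier_fourierInv_eq hGi (by rw [hFG]; exact hEi.comp_neg)) 0
  rw [hGinv, Real.fourier_eq] at hinv
  have hG0 : radK (Euc 2) W y = G 0 := by
    simp only [radK, hG]
    refine congrArg (fun F : Euc 2 → ℂ => 𝓕⁻ F y) (funext fun ζ => ?_)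
    simp
  rw [hG0, ← hinv]
  simp

/-- The integral of the three-dimensional kernel over a half line away from the origin. -/
lemma norm_integral_radK_descend_le (hW : Continuous W) (hv : VanishOff W) {S ρ H R : ℝ}
    (hS : ∀ x : ℝ, ‖radK ℝ W x‖ ≤ S) (hH : 0 < H) (hR : H ≤ R) :
    ‖∫ h in H..R, radK ℝ (descend W) (√(h ^ 2 + ρ ^ 2))‖ ≤ S / (π * H) := by
  have hpi := Real.pi_pos
  have hS0 : 0 ≤ S := (norm_nonneg _).trans (hS 0)
  have hκc := continuous_radK_real_descend hW hv
  have hκ1c : Continuous (radK ℝ W) :=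
    continuous_iff_continuousAt.2 fun x => (hasDerivAt_radK_real hW hv x).continuousAt
  have hsc : Continuous fun h : ℝ => √(h ^ 2 + ρ ^ 2) := by fun_prop
  set f : ℝ → ℂ := fun h => radK ℝ W (√(h ^ 2 + ρ ^ 2)) with hf
  set E : ℝ → ℂ := fun h => radK ℝ (descend W) (√(h ^ 2 + ρ ^ 2)) with hE
  have hfc : Continuous f := hκ1c.comp hsc
  have hEc : Continuous E := hκc.comp hsc
  have hfd : ∀ h, 0 < h → HasDerivAt f (-(2 * π * h) * E h) h := fun h hh => by
    have h0 : h ^ 2 + ρ ^ 2 ≠ 0 := by positivity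
    have h1 : HasDerivAt (fun h : ℝ => √(h ^ 2 + ρ ^ 2)) (h / √(h ^ 2 + ρ ^ 2)) h := by
      refine (((hasDerivAt_pow 2 h).add_const (ρ ^ 2)).sqrt h0).congr_deriv ?_
      simp; field_simp
    have h2 := (hasDerivAt_radK_real hW hv (√(h ^ 2 + ρ ^ 2))).scomp h h1
    refine h2.congr_deriv ?_
    have : ((√(h ^ 2 + ρ ^ 2) : ℝ) : ℂ) ≠ 0 := by
      exact_mod_cast (Real.sqrt_pos.2 (by positivity)).ne'
    simp only [hE, real_smul]
    push_cast
    field_simp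
  have hpos : ∀ h ∈ Set.uIcc H R, 0 < h := fun h hh => by
    rw [Set.uIcc_of_le hR] at hh; exact hH.trans_le hh.1
  have hcd : ∀ h ∈ Set.uIcc H R, HasDerivAt (fun h : ℝ => f h * ((2 * π * h)⁻¹ : ℝ))
      (-(E h + f h * ((2 * π * h ^ 2)⁻¹ : ℝ))) h := fun h hh => by
    have hh0 := hpos h hh
    have h1 : HasDerivAt (fun h : ℝ => (2 * π * h)⁻¹) (-(2 * π * h ^ 2)⁻¹) h := by
      refine (((hasDerivAt_id h).const_mul (2 * π)).inv (by simp; exact hh0.ne')).congr_deriv ?_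
      simp; field_simp
    refine ((hfd h hh0).mul h1.ofReal_comp).congr_deriv ?_
    have : (h : ℂ) ≠ 0 := by exact_mod_cast hh0.ne'
    have : (π : ℂ) ≠ 0 := by exact_mod_cast hpi.ne'
    push_cast
    field_simp
    ring
  have hci : ContinuousOn (fun h : ℝ => f h * ((2 * π * h ^ 2)⁻¹ : ℝ)) (Set.uIcc H R) := by
    refine hfc.continuousOn.mul (continuous_ofReal.comp_continuousOn
      (ContinuousOn.inv₀ (by fun_prop) fun h hh => ?_))
    have := hpos h hh
    positivity
  have hint := intervalIntegral.integral_eq_sub_of_hasDerivAt hcd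
    (ContinuousOn.intervalIntegrable (hEc.continuousOn.add hci).neg)
  rw [intervalIntegral.integral_neg, intervalIntegral.integral_add (hEc.intervalIntegrable _ _)
    hci.intervalIntegrable] at hint
  have hrw : ∫ h in H..R, E h = f H * ((2 * π * H)⁻¹ : ℝ) - f R * ((2 * π * R)⁻¹ : ℝ) -
      ∫ h in H..R, f h * ((2 * π * h ^ 2)⁻¹ : ℝ) := by
    linear_combination -hint
  have hR0 : 0 < R := hH.trans_le hR
  have hb1 : ‖∫ h in H..R, f h * ((2 * π * h ^ 2)⁻¹ : ℝ)‖ ≤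
      S * ((2 * π * H)⁻¹ - (2 * π * R)⁻¹) := by
    have hd : ∀ h ∈ Set.uIcc H R, HasDerivAt (fun h : ℝ => -(S * (2 * π * h)⁻¹))
        (S * (2 * π * h ^ 2)⁻¹) h := fun h hh => by
      have hh0 := hpos h hh
      refine ((((hasDerivAt_id h).const_mul (2 * π)).inv
        (by simp; exact hh0.ne')).const_mul S).neg.congr_deriv ?_
      simp; field_simp
    have hci' : IntervalIntegrable (fun h : ℝ => S * (2 * π * h ^ 2)⁻¹) volume H R := by
      refine ContinuousOn.intervalIntegrable (continuousOn_const.mul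
        (ContinuousOn.inv₀ (by fun_prop) fun h hh => ?_))
      have := hpos h hh
      positivity
    have h2 := intervalIntegral.integral_eq_sub_of_hasDerivAt hd hci'
    refine (intervalIntegral.norm_integral_le_of_norm_le hR
      (Filter.Eventually.of_forall fun h hh => ?_) hci').trans (le_of_eq ?_)
    · have hh0 : 0 < h := hH.trans hh.1
      rw [norm_mul, norm_real, Real.norm_of_nonneg (by positivity)]
      gcongr
      exact hS _
    · rw [h2]; ring
  have hb2 : ∀ h, 0 < h → ‖f h * ((2 * π * h)⁻¹ : ℝ)‖ ≤ S * (2 * π * h)⁻¹ := fun h hh => by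
    rw [norm_mul, norm_real, Real.norm_of_nonneg (by positivity)]
    gcongr
    exact hS _
  rw [hrw]
  have h3 := norm_sub_le (f H * ((2 * π * H)⁻¹ : ℝ) - f R * ((2 * π * R)⁻¹ : ℝ))
    (∫ h in H..R, f h * ((2 * π * h ^ 2)⁻¹ : ℝ))
  have h4 := norm_sub_le (f H * ((2 * π * H)⁻¹ : ℝ)) (f R * ((2 * π * R)⁻¹ : ℝ))
  have h5 : S / (π * H) = 2 * (S * (2 * π * H)⁻¹) := by field_simp
  have := hb2 H hH
  have := hb2 R hR0
  linarith

/-- The planar kernel is controlled by the geometric mean of the kernels in dimensions one and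
three. -/
lemma norm_radK_two_le (hW : ContDiff ℝ 1 W) (hv : VanishOff W) {S₁ S₃ : ℝ} (h1 : 0 < S₁)
    (h3 : 0 < S₃) (hS₁ : ∀ x : ℝ, ‖radK ℝ W x‖ ≤ S₁)
    (hS₃ : ∀ x : ℝ, ‖radK ℝ (descend W) x‖ ≤ S₃) (y : Euc 2) :
    ‖radK (Euc 2) W y‖ ≤ 3 * √(S₁ * S₃) := by
  obtain ⟨hEi, hE⟩ := radK_two_eq_integral hW hv y
  set E : ℝ → ℂ := fun h => radK ℝ (descend W) (√(h ^ 2 + ‖y‖ ^ 2)) with hEdef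
  have heven : ∀ h, E (-h) = E h := fun h => by simp [hEdef]
  set s := √(S₁ * S₃) with hs
  have hs0 : 0 < s := Real.sqrt_pos.2 (by positivity)
  have hss : s ^ 2 = S₁ * S₃ := Real.sq_sqrt (by positivity)
  set H := s / S₃ with hHdef
  have hH : 0 < H := by positivity
  have hsplit : ∫ h : ℝ, E h = 2 * ∫ h in Set.Ioi (0 : ℝ), E h := by
    rw [← intervalIntegral.integral_Iic_add_Ioi (b := 0) hEi.integrableOn hEi.integrableOn]
    have := integral_comp_neg_Ioi 0 E
    simp only [heven, neg_zero] at this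
    rw [← this]
    ring
  have hsplit2 := intervalIntegral.integral_interval_add_Ioi (a := 0) (b := H)
    (hEi.integrableOn (s := Set.Ioi 0)) (hEi.integrableOn (s := Set.Ioi H))
  have hb1 : ‖∫ h in (0 : ℝ)..H, E h‖ ≤ S₃ * H := by
    have := intervalIntegral.norm_integral_le_of_norm_le_const (a := 0) (b := H) (C := S₃) (f := E)
      fun h _ => hS₃ _
    rwa [sub_zero, abs_of_pos hH] at this
  have hb2 : ‖∫ h in Set.Ioi H, E h‖ ≤ S₁ / (π * H) := by
    refine le_of_tendsto (intervalIntegral_tendsto_integral_Ioi H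
      (hEi.integrableOn (s := Set.Ioi H)) Filter.tendsto_id).norm ?_
    filter_upwards [Filter.eventually_ge_atTop H] with R hR
    exact norm_integral_radK_descend_le hW.continuous hv hS₁ hH hR
  rw [hE, hsplit, ← hsplit2, norm_mul, Complex.norm_ofNat]
  have e1 : S₃ * H = s := by rw [hHdef]; field_simp
  have e2 : S₁ / (π * H) ≤ s / 2 := by
    rw [div_le_div_iff₀ (by positivity) (by norm_num), hHdef]
    have : s * (π * (s / S₃)) = π * S₁ := by
      rw [show s * (π * (s / S₃)) = π * (s ^ 2) / S₃ by ring, hss]; field_simp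
    rw [this]
    nlinarith [Real.two_le_pi]
  have := norm_add_le (∫ h in (0 : ℝ)..H, E h) (∫ h in Set.Ioi H, E h)
  linarith

end DimensionTwo

/-! ### Dispersive bounds for families of radial phases -/

/-- A family of phases on `(1/8, 8)` with a uniform lower bound on the second derivative, and for
which `s / M'` is a symbol. -/
structure PhaseFamily (ι : Type*) where
  /-- the phase -/
  M : ι → ℝ → ℝ
  /-- its first derivative -/
  M₁ : ι → ℝ → ℝ
  /-- its second derivative -/
  M₂ : ι → ℝ → ℝ
  /-- the quotient `s / M'` -/
  a : ι → ℝ → ℝ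
  /-- the lower bound for the second derivative -/
  g : ι → ℝ
  /-- the sign of the second derivative -/
  ε : ℝ
  hasDerivAt_M : ∀ i, ∀ s ∈ Set.Ioo (1 / 8 : ℝ) 8, HasDerivAt (M i) (M₁ i s) s
  hasDerivAt_M₁ : ∀ i, ∀ s ∈ Set.Ioo (1 / 8 : ℝ) 8, HasDerivAt (M₁ i) (M₂ i s) s
  continuousOn_M₂ : ∀ i, ContinuousOn (M₂ i) (Set.Ioo (1 / 8 : ℝ) 8)
  mul_a : ∀ i, ∀ s ∈ Set.Ioo (1 / 8 : ℝ) 8, M₁ i s * a i s = s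
  symbol_a : ∀ k, SymbolClass k a
  g_pos : ∀ i, 0 < g i
  sign : ε = 1 ∨ ε = -1
  le_M₂ : ∀ i, ∀ s ∈ Set.Ioo (1 / 8 : ℝ) 8, g i ≤ ε * M₂ i s

/-- Symbols supported in `[1/4, 4]`. -/
def Amplitude {ι : Type*} (k : ℕ) (w : ι → ℝ → ℝ) : Prop :=
  SymbolClass k w ∧ ∀ i, ∀ s ∉ Set.Icc (1 / 4 : ℝ) 4, w i s = 0

lemma SymbolClass.congr {ι : Type*} {k : ℕ} {f g : ι → ℝ → ℝ} (hf : SymbolClass k f)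
    (h : ∀ i, ∀ s ∈ Set.Ioo (1 / 8 : ℝ) 8, f i s = g i s) : SymbolClass k g := by
  have hb : ∃ C, ∀ i, ∀ s ∈ Set.Ioo (1 / 8 : ℝ) 8, |g i s| ≤ C := by
    obtain ⟨C, hC⟩ := hf.bounded
    exact ⟨C, fun i s hs => h i s hs ▸ hC i s hs⟩
  cases k with
  | zero => exact hb
  | succ k =>
    obtain ⟨_, f', h2, h3⟩ := hf
    refine ⟨hb, f', fun i s hs => (h2 i s hs).congr_of_eventuallyEq ?_, h3⟩
    filter_upwards [isOpen_Ioo.mem_nhds hs] with t ht using (h i t ht).symm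

lemma mem_region_of_mem_Icc {s : ℝ} (hs : s ∈ Set.Icc (1 / 4 : ℝ) 4) :
    s ∈ Set.Ioo (1 / 8 : ℝ) 8 :=
  ⟨lt_of_lt_of_le (by norm_num) hs.1, lt_of_le_of_lt hs.2 (by norm_num)⟩

lemma hasDerivAt_zero_of_vanish {E : Type*} [NormedAddCommGroup E] [NormedSpace ℝ E] {f : ℝ → E}
    (h : ∀ s ∉ Set.Icc (1 / 4 : ℝ) 4, f s = 0) {s : ℝ} (hs : s ∉ Set.Icc (1 / 4 : ℝ) 4) :
    HasDerivAt f 0 s :=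
  (hasDerivAt_const s (0 : E)).congr_of_eventuallyEq (by
    filter_upwards [isClosed_Icc.isOpen_compl.mem_nhds hs] with t ht using h t ht)

lemma continuous_of_continuousOn_of_vanish {E : Type*} [NormedAddCommGroup E] [NormedSpace ℝ E]
    {f : ℝ → E} (hf : ContinuousOn f (Set.Ioo (1 / 8 : ℝ) 8))
    (h : ∀ s ∉ Set.Icc (1 / 4 : ℝ) 4, f s = 0) : Continuous f := by
  refine continuous_iff_continuousAt.2 fun s => ?_
  by_cases hs : s ∈ Set.Icc (1 / 4 : ℝ) 4
  · exact hf.continuousAt (isOpen_Ioo.mem_nhds (mem_region_of_mem_Icc hs))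
  · exact (hasDerivAt_zero_of_vanish h hs).continuousAt

namespace Amplitude

variable {ι : Type*} {k : ℕ} {w : ι → ℝ → ℝ}

lemma mono {l : ℕ} (hl : l ≤ k) (hw : Amplitude k w) : Amplitude l w := ⟨hw.1.mono hl, hw.2⟩

lemma exists_deriv (hw : Amplitude (k + 1) w) :
    ∃ w' : ι → ℝ → ℝ, Amplitude k w' ∧ ∀ i s, HasDerivAt (w i) (w' i s / s) s := by
  classical
  obtain ⟨⟨hb, w', h1, h2⟩, h0⟩ := hw
  refine ⟨fun i s => if s ∈ Set.Icc (1 / 4 : ℝ) 4 then w' i s else 0, ⟨h2.congr ?_, ?_⟩, ?_⟩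
  · intro i s hs
    split_ifs with h
    · rfl
    · have := (h1 i s hs).unique (hasDerivAt_zero_of_vanish (h0 i) h)
      rw [div_eq_zero_iff] at this
      exact this.resolve_right (mem_region_pos hs).ne'
  · intro i s hs
    exact if_neg hs
  · intro i s
    beta_reduce
    split_ifs with h
    · exact h1 i s (mem_region_of_mem_Icc h)
    · simpa using hasDerivAt_zero_of_vanish (h0 i) h

lemma continuous (hw : Amplitude (k + 1) w) (i : ι) : Continuous (w i) := by
  obtain ⟨w', -, h⟩ := hw.exists_deriv
  exact continuous_iff_continuousAt.2 fun s => (h i s).continuousAt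

lemma mul_symbol {b : ι → ℝ → ℝ} (hw : Amplitude k w) (hb : SymbolClass k b) :
    Amplitude k (fun i s => b i s * w i s) :=
  ⟨hb.mul hw.1, fun i s hs => by simp [hw.2 i s hs]⟩

lemma bounded (hw : Amplitude k w) : ∃ C, 0 ≤ C ∧ ∀ i s, |w i s| ≤ C := by
  obtain ⟨C, hC⟩ := hw.1.bounded
  refine ⟨|C|, abs_nonneg _, fun i s => ?_⟩
  by_cases hs : s ∈ Set.Icc (1 / 4 : ℝ) 4
  · exact (hC i s (mem_region_of_mem_Icc hs)).trans (le_abs_self _)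
  · rw [hw.2 i s hs, abs_zero]; exact abs_nonneg _

end Amplitude

section Descend

variable {V : Type*} [NormedAddCommGroup V] [InnerProductSpace ℝ V] [FiniteDimensional ℝ V]
  [MeasurableSpace V] [BorelSpace V]

lemma _root_.MeasureTheory.Integrable.fourierChar_mul {f : V → ℂ} (hf : Integrable f) (y : V) :
    Integrable (fun v => (𝐞 (inner ℝ v y) : ℂ) * f v) := by
  have hc : Continuous fun v : V => (𝐞 (inner ℝ v y) : ℂ) := by fun_prop
  exact hf.bdd_mul hc.aestronglyMeasurable (c := 1) (Filter.Eventually.of_forall fun v => (Circle.norm_coe _).le)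

lemma VanishOff.integrable_integral_Ioi {f : ℝ → ℂ} (hf : Continuous f) (hv : VanishOff f) :
    Integrable (fun ξ : V => ∫ s in Set.Ioi ‖ξ‖, f s) := by
  have hi : Integrable f := hf.integrable_of_hasCompactSupport hv.hasCompactSupport
  have hc : Continuous (fun a : ℝ => ∫ s in Set.Ioi a, f s) := by
    have : (fun a : ℝ => ∫ s in Set.Ioi a, f s) =
        fun a => (∫ s in Set.Ioi (0 : ℝ), f s) - ∫ s in (0 : ℝ)..a, f s := by
      ext a
      rw [← intervalIntegral.integral_Ioi_sub_Ioi' hi.integrableOn hi.integrableOn]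
      ring
    rw [this]
    exact continuous_const.sub (intervalIntegral.continuous_primitive
      (fun a b => hi.intervalIntegrable) 0)
  refine (hc.comp continuous_norm).integrable_of_hasCompactSupport ?_
  refine HasCompactSupport.intro (isCompact_closedBall (0 : V) 4) fun ξ hξ => ?_
  have h4 : 4 < ‖ξ‖ := by simpa using hξ
  refine setIntegral_eq_zero_of_forall_eq_zero fun s hs => hv s fun h => ?_
  have := h.2
  simp only [Set.mem_Ioi] at hs
  linarith

end Descend

namespace PhaseFamily

variable {ι : Type*} (P : PhaseFamily ι)

/-- The oscillating profile `exp(-iτM) w`. -/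
def osc (w : ι → ℝ → ℝ) (i : ι) (τ s : ℝ) : ℂ := cexp (-(τ * P.M i s) * I) * w i s

variable {P} {k : ℕ} {w : ι → ℝ → ℝ}

lemma vanishOff_osc (hw : Amplitude k w) (i : ι) (τ : ℝ) : VanishOff (P.osc w i τ) :=
  fun s hs => by simp [osc, hw.2 i s hs]

lemma continuousOn_M (i : ι) : ContinuousOn (P.M i) (Set.Ioo (1 / 8 : ℝ) 8) :=
  fun s hs => (P.hasDerivAt_M i s hs).continuousAt.continuousWithinAt

lemma continuousOn_M₁ (i : ι) : ContinuousOn (P.M₁ i) (Set.Ioo (1 / 8 : ℝ) 8) :=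
  fun s hs => (P.hasDerivAt_M₁ i s hs).continuousAt.continuousWithinAt

lemma continuous_osc (hw : Amplitude (k + 1) w) (i : ι) (τ : ℝ) : Continuous (P.osc w i τ) := by
  refine continuous_of_continuousOn_of_vanish ?_ (vanishOff_osc hw i τ)
  have h1 := P.continuousOn_M i
  have h2 := (hw.continuous i).continuousOn (s := Set.Ioo (1 / 8 : ℝ) 8)
  unfold osc
  fun_prop

lemma hasDerivAt_osc {w' : ι → ℝ → ℝ} (hw : ∀ i, ∀ s ∉ Set.Icc (1 / 4 : ℝ) 4, w i s = 0)
    (hw' : ∀ i, ∀ s ∉ Set.Icc (1 / 4 : ℝ) 4, w' i s = 0)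
    (h : ∀ i s, HasDerivAt (w i) (w' i s / s) s) (i : ι) (τ s : ℝ) :
    HasDerivAt (P.osc w i τ) (-(τ * P.M₁ i s) * I * P.osc w i τ s + P.osc w' i τ s / s) s := by
  by_cases hs : s ∈ Set.Icc (1 / 4 : ℝ) 4
  · have h1 := (P.hasDerivAt_M i s (mem_region_of_mem_Icc hs)).ofReal_comp
    have h2 := (((h1.const_mul (τ : ℂ)).neg.mul_const I).cexp).mul (h i s).ofReal_comp
    refine h2.congr_deriv ?_
    simp only [osc, Pi.neg_apply]
    push_cast
    ring
  · have h0 : ∀ s ∉ Set.Icc (1 / 4 : ℝ) 4, P.osc w i τ s = 0 := fun s hs => by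
      simp [osc, hw i s hs]
    refine (hasDerivAt_zero_of_vanish h0 hs).congr_deriv ?_
    simp [hw i s hs, osc, hw' i s hs]

lemma contDiff_osc (hw : Amplitude (k + 2) w) (i : ι) (τ : ℝ) : ContDiff ℝ 1 (P.osc w i τ) := by
  obtain ⟨w', h1, h2⟩ := hw.exists_deriv
  have hd := hasDerivAt_osc (P := P) hw.2 h1.2 h2 i τ
  refine contDiff_one_iff_deriv.2 ⟨fun s => (hd s).differentiableAt, ?_⟩
  rw [funext fun s => (hd s).deriv]
  refine continuous_of_continuousOn_of_vanish ?_ fun s hs => by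
    simp [osc, hw.2 i s hs, h1.2 i s hs]
  have c1 := P.continuousOn_M₁ i
  have c2 := (continuous_osc (P := P) hw i τ).continuousOn (s := Set.Ioo (1 / 8 : ℝ) 8)
  have c3 := (continuous_osc (P := P) h1 i τ).continuousOn (s := Set.Ioo (1 / 8 : ℝ) 8)
  refine ContinuousOn.add (by fun_prop) (c3.div (by fun_prop) fun s hs => ?_)
  exact_mod_cast (mem_region_pos hs).ne'

/-- The dispersive bound in dimension `n` for amplitudes of regularity `k`. -/
def DispersiveBound (P : PhaseFamily ι) (n k : ℕ) : Prop :=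
  ∀ w : ι → ℝ → ℝ, Amplitude k w → ∃ C, 0 < C ∧ ∀ i, ∀ τ ≠ 0, ∀ x : Euc n,
    ‖radK (Euc n) (P.osc w i τ) x‖ ≤ C / (√(P.g i) * √|τ| ^ n)

lemma DispersiveBound.mono {n l : ℕ} (h : P.DispersiveBound n k) (hl : k ≤ l) :
    P.DispersiveBound n l := fun w hw => h w (hw.mono hl)

lemma descend_osc (hw : Amplitude (k + 2) w) {w₂ : ι → ℝ → ℝ} (hw₂ : Amplitude (k + 1) w₂)
    (hd : ∀ i s, HasDerivAt (fun s => P.a i s * w i s) (w₂ i s / s) s) (i : ι) {τ : ℝ}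
    (hτ : τ ≠ 0) (α : ℝ) :
    descend (P.osc w i τ) α = (2 * π * I / τ) *
      (-P.osc (fun i s => P.a i s * w i s) i τ α - ∫ s in Set.Ioi α, P.osc w₂ i τ s / s) := by
  have haw := hw.mul_symbol (P.symbol_a (k + 2))
  have hder := hasDerivAt_osc (P := P) haw.2 hw₂.2 hd i τ
  have heq : ∀ s, -(τ * P.M₁ i s) * I * P.osc (fun i s => P.a i s * w i s) i τ s +
      P.osc w₂ i τ s / s = -(τ * I) * (s * P.osc w i τ s) + P.osc w₂ i τ s / s := fun s => by
    by_cases hs : s ∈ Set.Icc (1 / 4 : ℝ) 4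
    · have : (s : ℂ) = P.M₁ i s * P.a i s := by
        exact_mod_cast (P.mul_a i s (mem_region_of_mem_Icc hs)).symm
      rw [this]
      simp only [osc]
      push_cast
      ring
    · simp [osc, hw.2 i s hs]
  have hv := vanishOff_osc (P := P) hw i τ
  have hv₂ := vanishOff_osc (P := P) hw₂ i τ
  have hi1 : Integrable (fun s : ℝ => (s : ℂ) * P.osc w i τ s) :=
    Continuous.integrable_of_hasCompactSupport
      (continuous_ofReal.mul (continuous_osc hw i τ)) hv.hasCompactSupport.mul_left
  have hi2 : Integrable (fun s : ℝ => P.osc w₂ i τ s / s) := by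
    refine Continuous.integrable_of_hasCompactSupport ?_
      (HasCompactSupport.intro isCompact_Icc fun s hs => by rw [hv₂ s hs, zero_div])
    refine continuous_of_continuousOn_of_vanish ((continuous_osc hw₂ i τ).continuousOn.div
      (by fun_prop) fun s hs => ?_) fun s hs => by rw [hv₂ s hs, zero_div]
    exact_mod_cast (mem_region_pos hs).ne'
  simp only [heq] at hder
  have htend : Filter.Tendsto (P.osc (fun i s => P.a i s * w i s) i τ) Filter.atTop (nhds 0) := by
    refine tendsto_const_nhds.congr' ?_
    filter_upwards [Filter.eventually_gt_atTop 4] with s hs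
    exact (vanishOff_osc (P := P) haw i τ s fun h => by have := h.2; linarith).symm
  have key := integral_Ioi_of_hasDerivAt_of_tendsto' (a := α) (fun s _ => hder s)
    ((hi1.const_mul _).add hi2).integrableOn htend
  rw [integral_add (hi1.const_mul _).integrableOn hi2.integrableOn, integral_const_mul] at key
  have hτ' : (τ : ℂ) ≠ 0 := by exact_mod_cast hτ
  rw [descend]
  field_simp
  linear_combination I * key + τ * (∫ s in Set.Ioi α, (s : ℂ) * P.osc w i τ s) * I_sq

lemma DispersiveBound.add_two {n : ℕ} (hn : 1 ≤ n) (h : P.DispersiveBound n (k + 1)) :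
    P.DispersiveBound (n + 2) (k + 2) := fun w hw => by
  have haw := hw.mul_symbol (P.symbol_a (k + 2))
  obtain ⟨w₂, hw₂, hd⟩ := haw.exists_deriv
  obtain ⟨C₁, hC₁, h1⟩ := h _ (haw.mono (Nat.le_succ _))
  obtain ⟨C₂, hC₂, h2⟩ := h _ hw₂
  have : Nonempty (Fin n) := ⟨⟨0, hn⟩⟩
  refine ⟨2 * π * (C₁ + C₂), by positivity, fun i τ hτ x => ?_⟩
  have hτ0 : 0 < |τ| := abs_pos.2 hτ
  have hg := P.g_pos i
  obtain ⟨y, hy⟩ := _root_.exists_norm_eq (Euc n) (norm_nonneg x)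
  rw [radK_eq_radK_descend (V := Euc n) (by simp) (continuous_osc hw i τ) (vanishOff_osc hw i τ)
    hy.symm]
  have hv₂ := vanishOff_osc (P := P) hw₂ i τ
  have hc2 : Continuous (fun s : ℝ => P.osc w₂ i τ s / s) := by
    refine continuous_of_continuousOn_of_vanish ((continuous_osc hw₂ i τ).continuousOn.div
      (by fun_prop) fun s hs => ?_) fun s hs => by rw [hv₂ s hs, zero_div]
    exact_mod_cast (mem_region_pos hs).ne'
  have hI : Integrable (fun ξ : Euc n => ∫ s in Set.Ioi ‖ξ‖, P.osc w₂ i τ s / s) :=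
    VanishOff.integrable_integral_Ioi hc2 fun s hs => by rw [hv₂ s hs, zero_div]
  have hI1 : Integrable (fun ξ : Euc n => P.osc (fun i s => P.a i s * w i s) i τ ‖ξ‖) :=
    (vanishOff_osc haw i τ).integrable_norm (continuous_osc haw i τ)
  have e : radK (Euc n) (descend (P.osc w i τ)) y = (2 * π * I / τ) *
      (-radK (Euc n) (P.osc (fun i s => P.a i s * w i s) i τ) y -
        radK (Euc n) (fun α => ∫ s in Set.Ioi α, P.osc w₂ i τ s / s) y) := by
    simp only [radK, Real.fourierInv_eq, Circle.smul_def, smul_eq_mul]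
    have j1 := hI1.fourierChar_mul y
    have j2 := hI.fourierChar_mul y
    rw [← neg_add', ← integral_add j1 j2, ← integral_neg, ← integral_const_mul]
    refine integral_congr_ae (Filter.Eventually.of_forall fun ξ => ?_)
    simp only [descend_osc hw hw₂ hd i hτ]
    ring
  have b2 := norm_radK_integral_Ioi_le (continuous_osc hw₂ i τ) hv₂ (h2 i τ hτ) y
  have b1 := h1 i τ hτ y
  rw [e, norm_mul]
  have hc : ‖(2 * π * I / τ : ℂ)‖ = 2 * π / |τ| := by
    simp [abs_of_pos Real.pi_pos]
  rw [hc]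
  calc _ ≤ 2 * π / |τ| * (C₁ / (√(P.g i) * √|τ| ^ n) + C₂ / (√(P.g i) * √|τ| ^ n)) := by
        gcongr
        refine (norm_sub_le _ _).trans ?_
        rw [norm_neg]
        exact add_le_add b1 b2
    _ = _ := by
        have : 0 < √(P.g i) := Real.sqrt_pos.2 hg
        have h3 : √|τ| ^ (n + 2) = √|τ| ^ n * |τ| := by
          rw [pow_add, Real.sq_sqrt hτ0.le]
        rw [h3]
        field_simp

lemma dispersiveBound_one : P.DispersiveBound 1 2 := fun w hw => by
  obtain ⟨B, hB0, hB⟩ := hw.bounded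
  obtain ⟨w', hw', hd⟩ := hw.exists_deriv
  obtain ⟨B', hB'0, hB'⟩ := hw'.bounded
  set K := 2 * π * B + (5 - 1 / 5) * (5 * B') / 2 with hK
  have hK0 : 0 ≤ K := by positivity
  refine ⟨2 * K + 1, by positivity, fun i τ hτ x => ?_⟩
  have hτ0 : 0 < |τ| := abs_pos.2 hτ
  have hg := P.g_pos i
  rw [radK_eq_of_norm_eq (V' := ℝ) (by simp) (y := ‖x‖) _ (by simp)]
  set W := P.osc w i τ with hW
  have hv : VanishOff W := vanishOff_osc hw i τ
  have hWc : Continuous W := continuous_osc hw i τ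
  have hWi : Integrable W := hWc.integrable_of_hasCompactSupport hv.hasCompactSupport
  have hone : ∀ y : ℝ, ‖𝓕⁻ W y‖ ≤ K / √(g P i * |τ|) := fun y => by
    rw [Real.fourierInv_eq]
    have e : ∫ v, 𝐞 (inner ℝ v y) • W v = ∫ v in (1 / 5 : ℝ)..5,
        cexp ((2 * π * v * y - τ * P.M i v : ℝ) * I) * w i v := by
      rw [intervalIntegral.integral_of_le (by norm_num), ← integral_indicator measurableSet_Ioc]
      refine integral_congr_ae (Filter.Eventually.of_forall fun v => ?_)
      by_cases h : v ∈ Set.Icc (1 / 4 : ℝ) 4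
      · have h' : v ∈ Set.Ioc (1 / 5 : ℝ) 5 :=
          ⟨lt_of_lt_of_le (by norm_num) h.1, h.2.trans (by norm_num)⟩
        simp only [Set.indicator_of_mem h', hW, osc, Circle.smul_def, smul_eq_mul,
          Real.fourierChar_apply, ← mul_assoc, ← Complex.exp_add]
        congr 2
        simp
        ring
      · simp only [hv v h, smul_zero]
        symm
        rw [Set.indicator_apply_eq_zero]
        intro _
        simp [hw.2 i v h]
    rw [e]
    have hreg : ∀ v ∈ Set.Icc (1 / 5 : ℝ) 5, v ∈ Set.Ioo (1 / 8 : ℝ) 8 := fun v h =>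
      ⟨lt_of_lt_of_le (by norm_num) h.1, lt_of_le_of_lt h.2 (by norm_num)⟩
    obtain ⟨ε', hε', hmul⟩ : ∃ ε', (ε' = 1 ∨ ε' = -1) ∧ ε' * -τ = P.ε * |τ| := by
      rcases P.sign with h | h <;> rcases le_total 0 τ with h2 | h2
      · exact ⟨-1, Or.inr rfl, by rw [h, abs_of_nonneg h2]; ring⟩
      · exact ⟨1, Or.inl rfl, by rw [h, abs_of_nonpos h2]⟩
      · exact ⟨1, Or.inl rfl, by rw [h, abs_of_nonneg h2]; ring⟩
      · exact ⟨-1, Or.inr rfl, by rw [h, abs_of_nonpos h2]⟩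
    refine norm_integral_exp_mul_le_of_second_deriv (ε := ε') (φ₁ := fun v => 2 * π * y - τ * P.M₁ i v)
      (φ₂ := fun v => -τ * P.M₂ i v) (w₁ := fun v => w' i v / v)
      (by norm_num) (by positivity) hε' (fun v hv => ?_) (fun v hv => ?_)
      (continuousOn_const.mul ((P.continuousOn_M₂ i).mono hreg)) (fun v hv => ?_)
      (fun v _ => hd i v) ?_ (fun v _ => hB i v) (fun v hv => ?_) (hw.2 i _ (by norm_num))
      (hw.2 i _ (by norm_num))
    · refine ((((hasDerivAt_id v).const_mul (2 * π)).mul_const y).sub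
        ((P.hasDerivAt_M i v (hreg v hv)).const_mul τ)).congr_deriv (by ring)
    · refine (((P.hasDerivAt_M₁ i v (hreg v hv)).const_mul τ).const_sub (2 * π * y)).congr_deriv
        (by ring)
    · have := P.le_M₂ i v (hreg v hv)
      calc g P i * |τ| ≤ (P.ε * P.M₂ i v) * |τ| := by gcongr
        _ = (P.ε * |τ|) * P.M₂ i v := by ring
        _ = _ := by rw [← hmul]; ring
    · exact (hw'.continuous i).continuousOn.div continuousOn_id fun v hv =>
        (mem_region_pos (hreg v hv)).ne'
    · have h0 := mem_region_pos (hreg v hv)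
      rw [abs_div, abs_of_pos h0, div_le_iff₀ h0]
      nlinarith [hB' i v, hv.1]
  have hsum : radK ℝ W ‖x‖ = 𝓕⁻ W ‖x‖ + 𝓕⁻ W (-‖x‖) := by
    have e1 : 𝓕⁻ W (-‖x‖) = 𝓕⁻ (fun v => W (-v)) ‖x‖ := by
      exact (Real.fourierInv_comp_linearIsometry (LinearIsometryEquiv.neg ℝ) W ‖x‖).symm
    rw [e1]
    simp only [radK, Real.fourierInv_eq, Circle.smul_def, smul_eq_mul]
    rw [← integral_add (hWi.fourierChar_mul _) (hWi.comp_neg.fourierChar_mul _)]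
    refine integral_congr_ae (Filter.Eventually.of_forall fun v => ?_)
    simp only [Real.norm_eq_abs, hv.apply_abs]
    ring
  rw [hsum, pow_one, ← Real.sqrt_mul hg.le]
  have : 0 < √(g P i * |τ|) := Real.sqrt_pos.2 (by positivity)
  calc _ ≤ K / √(g P i * |τ|) + K / √(g P i * |τ|) :=
        (norm_add_le _ _).trans (add_le_add (hone _) (hone _))
    _ = 2 * K / √(g P i * |τ|) := by ring
    _ ≤ _ := by gcongr; linarith

lemma dispersiveBound_two : P.DispersiveBound 2 3 := fun w hw => by
  obtain ⟨C₁, hC₁, h1⟩ := P.dispersiveBound_one.mono (by norm_num : 2 ≤ 3) w hw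
  obtain ⟨C₃, hC₃, h3⟩ := DispersiveBound.add_two (k := 1) le_rfl P.dispersiveBound_one w hw
  refine ⟨3 * √(C₁ * C₃), by positivity, fun i τ hτ x => ?_⟩
  have hτ0 : 0 < |τ| := abs_pos.2 hτ
  have hg := P.g_pos i
  have hv : VanishOff (P.osc w i τ) := vanishOff_osc hw i τ
  have hWc : Continuous (P.osc w i τ) := continuous_osc hw i τ
  have hτ1 : 0 < √|τ| := Real.sqrt_pos.2 hτ0
  have hg1 : 0 < √(P.g i) := Real.sqrt_pos.2 hg
  refine (norm_radK_two_le (contDiff_osc hw i τ) hv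
    (S₁ := C₁ / (√(P.g i) * √|τ| ^ 1)) (S₃ := C₃ / (√(P.g i) * √|τ| ^ 3)) (by positivity)
    (by positivity) (fun y => ?_) (fun y => ?_) x).trans (le_of_eq ?_)
  · obtain ⟨z, hz⟩ := _root_.exists_norm_eq (Euc 1) (norm_nonneg y)
    rw [radK_eq_of_norm_eq (V' := Euc 1) (by simp) _ hz.symm]
    exact h1 i τ hτ z
  · obtain ⟨z, hz⟩ := _root_.exists_norm_eq (Euc 3) (norm_nonneg y)
    rw [← radK_eq_radK_descend (V' := Euc 3) (by simp) hWc hv hz]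
    exact h3 i τ hτ z
  · have : C₁ / (√(P.g i) * √|τ| ^ 1) * (C₃ / (√(P.g i) * √|τ| ^ 3)) =
        (C₁ * C₃) / (√(P.g i) * √|τ| ^ 2) ^ 2 := by
      field_simp
    rw [this, Real.sqrt_div (by positivity), Real.sqrt_sq (by positivity)]
    ring

/-- The dispersive estimate in all dimensions. -/
theorem dispersiveBound {n : ℕ} (hn : 1 ≤ n) : P.DispersiveBound n (n + 1) := by
  induction n using Nat.strong_induction_on with
  | _ n ih =>
    match n, hn with
    | 1, _ => exact P.dispersiveBound_one
    | 2, _ => exact P.dispersiveBound_two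
    | n + 3, _ =>
      exact (DispersiveBound.add_two (by omega) (ih (n + 1) (by omega) (by omega))).mono (by omega)

end PhaseFamily

/-! ### The dispersive estimate for `m_β` -/

lemma jap_pos (x : ℝ) : 0 < jap x := Real.sqrt_pos.2 (by positivity)

lemma cFactor_pos (β : ℝ) (d : ℕ) {l : ℝ} (hl : 0 < l) : 0 < cFactor β d l := by
  have h1 := jap_pos (√β * l)
  have h2 := jap_pos l
  unfold cFactor
  positivity

/-- The rescaled symbols form a phase family. -/
lemma exists_phaseFamily {β : ℝ} (hβ : β = 0 ∨ β = 1) :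
    ∃ P : PhaseFamily (Set.Ioi (0 : ℝ)), P.M = mScaled β ∧
      ∀ l : Set.Ioi (0 : ℝ), P.g l = ((l : ℝ) / (2000 * jap l)) ^ 2 := by
  have hβ0 : 0 ≤ β := by rcases hβ with h | h <;> rw [h]; norm_num
  obtain ⟨ε, hε, hq⟩ := exists_qAux_lower hβ
  refine ⟨{
    M := mScaled β
    M₁ := fun l s => mScaled β l s * pAux β (l * s) / s
    M₂ := fun l s => mScaled β l s * qAux β (l * s) / s ^ 2
    a := aScaled β
    g := fun l => ((l : ℝ) / (2000 * jap l)) ^ 2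
    ε := ε
    hasDerivAt_M := fun l s hs => hasDerivAt_mScaled hβ0 l (mem_region_pos hs)
    hasDerivAt_M₁ := fun l s hs => hasDerivAt_deriv_mScaled hβ0 l (mem_region_pos hs)
    continuousOn_M₂ := ?_
    mul_a := ?_
    symbol_a := symbolClass_aScaled hβ0
    g_pos := ?_
    sign := hε
    le_M₂ := ?_ }, rfl, fun l => rfl⟩
  · intro l s hs
    have h0 := mem_region_pos hs
    have hls := mul_pos l.2 h0
    have c1 := ((hasDerivAt_hAux hls).comp_pos_mul l.2).continuousAt
    have c2 := ((hasDerivAt_kAux hls).comp_pos_mul l.2).continuousAt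
    have c3 := ((hasDerivAt_gAux hβ0 hls).comp_pos_mul l.2).continuousAt
    have c4 := ((hasDerivAt_pAux hβ0 hls).comp_pos_mul l.2).continuousAt
    have c5 := (hasDerivAt_mScaled hβ0 l h0).continuousAt
    refine ContinuousAt.continuousWithinAt ?_
    unfold qAux
    exact ContinuousAt.div (by fun_prop) (by fun_prop) (by positivity)
  · intro l s hs
    have h0 := mem_region_pos hs
    have h1 := mScaled_pos hβ0 l h0
    have h2 := half_le_pAux hβ0 (mul_pos l.2 h0)
    have h3 : pAux β (l * s) ≠ 0 := by linarith
    simp only [aScaled]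
    field_simp
  · intro l
    have := jap_pos l
    have h : 0 < (l : ℝ) := l.2
    positivity
  · intro l s hs
    have h0 := mem_region_pos hs
    have hl : 0 < (l : ℝ) := l.2
    have hls := mul_pos hl h0
    have h1 : 1 / 512 ≤ mScaled β l s := by
      rw [mScaled, le_div_iff₀ (mSymb_pos hβ0 hl)]
      have := mSymb_le_of_comparable hβ0 hl hls (by nlinarith [hs.1]) (by nlinarith [hs.2])
      linarith
    have h2 := hq _ hls
    have h3 : (1 : ℝ) / 64 * ((l : ℝ) ^ 2 / (1 + l ^ 2)) ≤ ((l : ℝ) * s) ^ 2 / (1 + (l * s) ^ 2) / s ^ 2 := by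
      rw [mul_pow, div_div, mul_comm ((1 : ℝ) + _), mul_comm (1 / 64 : ℝ), div_mul_div_comm, mul_one, div_le_div_iff₀ (by positivity) (by positivity)]
      have : s ^ 2 ≤ 64 := by nlinarith [hs.2]
      have h64 : 1 + (l : ℝ) ^ 2 * s ^ 2 ≤ (1 + (l : ℝ) ^ 2) * 64 := by nlinarith [sq_nonneg (l : ℝ)]
      nlinarith [mul_le_mul_of_nonneg_left h64 (by positivity : 0 ≤ (l : ℝ) ^ 2 * s ^ 2)]
    have hj : jap (l : ℝ) ^ 2 = 1 + (l : ℝ) ^ 2 := Real.sq_sqrt (by positivity)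
    calc ((l : ℝ) / (2000 * jap l)) ^ 2 = 1 / 4000000 * ((l : ℝ) ^ 2 / (1 + l ^ 2)) := by
          rw [div_pow, mul_pow, hj]; field_simp; norm_num
      _ ≤ 1 / 512 * (1 / 100 * (1 / 64 * ((l : ℝ) ^ 2 / (1 + l ^ 2)))) := by
          have : 0 ≤ (l : ℝ) ^ 2 / (1 + l ^ 2) := by positivity
          linarith
      _ ≤ mScaled β l s * (1 / 100 * (((l : ℝ) * s) ^ 2 / (1 + (l * s) ^ 2) / s ^ 2)) := by gcongr
      _ = mScaled β l s * ((1 / 100 * (((l : ℝ) * s) ^ 2 / (1 + (l * s) ^ 2))) / s ^ 2) := by ring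
      _ ≤ mScaled β l s * ((ε * qAux β (l * s)) / s ^ 2) := by
          have := mScaled_pos hβ0 l h0
          gcongr
      _ = _ := by ring

lemma scaled_le_cFactor {β : ℝ} (hβ : 0 ≤ β) (d : ℕ) {l : ℝ} (hl : 0 < l) :
    l ^ d / (l / (2000 * jap l) * √(mSymb β l) ^ d) ≤ 2000 * 2 ^ d * cFactor β d l := by
  have hm := mSymb_pos hβ hl
  have hj := jap_pos l
  have hjb := jap_pos (√β * l)
  have e1 : √(mSymb β l) ^ d = (mSymb β l ^ 2) ^ ((d : ℝ) / 4) := by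
    rw [Real.sqrt_eq_rpow, ← Real.rpow_natCast, ← Real.rpow_natCast, ← Real.rpow_mul hm.le,
      ← Real.rpow_mul hm.le]
    congr 1
    push_cast; ring
  have hjb2 : jap (√β * l) ^ 2 = 1 + β * l ^ 2 := by
    rw [jap, Real.sq_sqrt (by positivity), mul_pow, Real.sq_sqrt hβ]
  have h1l : 1 + l ≤ 2 * jap l := by
    rw [jap]
    have : (1 + l) / 2 ≤ √(1 + l ^ 2) := Real.le_sqrt_of_sq_le (by nlinarith [sq_nonneg (1 - l)])
    linarith
  have e2 : (l * jap (√β * l)) ^ ((d : ℝ) / 2) * (2 * jap l) ^ (-((d : ℝ) / 4)) ≤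
      √(mSymb β l) ^ d := by
    rw [e1]
    have h2 : (l * jap (√β * l)) ^ 2 * (2 * jap l)⁻¹ ≤ mSymb β l ^ 2 := by
      refine le_trans ?_ (mSymb_sq_bounds hβ hl).1
      rw [mul_pow, hjb2, ← div_eq_mul_inv]
      gcongr
    refine le_trans (le_of_eq ?_) (Real.rpow_le_rpow (by positivity) h2 (by positivity))
    rw [Real.mul_rpow (x := (l * jap (√β * l)) ^ 2) (by positivity) (by positivity),
      ← Real.rpow_natCast, ← Real.rpow_mul (by positivity), Real.inv_rpow (by positivity),
      Real.rpow_neg (by positivity)]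
    congr 2
    push_cast; ring
  have h2d : (2 : ℝ) ^ ((d : ℝ) / 4) ≤ 2 ^ d := by
    rw [← Real.rpow_natCast]
    exact Real.rpow_le_rpow_of_exponent_le (by norm_num) (by
      have : (0 : ℝ) ≤ d := by positivity
      linarith)
  calc _ ≤ l ^ d / (l / (2000 * jap l) *
        ((l * jap (√β * l)) ^ ((d : ℝ) / 2) * (2 * jap l) ^ (-((d : ℝ) / 4)))) := by gcongr
    _ = 2000 * 2 ^ ((d : ℝ) / 4) * cFactor β d l := by
        rw [cFactor, Real.mul_rpow hl.le hjb.le, Real.mul_rpow (by norm_num) hj.le,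
          Real.rpow_sub hl, Real.rpow_one, Real.rpow_add hj, Real.rpow_one, neg_div,
          Real.rpow_neg hjb.le, Real.rpow_neg hj.le, Real.rpow_neg (by norm_num : (0:ℝ) ≤ 2)]
        have : l ^ d = l ^ ((d : ℝ) / 2) * l ^ ((d : ℝ) / 2) := by
          rw [← Real.rpow_add hl, ← Real.rpow_natCast]; congr 1; ring
        rw [this]
        field_simp
    _ ≤ _ := by
        have := cFactor_pos β d hl
        gcongr

/-- The frequency localised dispersive estimate. -/
theorem dispersive_estimate {β : ℝ} (hβ : β = 0 ∨ β = 1) {d : ℕ} (hd : 1 ≤ d) :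
    ∃ (ψ : ℝ → ℝ) (C : ℝ), 0 < C ∧ Continuous ψ ∧ (∀ s, 0 ≤ ψ s ∧ ψ s ≤ 1) ∧
      (∀ s ∈ Set.Icc (1 / 2 : ℝ) 2, ψ s = 1) ∧ (∀ s ∉ Set.Icc (1 / 4 : ℝ) 4, ψ s = 0) ∧
      ∀ l : ℝ, 0 < l → ∀ t : ℝ, t ≠ 0 → ∀ x : Euc d,
        ‖𝓕⁻ (fun ξ : Euc d => cexp (-(t * mSymb β ‖ξ‖) * I) * ψ (‖ξ‖ / l)) x‖ ≤
          C * cFactor β d l * |t| ^ (-((d : ℝ) / 2)) := by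
  have hβ0 : 0 ≤ β := by rcases hβ with h | h <;> rw [h]; norm_num
  let ψ : ContDiffBump (5 / 4 : ℝ) := ⟨3 / 4, 1, by norm_num, by norm_num⟩
  have hψ0 : ∀ s ∉ Set.Icc (1 / 4 : ℝ) 4, ψ s = 0 := fun s hs => by
    refine ψ.zero_of_le_dist ?_
    rw [Real.dist_eq]
    by_contra! h
    rw [abs_lt] at h
    have : ψ.rOut = 1 := rfl
    exact hs ⟨by linarith, by linarith⟩
  obtain ⟨P, hPM, hPg⟩ := exists_phaseFamily hβ
  have hw : Amplitude (d + 1) (fun (_ : Set.Ioi (0 : ℝ)) => (ψ : ℝ → ℝ)) :=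
    ⟨SymbolClass.of_contDiff ψ.contDiff, fun _ => hψ0⟩
  obtain ⟨C, hC, h⟩ := P.dispersiveBound hd _ hw
  refine ⟨ψ, C * (2000 * 2 ^ d), by positivity, ψ.continuous, fun s => ⟨ψ.nonneg, ψ.le_one⟩,
    fun s hs => ?_, hψ0, fun l hl t ht x => ?_⟩
  · refine ψ.one_of_mem_closedBall ?_
    rw [Metric.mem_closedBall, Real.dist_eq, abs_le]
    have : ψ.rIn = 3 / 4 := rfl
    rw [this]
    constructor <;> linarith [hs.1, hs.2]
  · have hm := mSymb_pos hβ0 hl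
    have hj := jap_pos l
    set τ := t * mSymb β l with hτ
    have hscale : 𝓕⁻ (fun ξ : Euc d => cexp (-(t * mSymb β ‖ξ‖) * I) * ψ (‖ξ‖ / l)) x =
        (l ^ d : ℝ) * radK (Euc d) (P.osc (fun _ => ψ) ⟨l, hl⟩ τ) (l • x) := by
      rw [radK, Real.fourierInv_eq, Real.fourierInv_eq]
      have := Measure.integral_comp_smul (volume : Measure (Euc d)) (fun ξ : Euc d =>
        𝐞 (inner ℝ ξ x) • (cexp (-(t * mSymb β ‖ξ‖) * I) * (ψ (‖ξ‖ / l) : ℂ))) l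
      rw [finrank_euclideanSpace_fin, abs_of_pos (by positivity), eq_inv_smul_iff₀
        (by positivity)] at this
      rw [← this, real_smul]
      congr 1
      refine integral_congr_ae (Filter.Eventually.of_forall fun ξ => ?_)
      have e1 : ‖l • ξ‖ = l * ‖ξ‖ := by rw [norm_smul, Real.norm_of_nonneg hl.le]
      have e2 : (t : ℂ) * mSymb β (l * ‖ξ‖) = τ * mScaled β ⟨l, hl⟩ ‖ξ‖ := by
        rw [mScaled, hτ]
        have : (mSymb β l : ℂ) ≠ 0 := by exact_mod_cast hm.ne'
        push_cast
        field_simp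
      simp only [PhaseFamily.osc, hPM, e1, e2, inner_smul_left, inner_smul_right, conj_trivial,
        mul_div_cancel_left₀ _ hl.ne']
    rw [hscale, norm_mul, norm_real, Real.norm_of_nonneg (by positivity)]
    have hb := h ⟨l, hl⟩ τ (mul_ne_zero ht hm.ne') (l • x)
    rw [hPg, Real.sqrt_sq (by positivity), hτ, abs_mul, abs_of_pos hm, Real.sqrt_mul (abs_nonneg t),
      mul_pow] at hb
    have ht0 : 0 < |t| := abs_pos.2 ht
    have e3 : √|t| ^ d = |t| ^ ((d : ℝ) / 2) := by
      rw [Real.sqrt_eq_rpow, ← Real.rpow_natCast, ← Real.rpow_mul ht0.le]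
      congr 1; ring
    rw [e3] at hb
    calc _ ≤ l ^ d * (C / (l / (2000 * jap l) * (|t| ^ ((d : ℝ) / 2) * √(mSymb β l) ^ d))) := by
          gcongr
      _ = C * (l ^ d / (l / (2000 * jap l) * √(mSymb β l) ^ d)) * |t| ^ (-((d : ℝ) / 2)) := by
          rw [Real.rpow_neg ht0.le]
          field_simp
      _ ≤ C * (2000 * 2 ^ d * cFactor β d l) * |t| ^ (-((d : ℝ) / 2)) := by
          gcongr
          exact scaled_le_cFactor hβ0 d hl
      _ = _ := by ring

section Plancherel

variable {V : Type*} [NormedAddCommGroup V] [InnerProductSpace ℝ V] [FiniteDimensional ℝ V]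
  [MeasurableSpace V] [BorelSpace V]

/-- The integral Fourier transform of an integrable square-integrable function agrees with its
`L²` Fourier transform. -/
theorem fourier_toLp_ae_eq {f : V → ℂ} (h1 : Integrable f) (h2 : MemLp f 2) :
    (𝓕 (h2.toLp f) : Lp ℂ 2 (volume : Measure V)) =ᵐ[volume] 𝓕 f := by
  have hc : Continuous (𝓕 f) := VectorFourier.fourierIntegral_continuous
    Real.continuous_fourierChar continuous_inner h1
  refine ae_eq_of_integral_contDiff_smul_eq
    ((Lp.memLp _).locallyIntegrable (by norm_num)) hc.locallyIntegrable fun g g_diff g_supp => ?_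
  have hg2 : HasCompactSupport fun x => (g x : ℂ) :=
    g_supp.comp_left (g := fun s : ℝ => (s : ℂ)) (by simp)
  have hg3 : ContDiff ℝ (⊤ : ℕ∞) fun x => (g x : ℂ) := Complex.ofRealCLM.contDiff.comp g_diff
  set φ : SchwartzMap V ℂ := hg2.toSchwartzMap hg3 with hφ
  have hφx : ∀ x, φ x = (g x : ℂ) := fun x => rfl
  have e1 : ∫ x, g x • (𝓕 (h2.toLp f) : Lp ℂ 2 (volume : Measure V)) x =
      Lp.toTemperedDistribution (𝓕 (h2.toLp f)) φ := by
    rw [Lp.toTemperedDistribution_apply]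
    rfl
  rw [e1, ← Lp.fourier_toTemperedDistribution_eq, TemperedDistribution.fourier_apply,
    Lp.toTemperedDistribution_apply]
  have e2 := VectorFourier.integral_fourierIntegral_smul_eq_flip (μ := volume) (ν := volume)
    (L := innerₗ V) Real.continuous_fourierChar continuous_inner φ.integrable h1
  calc ∫ x, (𝓕 φ) x • (h2.toLp f) x = ∫ x, (𝓕 φ) x • f x := by
        refine integral_congr_ae ?_
        filter_upwards [h2.coeFn_toLp] with x hx
        rw [hx]
    _ = ∫ x, φ x • 𝓕 f x := by
        rw [flip_innerₗ] at e2
        exact e2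
    _ = _ := rfl

/-- Plancherel's theorem for integrable square-integrable functions. -/
theorem eLpNorm_fourier_eq {f : V → ℂ} (h1 : Integrable f) (h2 : MemLp f 2) :
    eLpNorm (𝓕 f) 2 = eLpNorm f 2 := by
  rw [← eLpNorm_congr_ae (fourier_toLp_ae_eq h1 h2), ← Lp.enorm_def, ← ofReal_norm,
    Lp.norm_fourier_eq, ofReal_norm, Lp.enorm_toLp]

theorem eLpNorm_fourierInv_eq {f : V → ℂ} (h1 : Integrable f) (h2 : MemLp f 2) :
    eLpNorm (𝓕⁻ f) 2 = eLpNorm f 2 := by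
  have : (𝓕⁻ f) = (𝓕 f) ∘ fun x => -x := by
    ext x
    exact Real.fourierInv_eq_fourier_neg f x
  have hc : Continuous (𝓕 f) := VectorFourier.fourierIntegral_continuous
    Real.continuous_fourierChar continuous_inner h1
  rw [this, eLpNorm_comp_measurePreserving hc.aestronglyMeasurable
    (Measure.measurePreserving_neg volume), eLpNorm_fourier_eq h1 h2]

end Plancherel

section Interpolation

theorem lintegral_Ioc_rpow {a b : ℝ} (ha : -1 < a) (hb : 0 ≤ b) :
    ∫⁻ t in Set.Ioc 0 b, ENNReal.ofReal (t ^ a) = ENNReal.ofReal (b ^ (a + 1) / (a + 1)) := by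
  have hi : IntegrableOn (fun t : ℝ => t ^ a) (Set.Ioc 0 b) := by
    have := intervalIntegral.intervalIntegrable_rpow' (a := 0) (b := b) ha
    rwa [intervalIntegrable_iff_integrableOn_Ioc_of_le hb] at this
  rw [← ofReal_integral_eq_lintegral_ofReal hi, ← intervalIntegral.integral_of_le hb,
    integral_rpow (Or.inl ha), Real.zero_rpow (by linarith), sub_zero]
  filter_upwards [ae_restrict_mem measurableSet_Ioc] with t ht
  exact Real.rpow_nonneg ht.1.le _

/-- A function whose distribution function is controlled by truncations of `f` at the height
dictated by interpolation between `L² → L²` and `L¹ → L^∞` lies in `L^r`. -/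
theorem lintegral_rpow_le_of_meas_lt_le {X : Type*} [MeasurableSpace X] {μ : Measure X} [SFinite μ]
    {f g : X → ℝ} (hf : Measurable f) (hf0 : ∀ x, 0 ≤ f x) (hg : Measurable g)
    (hg0 : ∀ x, 0 ≤ g x) {A r : ℝ} (hA : 0 < A) (hr : 2 < r)
    (h : ∀ y : ℝ, 0 < y → μ {x | y < g x} ≤
      ∫⁻ x in {x | f x ≤ (2 * A / y) ^ (r - 1)}, ENNReal.ofReal (4 / y ^ 2 * f x ^ 2) ∂μ) :
    ∫⁻ x, ENNReal.ofReal (g x ^ r) ∂μ ≤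
      ENNReal.ofReal (4 * r / (r - 2) * (2 * A) ^ (r - 2)) *
        ∫⁻ x, ENNReal.ofReal (f x ^ (r / (r - 1))) ∂μ := by
  rw [lintegral_rpow_eq_lintegral_meas_lt_mul μ (Filter.Eventually.of_forall hg0) hg.aemeasurable
    (by linarith)]
  have hAy : ∀ y : ℝ, 0 < y → 0 < 2 * A / y := fun y hy => by positivity
  set B : X → ℝ := fun x => 2 * A * f x ^ (-(1 / (r - 1))) with hB
  have hBm : Measurable B := by fun_prop
  -- the integrand as a function of `(y, x)`
  set Ψ : ℝ → X → ℝ≥0∞ := fun y x => ({p : ℝ × X | f p.2 ≤ (2 * A / p.1) ^ (r - 1)}).indicator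
    (fun p => ENNReal.ofReal (4 * f p.2 ^ 2 * p.1 ^ (r - 3))) (y, x) with hΨ
  have hΨm : Measurable (Function.uncurry Ψ) := by
    refine Measurable.indicator (by fun_prop) (measurableSet_le (by fun_prop) (by fun_prop))
  have step : ∀ y ∈ Set.Ioi (0 : ℝ), μ {a | y < g a} * ENNReal.ofReal (y ^ (r - 1)) ≤
      ∫⁻ x, Ψ y x ∂μ := by
    intro y hy
    have hy : 0 < y := hy
    refine (mul_le_mul_left (h y hy) _).trans ?_
    rw [← lintegral_mul_const _ (by fun_prop),
      ← lintegral_indicator (measurableSet_le hf measurable_const)]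
    refine lintegral_mono fun x => ?_
    simp only [hΨ, Set.indicator_apply, Set.mem_ofPred_eq]
    split_ifs
    · rw [← ENNReal.ofReal_mul (by positivity)]
      refine ENNReal.ofReal_le_ofReal (le_of_eq ?_)
      have : y ^ (r - 1) = y ^ (r - 3) * y ^ 2 := by
        rw [← Real.rpow_natCast, ← Real.rpow_add hy]
        congr 1; push_cast; ring
      rw [this]
      field_simp
    · exact le_rfl
  refine (mul_le_mul_right (setLIntegral_mono' measurableSet_Ioi step) _).trans ?_
  rw [lintegral_lintegral_swap hΨm.aemeasurable]
  have inner : ∀ x, ∫⁻ y in Set.Ioi 0, Ψ y x ≤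
      ENNReal.ofReal (4 / (r - 2) * (2 * A) ^ (r - 2)) * ENNReal.ofReal (f x ^ (r / (r - 1))) := by
    intro x
    rcases (hf0 x).eq_or_lt with h0 | h0
    · have : ∀ y, Ψ y x = 0 := by
        intro y
        simp [hΨ, Set.indicator_apply, ← h0]
      simp [this]
    have hb : 0 ≤ B x := by positivity
    calc ∫⁻ y in Set.Ioi 0, Ψ y x
        ≤ ∫⁻ y in Set.Ioi 0, (Set.Ioc 0 (B x)).indicator
            (fun y => ENNReal.ofReal (4 * f x ^ 2) * ENNReal.ofReal (y ^ (r - 3))) y := by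
          refine setLIntegral_mono' measurableSet_Ioi fun y hy => ?_
          have hy : 0 < y := hy
          simp only [hΨ, Set.indicator_apply, Set.mem_ofPred_eq]
          split_ifs with h1 h2
          · rw [← ENNReal.ofReal_mul (by positivity)]
          · exfalso
            refine h2 ⟨hy, ?_⟩
            have h3 : f x ^ (1 / (r - 1)) ≤ 2 * A / y := by
              have := Real.rpow_le_rpow h0.le h1 (z := 1 / (r - 1))
                (div_nonneg zero_le_one (by linarith))
              rwa [← Real.rpow_mul (hAy y hy).le, mul_one_div_cancel (by linarith),
                Real.rpow_one] at this
            rw [hB]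
            simp only
            rw [Real.rpow_neg h0.le, ← div_eq_mul_inv, le_div_iff₀ (by positivity)]
            rw [le_div_iff₀ hy] at h3
            linarith
          · exact zero_le
          · exact le_rfl
      _ ≤ ∫⁻ y, (Set.Ioc 0 (B x)).indicator
            (fun y => ENNReal.ofReal (4 * f x ^ 2) * ENNReal.ofReal (y ^ (r - 3))) y :=
          setLIntegral_le_lintegral _ _
      _ = ENNReal.ofReal (4 * f x ^ 2 * (B x ^ (r - 2) / (r - 2))) := by
          rw [lintegral_indicator measurableSet_Ioc, lintegral_const_mul _ (by fun_prop),
            lintegral_Ioc_rpow (by linarith) hb, ← ENNReal.ofReal_mul (by positivity)]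
          ring_nf
      _ = _ := by
          rw [← ENNReal.ofReal_mul (mul_nonneg (div_nonneg (by norm_num) (by linarith))
            (by positivity))]
          congr 1
          rw [hB]
          simp only
          rw [Real.mul_rpow (by positivity) (by positivity), ← Real.rpow_mul h0.le]
          have : f x ^ (r / (r - 1)) = f x ^ 2 * f x ^ (-(1 / (r - 1)) * (r - 2)) := by
            rw [← Real.rpow_natCast, ← Real.rpow_add h0]
            congr 1
            have : r - 1 ≠ 0 := by linarith
            push_cast
            field_simp
            ring
          rw [this]
          ring
  refine (mul_le_mul_right (lintegral_mono inner) _).trans (le_of_eq ?_)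
  rw [lintegral_const_mul _ (by fun_prop), ← mul_assoc, ← ENNReal.ofReal_mul (by linarith)]
  congr 2
  ring

end Interpolation

section Multiplier

variable {d : ℕ} {m f g : Euc d → ℂ}

theorem continuous_fourier_of_integrable (hf : Integrable f) : Continuous (𝓕 f) :=
  VectorFourier.fourierIntegral_continuous Real.continuous_fourierChar continuous_inner hf

theorem norm_fourier_le_integral_norm (f : Euc d → ℂ) (ξ : Euc d) : ‖𝓕 f ξ‖ ≤ ∫ y, ‖f y‖ :=
  VectorFourier.norm_fourierIntegral_le_integral_norm _ _ _ _ _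

theorem integrable_mul_fourier (hm : Integrable m) (hf : Integrable f) :
    Integrable fun ξ => m ξ * 𝓕 f ξ :=
  hm.mul_bdd (c := ∫ y, ‖f y‖) (continuous_fourier_of_integrable hf).aestronglyMeasurable
    (Filter.Eventually.of_forall (norm_fourier_le_integral_norm f))

theorem continuous_mulOp (hm : Integrable m) (hf : Integrable f) : Continuous (mulOp m f) := by
  have : mulOp m f = (𝓕 fun ξ => m ξ * 𝓕 f ξ) ∘ fun x => -x := by
    ext x
    exact Real.fourierInv_eq_fourier_neg _ x
  rw [this]
  exact (continuous_fourier_of_integrable (integrable_mul_fourier hm hf)).comp continuous_neg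

theorem mulOp_add (hm : Integrable m) (hf : Integrable f) (hg : Integrable g) (x : Euc d) :
    mulOp m (fun y => f y + g y) x = mulOp m f x + mulOp m g x := by
  simp only [mulOp, Real.fourierInv_eq]
  rw [← integral_add]
  · refine integral_congr_ae (Filter.Eventually.of_forall fun ξ => ?_)
    have : 𝓕 (fun y => f y + g y) ξ = 𝓕 f ξ + 𝓕 g ξ := by
      simp only [Real.fourier_eq]
      rw [← integral_add]
      · simp only [smul_add]
      · exact (Real.fourierIntegral_convergent_iff ξ).2 hf
      · exact (Real.fourierIntegral_convergent_iff ξ).2 hg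
    simp only [this, mul_add, smul_add]
  · simpa [Circle.smul_def] using (integrable_mul_fourier hm hf).fourierChar_mul x
  · simpa [Circle.smul_def] using (integrable_mul_fourier hm hg).fourierChar_mul x

theorem mulOp_eq_integral (hm : Integrable m) (hf : Integrable f) (x : Euc d) :
    mulOp m f x = ∫ y, f y * 𝓕⁻ m (x - y) := by
  have e1 : mulOp m f x =
      ∫ ξ, ∫ y, (𝐞 (inner ℝ ξ x) : ℂ) * m ξ * ((𝐞 (-inner ℝ y ξ) : ℂ) * f y) := by
    simp only [mulOp, Real.fourierInv_eq, Real.fourier_eq, Circle.smul_def, smul_eq_mul]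
    refine integral_congr_ae (Filter.Eventually.of_forall fun ξ => ?_)
    beta_reduce
    rw [integral_const_mul]
    ring
  rw [e1, integral_integral_swap]
  · refine integral_congr_ae (Filter.Eventually.of_forall fun y => ?_)
    beta_reduce
    rw [Real.fourierInv_eq, ← integral_const_mul]
    refine integral_congr_ae (Filter.Eventually.of_forall fun ξ => ?_)
    simp only [Circle.smul_def, smul_eq_mul]
    rw [inner_sub_right, sub_eq_add_neg, AddChar.map_add_eq_mul, Circle.coe_mul,
      real_inner_comm y ξ]
    ring
  · refine ((hm.mul_prod hf).norm).mono' ?_ ?_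
    · refine AEStronglyMeasurable.mul (AEStronglyMeasurable.mul ?_ hm.1.comp_fst)
        (AEStronglyMeasurable.mul ?_ hf.1.comp_snd)
      · exact (Continuous.aestronglyMeasurable (by fun_prop))
      · exact (Continuous.aestronglyMeasurable (by fun_prop))
    · refine Filter.Eventually.of_forall fun p => ?_
      simp only [Function.uncurry, norm_mul, Circle.norm_coe, one_mul, le_refl]

theorem norm_mulOp_le {A : ℝ} (hm : Integrable m) (hf : Integrable f) (hA : ∀ x, ‖𝓕⁻ m x‖ ≤ A)
    (x : Euc d) : ‖mulOp m f x‖ ≤ A * ∫ y, ‖f y‖ := by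
  rw [mulOp_eq_integral hm hf, ← integral_const_mul]
  refine norm_integral_le_of_norm_le (hf.norm.const_mul A) (Filter.Eventually.of_forall fun y => ?_)
  rw [norm_mul, mul_comm]
  exact mul_le_mul_of_nonneg_right (hA _) (norm_nonneg _)

theorem eLpNorm_mulOp_le (hm : Integrable m) (hm1 : ∀ ξ, ‖m ξ‖ ≤ 1) (hf : Integrable f)
    (hf2 : MemLp f 2) : eLpNorm (mulOp m f) 2 ≤ eLpNorm f 2 := by
  have hle : eLpNorm (fun ξ => m ξ * 𝓕 f ξ) 2 ≤ eLpNorm (𝓕 f) 2 := by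
    refine eLpNorm_mono fun ξ => ?_
    rw [norm_mul]
    exact mul_le_of_le_one_left (norm_nonneg _) (hm1 ξ)
  have hF : eLpNorm (𝓕 f) 2 = eLpNorm f 2 := eLpNorm_fourier_eq hf hf2
  have hmem : MemLp (fun ξ => m ξ * 𝓕 f ξ) 2 :=
    ⟨(integrable_mul_fourier hm hf).1, hle.trans_lt (hF ▸ hf2.2)⟩
  rw [mulOp, eLpNorm_fourierInv_eq (integrable_mul_fourier hm hf) hmem]
  exact hle.trans hF.le

theorem integrable_norm_rpow_of_bounded {X : Type*} [MeasurableSpace X] {μ : Measure X} {f : X → ℂ}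
    (hf : Integrable f μ) {M : ℝ} (hM : ∀ x, ‖f x‖ ≤ M) {p : ℝ} (hp : 1 ≤ p) :
    Integrable (fun x => ‖f x‖ ^ p) μ := by
  refine (hf.norm.const_mul (M ^ (p - 1))).mono' ?_ (Filter.Eventually.of_forall fun x => ?_)
  · exact (hf.1.norm.aemeasurable.pow_const p).aestronglyMeasurable
  · rw [Real.norm_of_nonneg (by positivity)]
    rcases (norm_nonneg (f x)).eq_or_lt with h | h
    · rw [← h, Real.zero_rpow (by linarith), mul_zero]
    · calc ‖f x‖ ^ p = ‖f x‖ ^ (p - 1) * ‖f x‖ := by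
            rw [← Real.rpow_add_one h.ne']; ring_nf
        _ ≤ _ := mul_le_mul_of_nonneg_right
            (Real.rpow_le_rpow h.le (hM x) (by linarith)) h.le

theorem memLp_two_of_integrable_of_bounded {X : Type*} [MeasurableSpace X] {μ : Measure X}
    {f : X → ℂ} (hf : Integrable f μ) {M : ℝ} (hM : ∀ x, ‖f x‖ ≤ M) : MemLp f 2 μ := by
  rw [memLp_two_iff_integrable_sq_norm hf.1]
  simpa using integrable_norm_rpow_of_bounded hf hM (p := 2) (by norm_num)

/-- Interpolation between the `L² → L²` and `L¹ → L^∞` bounds of a Fourier multiplier, for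
normalised functions. -/
theorem lintegral_mulOp_rpow_le (hm : Integrable m) (hm1 : ∀ ξ, ‖m ξ‖ ≤ 1) {A : ℝ} (hA0 : 0 < A)
    (hA : ∀ x, ‖𝓕⁻ m x‖ ≤ A) (hfm : Measurable f) (hf : Integrable f) {M : ℝ}
    (hM : ∀ x, ‖f x‖ ≤ M) {r : ℝ} (hr : 2 < r) (hn : ∫ x, ‖f x‖ ^ (r / (r - 1)) ≤ 1) :
    ∫⁻ x, ENNReal.ofReal (‖mulOp m f x‖ ^ r) ≤
      ENNReal.ofReal (4 * r / (r - 2) * (2 * A) ^ (r - 2)) := by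
  set p := r / (r - 1) with hp
  have hr1 : 0 < r - 1 := by linarith
  have hp1 : 1 ≤ p := by rw [hp, le_div_iff₀ hr1]; linarith
  have hip := integrable_norm_rpow_of_bounded hf hM hp1
  refine (lintegral_rpow_le_of_meas_lt_le (f := fun x => ‖f x‖) (r := r) (A := A) hfm.norm
    (fun x => norm_nonneg _) (continuous_mulOp hm hf).measurable.norm (fun x => norm_nonneg _)
    hA0 hr ?_).trans ?_
  · intro y hy
    set c := (2 * A / y) ^ (r - 1) with hc
    have hc0 : 0 < c := by positivity
    have hs : MeasurableSet {x | ‖f x‖ ≤ c} := measurableSet_le hfm.norm measurable_const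
    set f₁ := {x | ‖f x‖ ≤ c}.indicator f with hf₁
    set f₂ := {x | ‖f x‖ ≤ c}ᶜ.indicator f with hf₂
    have i₁ : Integrable f₁ := hf.indicator hs
    have i₂ : Integrable f₂ := hf.indicator hs.compl
    have hsum : f = fun x => f₁ x + f₂ x := by
      ext x
      exact congrFun (Set.indicator_self_add_compl _ f).symm x
    have h2 : ∀ x, ‖mulOp m f₂ x‖ ≤ y / 2 := by
      intro x
      refine (norm_mulOp_le hm i₂ hA x).trans ?_
      have : ∫ y, ‖f₂ y‖ ≤ c ^ (1 - p) * 1 := by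
        refine le_trans ?_ (mul_le_mul_of_nonneg_left hn (by positivity))
        rw [← integral_const_mul]
        refine integral_mono i₂.norm (hip.const_mul _) fun z => ?_
        simp only [hf₂, Set.indicator_apply, Set.mem_compl_iff, Set.mem_ofPred_eq, not_le]
        split_ifs with h
        · have hz : 0 < ‖f z‖ := hc0.trans h
          calc ‖f z‖ = ‖f z‖ ^ (1 - p) * ‖f z‖ ^ p := by
                rw [← Real.rpow_add hz]; simp
            _ ≤ _ := mul_le_mul_of_nonneg_right
                (Real.rpow_le_rpow_of_nonpos hc0 h.le (by linarith)) (by positivity)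
        · simp only [norm_zero]
          positivity
      calc A * ∫ y, ‖f₂ y‖ ≤ A * (c ^ (1 - p) * 1) := mul_le_mul_of_nonneg_left this hA0.le
        _ = y / 2 := by
          rw [hc, ← Real.rpow_mul (by positivity)]
          have : (r - 1) * (1 - p) = -1 := by rw [hp]; field_simp; ring
          rw [this, Real.rpow_neg_one]
          field_simp
    have hsub : {x | y < ‖mulOp m f x‖} ⊆ {x | ENNReal.ofReal (y / 2) ^ 2 ≤ ‖mulOp m f₁ x‖ₑ ^ 2} := by
      intro x hx
      have hx : y < ‖mulOp m f x‖ := hx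
      have e : mulOp m f x = mulOp m f₁ x + mulOp m f₂ x := by
        conv_lhs => rw [hsum]
        exact mulOp_add hm i₁ i₂ x
      have : y / 2 ≤ ‖mulOp m f₁ x‖ := by
        have := norm_add_le (mulOp m f₁ x) (mulOp m f₂ x)
        rw [← e] at this
        linarith [h2 x]
      have h3 : ENNReal.ofReal (y / 2) ≤ ‖mulOp m f₁ x‖ₑ := by
        rw [← ofReal_norm]
        exact ENNReal.ofReal_le_ofReal this
      exact pow_le_pow_left' h3 2
    have m1 : MemLp f₁ 2 := (memLp_two_of_integrable_of_bounded hf hM).indicator hs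
    have hL2 : ∫⁻ x, ‖mulOp m f₁ x‖ₑ ^ 2 ≤ ∫⁻ x, ‖f₁ x‖ₑ ^ 2 := by
      have := eLpNorm_mulOp_le hm hm1 i₁ m1
      rw [eLpNorm_eq_lintegral_rpow_enorm_toReal (by norm_num) (by norm_num),
        eLpNorm_eq_lintegral_rpow_enorm_toReal (by norm_num) (by norm_num)] at this
      simpa using (ENNReal.rpow_le_rpow_iff (by norm_num : (0 : ℝ) < 1 / 2)).1
        (by simpa using this)
    have hy2 : ENNReal.ofReal (y / 2) ^ 2 ≠ 0 :=
      pow_ne_zero _ (by simpa using hy)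
    calc volume {x | y < ‖mulOp m f x‖}
        ≤ volume {x | ENNReal.ofReal (y / 2) ^ 2 ≤ ‖mulOp m f₁ x‖ₑ ^ 2} := measure_mono hsub
      _ ≤ (∫⁻ x, ‖mulOp m f₁ x‖ₑ ^ 2) / ENNReal.ofReal (y / 2) ^ 2 :=
          meas_ge_le_lintegral_div
            ((continuous_mulOp hm i₁).measurable.enorm.pow_const 2).aemeasurable hy2
            (ENNReal.pow_ne_top ENNReal.ofReal_ne_top)
      _ ≤ (∫⁻ x, ‖f₁ x‖ₑ ^ 2) / ENNReal.ofReal (y / 2) ^ 2 := ENNReal.div_le_div_right hL2 _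
      _ = _ := by
          rw [div_eq_mul_inv, ← lintegral_mul_const _ (by fun_prop), ← lintegral_indicator hs]
          refine lintegral_congr fun x => ?_
          simp only [hf₁, Set.indicator_apply]
          split_ifs
          · rw [← ofReal_norm, ← ENNReal.ofReal_pow (norm_nonneg _),
              ← ENNReal.ofReal_pow (by positivity), ← ENNReal.ofReal_inv_of_pos (by positivity),
              ← ENNReal.ofReal_mul (by positivity)]
            congr 1
            field_simp
            norm_num
          · simp
  · rw [← ofReal_integral_eq_lintegral_ofReal hip (Filter.Eventually.of_forall fun x => by
      positivity)]
    exact mul_le_of_le_one_right (zero_le) (by simpa using hn)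

theorem integral_mul_fourier_mul_conj (hm : Integrable m) (hf : Integrable f) (hg : Integrable g) :
    ∫ ξ, m ξ * 𝓕 f ξ * (starRingEnd ℂ) (𝓕 g ξ) = ∫ x, mulOp m f x * (starRingEnd ℂ) (g x) := by
  have hh := integrable_mul_fourier hm hf
  have e1 : ∀ ξ, m ξ * 𝓕 f ξ * (starRingEnd ℂ) (𝓕 g ξ) =
      ∫ x, m ξ * 𝓕 f ξ * ((𝐞 (inner ℝ x ξ) : ℂ) * (starRingEnd ℂ) (g x)) := by
    intro ξ
    rw [integral_const_mul, Real.fourier_eq g, ← integral_conj]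
    congr 1
    refine integral_congr_ae (Filter.Eventually.of_forall fun x => ?_)
    simp only [Circle.smul_def, smul_eq_mul, map_mul, ← Circle.coe_inv_eq_conj]
    rw [AddChar.map_neg_eq_inv, inv_inv]
  simp only [e1]
  rw [integral_integral_swap]
  · refine integral_congr_ae (Filter.Eventually.of_forall fun x => ?_)
    beta_reduce
    rw [mulOp, Real.fourierInv_eq, ← integral_mul_const]
    refine integral_congr_ae (Filter.Eventually.of_forall fun ξ => ?_)
    simp only [Circle.smul_def, smul_eq_mul]
    rw [real_inner_comm x ξ]
    ring
  · refine ((hh.mul_prod hg).norm).mono' ?_ ?_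
    · refine AEStronglyMeasurable.mul hh.1.comp_fst (AEStronglyMeasurable.mul ?_ ?_)
      · exact (Continuous.aestronglyMeasurable (by fun_prop))
      · exact Complex.continuous_conj.comp_aestronglyMeasurable hg.1.comp_snd
    · refine Filter.Eventually.of_forall fun p => ?_
      simp only [Function.uncurry, norm_mul, Circle.norm_coe, one_mul, RCLike.norm_conj, le_refl]

/-- The bilinear form of a Fourier multiplier, interpolated between `L²` and `L¹`: bound for
normalised first argument. -/
theorem norm_integral_mul_fourier_mul_conj_le_of_le_one (hm : Integrable m) (hm1 : ∀ ξ, ‖m ξ‖ ≤ 1)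
    {A : ℝ} (hA0 : 0 < A) (hA : ∀ x, ‖𝓕⁻ m x‖ ≤ A) (hfm : Measurable f) (hf : Integrable f)
    {M M' : ℝ} (hM : ∀ x, ‖f x‖ ≤ M) (hg : Integrable g) (hM' : ∀ x, ‖g x‖ ≤ M') {r : ℝ}
    (hr : 2 < r) (hn : ∫ x, ‖f x‖ ^ (r / (r - 1)) ≤ 1) :
    ‖∫ ξ, m ξ * 𝓕 f ξ * (starRingEnd ℂ) (𝓕 g ξ)‖ ≤
      (4 * r / (r - 2) * (2 * A) ^ (r - 2)) ^ (1 / r) *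
        (∫ x, ‖g x‖ ^ (r / (r - 1))) ^ (1 / (r / (r - 1))) := by
  have hr1 : 0 < r - 1 := by linarith
  have hr2 : 0 < r - 2 := by linarith
  have hp1 : 1 ≤ r / (r - 1) := by rw [le_div_iff₀ hr1]; linarith
  have hK := lintegral_mulOp_rpow_le hm hm1 hA0 hA hfm hf hM hr hn
  have hconj : r.HolderConjugate (r / (r - 1)) := Real.HolderConjugate.conjExponent (by linarith)
  have hcont := continuous_mulOp hm hf
  have hi : Integrable fun x => ‖mulOp m f x‖ ^ r := by
    refine ⟨(hcont.norm.rpow_const fun _ => Or.inr (by linarith)).aestronglyMeasurable, ?_⟩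
    rw [hasFiniteIntegral_iff_ofReal (Filter.Eventually.of_forall fun x => by positivity)]
    exact hK.trans_lt ENNReal.ofReal_lt_top
  have hI : ∫ x, ‖mulOp m f x‖ ^ r ≤ 4 * r / (r - 2) * (2 * A) ^ (r - 2) := by
    rw [← ENNReal.ofReal_le_ofReal_iff (by positivity), ofReal_integral_eq_lintegral_ofReal hi
      (Filter.Eventually.of_forall fun x => by positivity)]
    exact hK
  rw [integral_mul_fourier_mul_conj hm hf hg]
  calc ‖∫ x, mulOp m f x * (starRingEnd ℂ) (g x)‖ ≤ ∫ x, ‖mulOp m f x‖ * ‖g x‖ := by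
        refine (norm_integral_le_integral_norm _).trans (le_of_eq ?_)
        simp only [norm_mul, RCLike.norm_conj]
    _ ≤ (∫ x, ‖mulOp m f x‖ ^ r) ^ (1 / r) *
        (∫ x, ‖g x‖ ^ (r / (r - 1))) ^ (1 / (r / (r - 1))) := by
        refine integral_mul_le_Lp_mul_Lq_of_nonneg hconj
          (Filter.Eventually.of_forall fun x => norm_nonneg _)
          (Filter.Eventually.of_forall fun x => norm_nonneg _) ?_ ?_
        · rw [← integrable_norm_rpow_iff hcont.norm.aestronglyMeasurable (by simp; linarith)
            (by simp)]
          rw [ENNReal.toReal_ofReal (by linarith)]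
          simpa using hi
        · rw [← integrable_norm_rpow_iff hg.1.norm (by simp; linarith) (by simp)]
          rw [ENNReal.toReal_ofReal (by linarith)]
          simpa using integrable_norm_rpow_of_bounded hg hM' hp1
    _ ≤ _ := by gcongr

theorem fourier_const_mul (c : ℂ) (f : Euc d → ℂ) (ξ : Euc d) :
    𝓕 (fun x => c * f x) ξ = c * 𝓕 f ξ := by
  simp only [Real.fourier_eq, Circle.smul_def, smul_eq_mul]
  rw [← integral_const_mul]
  refine integral_congr_ae (Filter.Eventually.of_forall fun x => ?_)
  ring

/-- The bilinear form of a Fourier multiplier, interpolated between `L²` and `L¹`. -/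
theorem norm_integral_mul_fourier_mul_conj_le (hm : Integrable m) (hm1 : ∀ ξ, ‖m ξ‖ ≤ 1)
    {A : ℝ} (hA0 : 0 < A) (hA : ∀ x, ‖𝓕⁻ m x‖ ≤ A) (hfm : Measurable f) (hf : Integrable f)
    {M M' : ℝ} (hM : ∀ x, ‖f x‖ ≤ M) (hg : Integrable g) (hM' : ∀ x, ‖g x‖ ≤ M') {r : ℝ}
    (hr : 2 < r) :
    ‖∫ ξ, m ξ * 𝓕 f ξ * (starRingEnd ℂ) (𝓕 g ξ)‖ ≤
      (4 * r / (r - 2) * (2 * A) ^ (r - 2)) ^ (1 / r) *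
        (∫ x, ‖f x‖ ^ (r / (r - 1))) ^ (1 / (r / (r - 1))) *
        (∫ x, ‖g x‖ ^ (r / (r - 1))) ^ (1 / (r / (r - 1))) := by
  have hr1 : 0 < r - 1 := by linarith
  have hr2 : 0 < r - 2 := by linarith
  set p := r / (r - 1) with hp
  have hp1 : 1 ≤ p := by rw [hp, le_div_iff₀ hr1]; linarith
  have hip := integrable_norm_rpow_of_bounded hf hM hp1
  have hI0 : 0 ≤ ∫ x, ‖f x‖ ^ p := integral_nonneg fun x => by positivity
  rcases hI0.eq_or_lt with h0 | h0
  · have hae : f =ᵐ[volume] fun _ => 0 := by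
      have := (integral_eq_zero_iff_of_nonneg (fun x => by positivity) hip).1 h0.symm
      filter_upwards [this] with x hx
      have hx : ‖f x‖ ^ p = 0 := hx
      rw [Real.rpow_eq_zero (norm_nonneg _) (by linarith)] at hx
      exact norm_eq_zero.1 hx
    have hF : ∀ ξ, 𝓕 f ξ = 0 := by
      intro ξ
      rw [Real.fourier_eq]
      refine integral_eq_zero_of_ae ?_
      filter_upwards [hae] with x hx
      simp [hx]
    simp only [hF, mul_zero, zero_mul, integral_zero, norm_zero]
    positivity
  · set N := (∫ x, ‖f x‖ ^ p) ^ (1 / p) with hN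
    have hN0 : 0 < N := by positivity
    have hc : ∀ x, ‖((N⁻¹ : ℝ) : ℂ) * f x‖ = N⁻¹ * ‖f x‖ := fun x => by
      rw [norm_mul, Complex.norm_real, Real.norm_of_nonneg (by positivity)]
    have key := norm_integral_mul_fourier_mul_conj_le_of_le_one (f := fun x => ((N⁻¹ : ℝ) : ℂ) * f x)
      (M := N⁻¹ * M) hm hm1 hA0 hA (by fun_prop) (hf.const_mul _)
      (fun x => by rw [hc]; exact mul_le_mul_of_nonneg_left (hM x) (by positivity)) hg hM' hr ?_
    · have e : ∀ ξ, m ξ * 𝓕 (fun x => ((N⁻¹ : ℝ) : ℂ) * f x) ξ * (starRingEnd ℂ) (𝓕 g ξ) =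
          ((N⁻¹ : ℝ) : ℂ) * (m ξ * 𝓕 f ξ * (starRingEnd ℂ) (𝓕 g ξ)) := fun ξ => by
        rw [fourier_const_mul]; ring
      simp only [e] at key
      rw [integral_const_mul, norm_mul, Complex.norm_real, Real.norm_of_nonneg (by positivity),
        inv_mul_le_iff₀ hN0] at key
      refine key.trans (le_of_eq ?_)
      ring
    · simp only [hc, ← hp]
      have : ∀ x, (N⁻¹ * ‖f x‖) ^ p = (∫ x, ‖f x‖ ^ p)⁻¹ * ‖f x‖ ^ p := fun x => by
        rw [Real.mul_rpow (by positivity) (norm_nonneg _), Real.inv_rpow hN0.le, hN,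
          ← Real.rpow_mul hI0, one_div_mul_cancel (by linarith), Real.rpow_one]
      simp only [this]
      rw [integral_const_mul, inv_mul_cancel₀ h0.ne']

end Multiplier

section FractionalIntegration

theorem lintegral_Ioi_rpow_neg_two {h : ℝ} (hh : 0 < h) :
    ∫⁻ t in Set.Ioi h, ENNReal.ofReal (t ^ (-2 : ℝ)) = ENNReal.ofReal h⁻¹ := by
  rw [← ofReal_integral_eq_lintegral_ofReal (integrableOn_Ioi_rpow_of_lt (by norm_num) hh),
    integral_Ioi_rpow_of_lt (by norm_num) hh]
  · norm_num [Real.rpow_neg_one]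
  · filter_upwards [ae_restrict_mem measurableSet_Ioi] with t ht
    exact Real.rpow_nonneg (hh.trans ht).le _

/-- Pointwise form of the splitting at distance `h = y^{-p}` used for fractional integration. -/
theorem mul_rpow_neg_le_add {γ y z τ : ℝ} (h0 : 0 < γ) (h1 : γ < 1) (hy : 0 < y) (hz : 0 ≤ z)
    (hzy : z ≤ y) :
    z * |τ| ^ (-γ) ≤ y ^ (2 / (2 - γ) - 1) * z ^ (2 / (2 - γ)) +
      ((Set.Ioc 0 (y ^ (-(2 / (2 - γ))))).indicator (fun u => y * u ^ (-γ)) |τ| +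
      (Set.Ioi (y ^ (-(2 / (2 - γ))))).indicator (fun u => y⁻¹ * u ^ (-2 : ℝ)) |τ|) := by
  set p := 2 / (2 - γ) with hp
  have h2 : 0 < 2 - γ := by linarith
  have hp1 : 1 < p := by rw [hp, lt_div_iff₀ h2]; linarith
  have hh : 0 < y ^ (-p) := by positivity
  have hA : 0 ≤ y ^ (p - 1) * z ^ p := by positivity
  rcases (abs_nonneg τ).eq_or_lt with ht | ht
  · rw [← ht, Real.zero_rpow (by linarith), mul_zero]
    simp only [Set.indicator_apply, Set.mem_Ioc, lt_self_iff_false, false_and, if_false,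
      Set.mem_Ioi, not_lt.2 hh.le, add_zero]
    exact hA
  by_cases hle : |τ| ≤ y ^ (-p)
  · rw [Set.indicator_of_mem (show |τ| ∈ Set.Ioc 0 (y ^ (-p)) from ⟨ht, hle⟩),
      Set.indicator_of_notMem (show |τ| ∉ Set.Ioi (y ^ (-p)) from not_lt.2 hle), add_zero]
    have : z * |τ| ^ (-γ) ≤ y * |τ| ^ (-γ) := by gcongr
    linarith
  · rw [not_le] at hle
    rw [Set.indicator_of_notMem (show |τ| ∉ Set.Ioc 0 (y ^ (-p)) from fun h => not_le.2 hle h.2),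
      Set.indicator_of_mem (show |τ| ∈ Set.Ioi (y ^ (-p)) from hle), zero_add]
    have hconj : p.HolderConjugate (2 / γ) := by
      rw [Real.holderConjugate_iff]
      refine ⟨hp1, ?_⟩
      rw [hp]
      field_simp
      ring
    set ε := y ^ ((p - 1) / p) with hε
    have hε0 : 0 < ε := by positivity
    have hyoung := Real.young_inequality_of_nonneg (a := ε * z) (b := ε⁻¹ * |τ| ^ (-γ))
      (by positivity) (by positivity) hconj
    have e1 : (ε * z) ^ p = y ^ (p - 1) * z ^ p := by
      rw [Real.mul_rpow hε0.le hz, hε, ← Real.rpow_mul hy.le, div_mul_cancel₀ _ (by linarith)]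
    have e2 : (ε⁻¹ * |τ| ^ (-γ)) ^ (2 / γ) = y⁻¹ * |τ| ^ (-2 : ℝ) := by
      rw [Real.mul_rpow (by positivity) (by positivity), hε, ← Real.rpow_neg hy.le,
        ← Real.rpow_mul hy.le, ← Real.rpow_mul ht.le, ← Real.rpow_neg_one y]
      congr 2
      · rw [hp]
        field_simp
        ring
      · field_simp
    rw [e1, e2] at hyoung
    have e3 : ε * z * (ε⁻¹ * |τ| ^ (-γ)) = z * |τ| ^ (-γ) := by
      field_simp
    rw [e3] at hyoung
    refine hyoung.trans (add_le_add (div_le_self hA hp1.le) (div_le_self (by positivity) ?_))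
    rw [le_div_iff₀ h0]
    linarith

theorem lintegral_abs_le {f : ℝ → ℝ≥0∞} (hf : Measurable f) (hf0 : f 0 = 0) :
    ∫⁻ τ, f |τ| ≤ 2 * ∫⁻ τ in Set.Ioi 0, f τ := by
  have key : ∀ τ : ℝ, f |τ| ≤ (Set.Ioi 0).indicator f τ + (Set.Ioi 0).indicator f (-τ) := by
    intro τ
    rcases lt_trichotomy τ 0 with h | h | h
    · rw [abs_of_neg h, Set.indicator_of_mem (show -τ ∈ Set.Ioi (0 : ℝ) by simpa using h)]
      exact le_add_self
    · simp [h, hf0]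
    · rw [abs_of_pos h, Set.indicator_of_mem (show τ ∈ Set.Ioi (0 : ℝ) from h)]
      exact le_self_add
  refine (lintegral_mono key).trans (le_of_eq ?_)
  rw [lintegral_add_left (hf.indicator measurableSet_Ioi),
    lintegral_neg_eq_self (f := fun τ => (Set.Ioi 0).indicator f τ),
    lintegral_indicator measurableSet_Ioi, two_mul]

theorem lintegral_mul_rpow_neg_le {γ : ℝ} (h0 : 0 < γ) (h1 : γ < 1) {θ : ℝ → ℝ}
    (hθ : Measurable θ) (hθ0 : ∀ t, 0 ≤ θ t)
    (hn : ∫⁻ t, ENNReal.ofReal (θ t ^ (2 / (2 - γ))) ≤ 1) (t : ℝ) :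
    ∫⁻ s, {p : ℝ × ℝ | θ p.2 ≤ θ p.1}.indicator
        (fun p => ENNReal.ofReal (θ p.1 * θ p.2 * |p.1 - p.2| ^ (-γ))) (t, s) ≤
      ENNReal.ofReal (3 + 2 / (1 - γ)) * ENNReal.ofReal (θ t ^ (2 / (2 - γ))) := by
  set p := 2 / (2 - γ) with hp
  have h2 : 0 < 2 - γ := by linarith
  have h1' : 0 < 1 - γ := by linarith
  have hp1 : 1 < p := by rw [hp, lt_div_iff₀ h2]; linarith
  rcases (hθ0 t).eq_or_lt with hy | hy
  · have : ∀ s, {p : ℝ × ℝ | θ p.2 ≤ θ p.1}.indicator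
        (fun p => ENNReal.ofReal (θ p.1 * θ p.2 * |p.1 - p.2| ^ (-γ))) (t, s) = 0 := by
      intro s
      simp [Set.indicator_apply, ← hy]
    simp [this]
  set y := θ t with hyt
  set k₁ : ℝ → ℝ≥0∞ := fun u => (Set.Ioc 0 (y ^ (-p))).indicator
    (fun u => ENNReal.ofReal (y ^ 2) * ENNReal.ofReal (u ^ (-γ))) u with hk₁
  set k₂ : ℝ → ℝ≥0∞ := fun u => (Set.Ioi (y ^ (-p))).indicator
    (fun u => ENNReal.ofReal (u ^ (-2 : ℝ))) u with hk₂
  have mk₁ : Measurable k₁ := Measurable.indicator (by fun_prop) measurableSet_Ioc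
  have mk₂ : Measurable k₂ := Measurable.indicator (by fun_prop) measurableSet_Ioi
  have hh : 0 < y ^ (-p) := by positivity
  have pw : ∀ s, {p : ℝ × ℝ | θ p.2 ≤ θ p.1}.indicator
        (fun p => ENNReal.ofReal (θ p.1 * θ p.2 * |p.1 - p.2| ^ (-γ))) (t, s) ≤
      ENNReal.ofReal (y ^ p) * ENNReal.ofReal (θ s ^ p) + (k₁ |t - s| + k₂ |t - s|) := by
    intro s
    simp only [Set.indicator_apply (s := {p : ℝ × ℝ | θ p.2 ≤ θ p.1}), Set.mem_ofPred_eq]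
    split_ifs with hle
    · have := mul_le_mul_of_nonneg_left (mul_rpow_neg_le_add h0 h1 (τ := t - s) hy (hθ0 s) hle)
        hy.le
      rw [← hp] at this
      have e1 : y ^ p = y * y ^ (p - 1) := by
        rw [mul_comm, ← Real.rpow_add_one hy.ne']; ring_nf
      calc ENNReal.ofReal (y * θ s * |t - s| ^ (-γ)) ≤ _ :=
            ENNReal.ofReal_le_ofReal ((mul_assoc _ _ _).le.trans this)
        _ ≤ _ := by
          rw [mul_add, mul_add]
          refine ENNReal.ofReal_add_le.trans (add_le_add (le_of_eq ?_)
            (ENNReal.ofReal_add_le.trans (add_le_add (le_of_eq ?_) (le_of_eq ?_))))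
          · rw [← ENNReal.ofReal_mul (by positivity), e1]
            ring_nf
          · simp only [hk₁, Set.indicator_apply]
            split_ifs
            · rw [← ENNReal.ofReal_mul (by positivity)]
              ring_nf
            · simp
          · simp only [hk₂, Set.indicator_apply]
            split_ifs
            · congr 1
              field_simp
            · simp
    · exact zero_le
  refine (lintegral_mono pw).trans ?_
  rw [lintegral_add_left (by fun_prop), lintegral_const_mul _ (by fun_prop)]
  have e2 : ∫⁻ s, (k₁ |t - s| + k₂ |t - s|) = ∫⁻ s, (k₁ |s| + k₂ |s|) :=
    lintegral_sub_left_eq_self (fun s => k₁ |s| + k₂ |s|) t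
  have b1 : ∫⁻ s, k₁ |s| ≤ 2 * ENNReal.ofReal (y ^ p / (1 - γ)) := by
    refine (lintegral_abs_le mk₁ (by simp [hk₁])).trans (mul_le_mul_right ?_ 2)
    refine (setLIntegral_le_lintegral _ _).trans (le_of_eq ?_)
    rw [hk₁, lintegral_indicator measurableSet_Ioc, lintegral_const_mul _ (by fun_prop),
      lintegral_Ioc_rpow (by linarith) hh.le, ← ENNReal.ofReal_mul (by positivity)]
    congr 1
    rw [← Real.rpow_mul hy.le, ← mul_div_assoc, ← Real.rpow_natCast, ← Real.rpow_add hy,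
      neg_add_eq_sub]
    congr 2
    rw [hp]
    field_simp
    push_cast
    ring
  have b2 : ∫⁻ s, k₂ |s| ≤ 2 * ENNReal.ofReal (y ^ p) := by
    refine (lintegral_abs_le mk₂ (by simp [hk₂, not_lt.2 hh.le])).trans (mul_le_mul_right ?_ 2)
    refine (setLIntegral_le_lintegral _ _).trans (le_of_eq ?_)
    rw [hk₂, lintegral_indicator measurableSet_Ioi, lintegral_Ioi_rpow_neg_two hh,
      Real.rpow_neg hy.le, inv_inv]
  rw [e2, lintegral_add_left (by fun_prop)]
  refine (add_le_add (mul_le_of_le_one_right zero_le hn) (add_le_add b1 b2)).trans (le_of_eq ?_)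
  have h2e : (2 : ℝ≥0∞) = ENNReal.ofReal 2 := by simp
  rw [h2e, ← ENNReal.ofReal_mul (by norm_num), ← ENNReal.ofReal_mul (by norm_num),
    ← ENNReal.ofReal_add (by positivity) (by positivity),
    ← ENNReal.ofReal_add (by positivity) (by positivity), ← ENNReal.ofReal_mul (by positivity)]
  congr 1
  field_simp
  ring

/-- The quadratic form of fractional integration on `L^p`, `p = 2/(2-γ)`, for normalised
functions. -/
theorem lintegral_lintegral_mul_rpow_neg_le_of_le_one {γ : ℝ} (h0 : 0 < γ) (h1 : γ < 1)
    {θ : ℝ → ℝ} (hθ : Measurable θ) (hθ0 : ∀ t, 0 ≤ θ t)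
    (hn : ∫⁻ t, ENNReal.ofReal (θ t ^ (2 / (2 - γ))) ≤ 1) :
    ∫⁻ t, ∫⁻ s, ENNReal.ofReal (θ t * θ s * |t - s| ^ (-γ)) ≤
      ENNReal.ofReal (6 + 4 / (1 - γ)) := by
  have h1' : 0 < 1 - γ := by linarith
  set Ψ : ℝ → ℝ → ℝ≥0∞ := fun t s => {p : ℝ × ℝ | θ p.2 ≤ θ p.1}.indicator
        (fun p => ENNReal.ofReal (θ p.1 * θ p.2 * |p.1 - p.2| ^ (-γ))) (t, s) with hΨ
  have mΨ : Measurable (Function.uncurry Ψ) :=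
    Measurable.indicator (by fun_prop) (measurableSet_le (by fun_prop) (by fun_prop))
  have mΨ' : Measurable fun p : ℝ × ℝ => Ψ p.2 p.1 := mΨ.comp measurable_swap
  have b : ∫⁻ t, ∫⁻ s, Ψ t s ≤ ENNReal.ofReal (3 + 2 / (1 - γ)) := by
    refine (lintegral_mono fun t => lintegral_mul_rpow_neg_le h0 h1 hθ hθ0 hn t).trans ?_
    rw [lintegral_const_mul _ (by fun_prop)]
    exact mul_le_of_le_one_right zero_le hn
  calc ∫⁻ t, ∫⁻ s, ENNReal.ofReal (θ t * θ s * |t - s| ^ (-γ))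
      ≤ ∫⁻ t, ∫⁻ s, (Ψ t s + Ψ s t) := by
        refine lintegral_mono fun t => lintegral_mono fun s => ?_
        simp only [hΨ, Set.indicator_apply, Set.mem_ofPred_eq]
        rcases le_total (θ s) (θ t) with h | h
        · rw [if_pos h]
          exact le_self_add
        · rw [if_pos h, abs_sub_comm, mul_comm (θ t)]
          exact le_add_self
    _ = (∫⁻ t, ∫⁻ s, Ψ t s) + ∫⁻ t, ∫⁻ s, Ψ s t := by
        refine Eq.trans (lintegral_congr fun t => lintegral_add_left mΨ.of_uncurry_left _)
          (lintegral_add_left mΨ.lintegral_prod_right' _)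
    _ = (∫⁻ t, ∫⁻ s, Ψ t s) + ∫⁻ t, ∫⁻ s, Ψ t s := by
        rw [lintegral_lintegral_swap (f := fun t s => Ψ s t) mΨ'.aemeasurable]
    _ ≤ ENNReal.ofReal (3 + 2 / (1 - γ)) + ENNReal.ofReal (3 + 2 / (1 - γ)) := add_le_add b b
    _ = _ := by
        rw [← ENNReal.ofReal_add (by positivity) (by positivity)]
        ring_nf

/-- Hardy–Littlewood–Sobolev inequality on the line, in quadratic form. -/
theorem lintegral_lintegral_mul_rpow_neg_le {γ : ℝ} (h0 : 0 < γ) (h1 : γ < 1)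
    {θ : ℝ → ℝ} (hθ : Measurable θ) (hθ0 : ∀ t, 0 ≤ θ t)
    (hi : Integrable fun t => θ t ^ (2 / (2 - γ))) :
    ∫⁻ t, ∫⁻ s, ENNReal.ofReal (θ t * θ s * |t - s| ^ (-γ)) ≤
      ENNReal.ofReal ((6 + 4 / (1 - γ)) * (∫ t, θ t ^ (2 / (2 - γ))) ^ (2 - γ)) := by
  have h1' : 0 < 1 - γ := by linarith
  have h2 : 0 < 2 - γ := by linarith
  set p := 2 / (2 - γ) with hp
  have hp0 : 0 < p := by positivity
  have hI0 : 0 ≤ ∫ t, θ t ^ p := integral_nonneg fun t => Real.rpow_nonneg (hθ0 t) _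
  rcases hI0.eq_or_lt with hI | hI
  · have hae : ∀ᵐ t, θ t = 0 := by
      have := (integral_eq_zero_iff_of_nonneg (fun t => Real.rpow_nonneg (hθ0 t) _) hi).1 hI.symm
      filter_upwards [this] with t ht
      exact (Real.rpow_eq_zero (hθ0 t) hp0.ne').1 ht
    refine le_of_eq_of_le ?_ zero_le
    rw [lintegral_eq_zero_iff' (by fun_prop)]
    filter_upwards [hae] with t ht
    simp [ht]
  · set N := (∫ t, θ t ^ p) ^ (1 / p) with hN
    have hN0 : 0 < N := by positivity
    have key := lintegral_lintegral_mul_rpow_neg_le_of_le_one h0 h1 (θ := fun t => N⁻¹ * θ t)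
      (by fun_prop) (fun t => mul_nonneg (by positivity) (hθ0 t)) ?_
    · have e : ∀ t s, ENNReal.ofReal (θ t * θ s * |t - s| ^ (-γ)) = ENNReal.ofReal (N ^ 2) *
          ENNReal.ofReal (N⁻¹ * θ t * (N⁻¹ * θ s) * |t - s| ^ (-γ)) := by
        intro t s
        rw [← ENNReal.ofReal_mul (by positivity)]
        congr 1
        field_simp
      simp only [e]
      have e2 : ∀ t, ∫⁻ s, ENNReal.ofReal (N ^ 2) *
          ENNReal.ofReal (N⁻¹ * θ t * (N⁻¹ * θ s) * |t - s| ^ (-γ)) = ENNReal.ofReal (N ^ 2) *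
          ∫⁻ s, ENNReal.ofReal (N⁻¹ * θ t * (N⁻¹ * θ s) * |t - s| ^ (-γ)) := fun t =>
        lintegral_const_mul _ (by fun_prop)
      simp only [e2]
      rw [lintegral_const_mul _ (by fun_prop)]
      refine (mul_le_mul_right key _).trans (le_of_eq ?_)
      rw [← ENNReal.ofReal_mul (by positivity), mul_comm, hN, ← Real.rpow_natCast,
        ← Real.rpow_mul hI0]
      congr 3
      rw [hp]
      field_simp
      norm_num
    · have e : ∀ t, (N⁻¹ * θ t) ^ p = (∫ t, θ t ^ p)⁻¹ * θ t ^ p := fun t => by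
        rw [Real.mul_rpow (by positivity) (hθ0 t), Real.inv_rpow hN0.le, hN,
          ← Real.rpow_mul hI0, one_div_mul_cancel hp0.ne', Real.rpow_one]
      simp only [← hp, e]
      rw [← ofReal_integral_eq_lintegral_ofReal (hi.const_mul _)
        (Filter.Eventually.of_forall fun t =>
          mul_nonneg (inv_nonneg.2 hI0) (Real.rpow_nonneg (hθ0 t) _)),
        integral_const_mul, inv_mul_cancel₀ hI.ne', ENNReal.ofReal_one]

end FractionalIntegration

section Duality

variable {d : ℕ}

/-- The plane wave `exp(i(2π⟨ξ,x⟩ - t φ(ξ)))`. -/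
def planeWave (φ : Euc d → ℝ) (t : ℝ) (x ξ : Euc d) : ℂ :=
  (𝐞 (inner ℝ ξ x) : ℂ) * cexp (-(t * φ ξ : ℝ) * I)

theorem norm_planeWave (φ : Euc d → ℝ) (t : ℝ) (x ξ : Euc d) : ‖planeWave φ t x ξ‖ = 1 := by
  rw [planeWave, norm_mul, Circle.norm_coe, one_mul, ← Complex.ofReal_neg,
    Complex.norm_exp_ofReal_mul_I]

theorem measurable_planeWave {φ : Euc d → ℝ} (hφ : Measurable φ) {X : Type*} [MeasurableSpace X]
    {t : X → ℝ} {x ξ : X → Euc d} (ht : Measurable t) (hx : Measurable x) (hξ : Measurable ξ) :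
    Measurable fun p => planeWave φ (t p) (x p) (ξ p) := by
  unfold planeWave
  have h1 : Measurable fun p => (𝐞 (inner ℝ (ξ p) (x p)) : ℂ) :=
    (Continuous.measurable (by fun_prop : Continuous fun s : ℝ => (𝐞 s : ℂ))).comp
      (hξ.inner hx)
  have h2 : Measurable fun p => φ (ξ p) := hφ.comp hξ
  fun_prop

/-- Superposition `∫∫ ε(s,t) e^{i(2π⟨ξ,x⟩ - tφ(ξ))} G(s,ξ) ds dξ`. -/
def superposition (φ : Euc d → ℝ) (ε : ℝ → ℝ → ℝ) (G : ℝ × Euc d → ℂ) (t : ℝ) (x : Euc d) : ℂ :=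
  ∫ z : ℝ × Euc d, (ε z.1 t : ℂ) * planeWave φ t x z.2 * G z

variable {φ w : Euc d → ℝ} {ε : ℝ → ℝ → ℝ} {G : ℝ × Euc d → ℂ} {g : ℝ → ℝ}

theorem integrable_of_norm_le_mul (hw : Integrable w) (hg : Integrable g) (hG : Measurable G)
    (hGb : ∀ s ξ, ‖G (s, ξ)‖ ≤ g s * w ξ) : Integrable G :=
  (hg.mul_prod hw).mono' hG.aestronglyMeasurable (Filter.Eventually.of_forall fun z => hGb z.1 z.2)

theorem integral_mul_le_sqrt_mul_sqrt {X : Type*} [MeasurableSpace X] {μ : Measure X} {a b : X → ℝ}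
    (ha0 : ∀ x, 0 ≤ a x) (hb0 : ∀ x, 0 ≤ b x) (ha : MemLp a 2 μ) (hb : MemLp b 2 μ) :
    ∫ x, a x * b x ∂μ ≤ √(∫ x, a x ^ 2 ∂μ) * √(∫ x, b x ^ 2 ∂μ) := by
  have := integral_mul_le_Lp_mul_Lq_of_nonneg (μ := μ) (f := a) (g := b) (p := 2) (q := 2)
    (by rw [Real.holderConjugate_iff]; norm_num) (Filter.Eventually.of_forall ha0)
    (Filter.Eventually.of_forall hb0) (by simpa using ha) (by simpa using hb)
  simpa [Real.sqrt_eq_rpow] using this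

/-- Pairing a superposition of waves with a test function, reduced to a bound for the dual
operator. -/
theorem norm_integral_superposition_mul_conj_le (hφ : Measurable φ)
    (hε : Measurable (Function.uncurry ε)) (hε1 : ∀ s t, |ε s t| ≤ 1) (hw : Integrable w)
    (hwm : Measurable w)
    (hw01 : ∀ ξ, 0 ≤ w ξ ∧ w ξ ≤ 1) (hg : Integrable g) (hg0 : ∀ s, 0 ≤ g s) (hG : Measurable G)
    (hGb : ∀ s ξ, ‖G (s, ξ)‖ ≤ g s * w ξ) (hGw : ∀ s ξ, G (s, ξ) ≠ 0 → w ξ = 1)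
    {P : Type*} [MeasurableSpace P] {μ : Measure P} [SFinite μ] {τ : P → ℝ} {e : P → Euc d}
    {Φ : P → ℂ} (hτ : Measurable τ) (he : Measurable e) (hΦm : Measurable Φ)
    (hΦ : Integrable Φ μ) {K : ℝ}
    (hK : ∀ s, ∫ ξ, w ξ * ‖∫ p, (ε s (τ p) : ℂ) * (starRingEnd ℂ) (planeWave φ (τ p) (e p) ξ) *
      Φ p ∂μ‖ ^ 2 ≤ K) :
    ‖∫ p, superposition φ ε G (τ p) (e p) * (starRingEnd ℂ) (Φ p) ∂μ‖ ≤
      √K * ∫ s, √(∫ ξ, ‖G (s, ξ)‖ ^ 2) := by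
  have hGi := integrable_of_norm_le_mul hw hg hG hGb
  set H : ℝ → Euc d → ℂ := fun s ξ => ∫ p, (ε s (τ p) : ℂ) *
    (starRingEnd ℂ) (planeWave φ (τ p) (e p) ξ) * Φ p ∂μ with hH
  have hHb : ∀ s ξ, ‖H s ξ‖ ≤ ∫ p, ‖Φ p‖ ∂μ := by
    intro s ξ
    refine norm_integral_le_of_norm_le hΦ.norm (Filter.Eventually.of_forall fun p => ?_)
    rw [norm_mul, norm_mul, RCLike.norm_conj, norm_planeWave, mul_one, Complex.norm_real,
      Real.norm_eq_abs]
    exact mul_le_of_le_one_left (norm_nonneg _) (hε1 _ _)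
  have hHm : StronglyMeasurable (Function.uncurry H) := by
    have : Measurable fun q : (ℝ × Euc d) × P => (ε q.1.1 (τ q.2) : ℂ) *
        (starRingEnd ℂ) (planeWave φ (τ q.2) (e q.2) q.1.2) * Φ q.2 := by
      have h1 : Measurable fun q : (ℝ × Euc d) × P => ε q.1.1 (τ q.2) :=
        hε.comp (by fun_prop : Measurable fun q : (ℝ × Euc d) × P => (q.1.1, τ q.2))
      have h2 : Measurable fun q : (ℝ × Euc d) × P => planeWave φ (τ q.2) (e q.2) q.1.2 :=
        measurable_planeWave hφ (by fun_prop) (by fun_prop) (by fun_prop)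
      have h3 : Measurable fun q : (ℝ × Euc d) × P =>
          (starRingEnd ℂ) (planeWave φ (τ q.2) (e q.2) q.1.2) :=
        Complex.continuous_conj.measurable.comp h2
      fun_prop
    exact this.stronglyMeasurable.integral_prod_right'
  -- exchange the order of integration
  have swap : ∫ p, superposition φ ε G (τ p) (e p) * (starRingEnd ℂ) (Φ p) ∂μ =
      ∫ z : ℝ × Euc d, G z * (starRingEnd ℂ) (H z.1 z.2) := by
    have e1 : ∀ p, superposition φ ε G (τ p) (e p) * (starRingEnd ℂ) (Φ p) =
        ∫ z : ℝ × Euc d, (ε z.1 (τ p) : ℂ) * planeWave φ (τ p) (e p) z.2 * G z *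
          (starRingEnd ℂ) (Φ p) := by
      intro p
      rw [superposition, integral_mul_const]
    simp only [e1]
    rw [integral_integral_swap]
    · refine integral_congr_ae (Filter.Eventually.of_forall fun z => ?_)
      beta_reduce
      rw [hH]
      beta_reduce
      rw [← integral_conj, ← integral_const_mul]
      refine integral_congr_ae (Filter.Eventually.of_forall fun p => ?_)
      simp only [map_mul, Complex.conj_conj, Complex.conj_ofReal]
      ring
    · refine (hΦ.norm.mul_prod hGi.norm).mono' (Measurable.aestronglyMeasurable ?_)
        (Filter.Eventually.of_forall fun q => ?_)
      · have h1 : Measurable fun q : P × ℝ × Euc d => ε q.2.1 (τ q.1) :=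
          hε.comp (by fun_prop : Measurable fun q : P × ℝ × Euc d => (q.2.1, τ q.1))
        have h2 : Measurable fun q : P × ℝ × Euc d => planeWave φ (τ q.1) (e q.1) q.2.2 :=
          measurable_planeWave hφ (by fun_prop) (by fun_prop) (by fun_prop)
        have h3 : Measurable fun q : P × ℝ × Euc d => (starRingEnd ℂ) (Φ q.1) :=
          Complex.continuous_conj.measurable.comp (by fun_prop)
        simp only [Function.uncurry_def]
        fun_prop
      · simp only [Function.uncurry_def, norm_mul, RCLike.norm_conj, norm_planeWave, mul_one,
          Complex.norm_real, Real.norm_eq_abs]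
        rw [mul_comm]
        exact mul_le_mul_of_nonneg_left (mul_le_of_le_one_left (norm_nonneg _) (hε1 _ _))
          (norm_nonneg _)
  have hprod : Integrable fun z : ℝ × Euc d => G z * (starRingEnd ℂ) (H z.1 z.2) := by
    refine hGi.mul_bdd (c := ∫ p, ‖Φ p‖ ∂μ) ?_ (Filter.Eventually.of_forall fun z => ?_)
    · exact (Complex.continuous_conj.comp_stronglyMeasurable hHm).aestronglyMeasurable
    · rw [RCLike.norm_conj]
      exact hHb _ _
  have hGs : ∀ s, MemLp (fun ξ => ‖G (s, ξ)‖) 2 := by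
    intro s
    have hGs1 : Measurable fun ξ => G (s, ξ) := hG.comp (by fun_prop)
    have h1 : Integrable fun ξ => G (s, ξ) :=
      (hw.const_mul (g s)).mono' hGs1.aestronglyMeasurable
        (Filter.Eventually.of_forall fun ξ => hGb s ξ)
    refine (memLp_two_of_integrable_of_bounded h1 (M := g s) fun ξ => ?_).norm
    exact (hGb s ξ).trans (mul_le_of_le_one_right (hg0 s) (hw01 ξ).2)
  have hL2i : Integrable fun s => √(∫ ξ, ‖G (s, ξ)‖ ^ 2) := by
    refine (hg.mul_const √(∫ ξ, w ξ)).mono' ?_ (Filter.Eventually.of_forall fun s => ?_)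
    · have : StronglyMeasurable fun s => ∫ ξ, ‖G (s, ξ)‖ ^ 2 :=
        (hG.norm.pow_const 2).stronglyMeasurable.integral_prod_right'
      exact (Real.continuous_sqrt.comp_stronglyMeasurable this).aestronglyMeasurable
    · rw [Real.norm_of_nonneg (Real.sqrt_nonneg _)]
      have : ∫ ξ, ‖G (s, ξ)‖ ^ 2 ≤ g s ^ 2 * ∫ ξ, w ξ := by
        rw [← integral_const_mul]
        refine integral_mono ((memLp_two_iff_integrable_sq_norm (hGs s).1).1 (hGs s) |>.congr ?_)
          (hw.const_mul _) fun ξ => ?_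
        · exact Filter.Eventually.of_forall fun ξ => by simp
        · have h1 := pow_le_pow_left₀ (norm_nonneg _) (hGb s ξ) 2
          have h2 : w ξ ^ 2 ≤ w ξ := by
            have := hw01 ξ
            nlinarith
          calc ‖G (s, ξ)‖ ^ 2 ≤ g s ^ 2 * w ξ ^ 2 := by rw [← mul_pow]; exact h1
            _ ≤ _ := mul_le_mul_of_nonneg_left h2 (by positivity)
      calc √(∫ ξ, ‖G (s, ξ)‖ ^ 2) ≤ √(g s ^ 2 * ∫ ξ, w ξ) := Real.sqrt_le_sqrt this
        _ = _ := by rw [Real.sqrt_mul (by positivity), Real.sqrt_sq (hg0 s)]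
  rw [swap, Measure.volume_eq_prod, integral_prod _ hprod, ← integral_const_mul]
  refine norm_integral_le_of_norm_le (hL2i.const_mul _) (Filter.Eventually.of_forall fun s => ?_)
  have hHs : Measurable fun ξ => H s ξ := hHm.measurable.of_uncurry_left
  have hwH : MemLp (fun ξ => √(w ξ) * ‖H s ξ‖) 2 := by
    refine (memLp_two_iff_integrable_sq ?_).2 ?_
    · exact (hwm.sqrt.mul hHs.norm).aestronglyMeasurable
    · have : ∀ ξ, (√(w ξ) * ‖H s ξ‖) ^ 2 = w ξ * ‖H s ξ‖ ^ 2 := fun ξ => by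
        rw [mul_pow, Real.sq_sqrt (hw01 ξ).1]
      simp only [this]
      refine hw.mul_bdd (c := (∫ p, ‖Φ p‖ ∂μ) ^ 2) (hHs.norm.pow_const 2).aestronglyMeasurable
        (Filter.Eventually.of_forall fun ξ => ?_)
      rw [norm_pow, norm_norm]
      exact pow_le_pow_left₀ (norm_nonneg _) (hHb s ξ) 2
  calc ‖∫ ξ, G (s, ξ) * (starRingEnd ℂ) (H s ξ)‖
      ≤ ∫ ξ, ‖G (s, ξ)‖ * (√(w ξ) * ‖H s ξ‖) := by
        refine (norm_integral_le_integral_norm _).trans (le_of_eq ?_)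
        refine integral_congr_ae (Filter.Eventually.of_forall fun ξ => ?_)
        simp only [norm_mul, RCLike.norm_conj]
        by_cases h : G (s, ξ) = 0
        · simp [h]
        · rw [hGw s ξ h, Real.sqrt_one, one_mul]
    _ ≤ √(∫ ξ, ‖G (s, ξ)‖ ^ 2) * √(∫ ξ, (√(w ξ) * ‖H s ξ‖) ^ 2) :=
        integral_mul_le_sqrt_mul_sqrt (fun _ => norm_nonneg _)
          (fun _ => mul_nonneg (Real.sqrt_nonneg _) (norm_nonneg _)) (hGs s) hwH
    _ ≤ √(∫ ξ, ‖G (s, ξ)‖ ^ 2) * √K := by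
        refine mul_le_mul_of_nonneg_left (Real.sqrt_le_sqrt ?_) (Real.sqrt_nonneg _)
        refine le_trans (le_of_eq ?_) (hK s)
        refine integral_congr_ae (Filter.Eventually.of_forall fun ξ => ?_)
        simp only [mul_pow, Real.sq_sqrt (hw01 ξ).1, hH]
    _ = _ := mul_comm _ _

/-- The `TT*` argument combined with fractional integration in time. -/
theorem integral_mul_norm_integral_sq_le (hφ : Measurable φ) (hw : Integrable w)
    (hwm : Measurable w) (hw0 : ∀ ξ, 0 ≤ w ξ) {a : ℝ → Euc d → ℂ}
    (ha : Measurable (Function.uncurry a)) {α θ : ℝ → ℝ} (hα : Integrable α)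
    (haα : ∀ t ξ, ‖a t ξ‖ ≤ α t) {A γ : ℝ} (hA : 0 ≤ A) (h0 : 0 < γ) (h1 : γ < 1)
    (hθ : Measurable θ) (hθ0 : ∀ t, 0 ≤ θ t) (hi : Integrable fun t => θ t ^ (2 / (2 - γ)))
    (hker : ∀ t t', t ≠ t' → ‖∫ ξ, (w ξ * cexp (((t - t') * φ ξ : ℝ) * I)) *
      a t ξ * (starRingEnd ℂ) (a t' ξ)‖ ≤ A * |t - t'| ^ (-γ) * θ t * θ t')
    {η : ℝ → ℝ} (hη : Measurable η) (hη1 : ∀ t, |η t| ≤ 1) :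
    ∫ ξ, w ξ * ‖∫ t, (η t : ℂ) * (cexp ((t * φ ξ : ℝ) * I) * a t ξ)‖ ^ 2 ≤
      A * ((6 + 4 / (1 - γ)) * (∫ t, θ t ^ (2 / (2 - γ))) ^ (2 - γ)) := by
  have hh1 : 0 < 1 - γ := by linarith
  have hI0 : 0 ≤ ∫ t, θ t ^ (2 / (2 - γ)) :=
    integral_nonneg fun t => Real.rpow_nonneg (hθ0 t) _
  set b : ℝ → Euc d → ℂ := fun t ξ => (η t : ℂ) * (cexp ((t * φ ξ : ℝ) * I) * a t ξ) with hb
  have hbm : Measurable (Function.uncurry b) := by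
    have : Measurable fun p : ℝ × Euc d => a p.1 p.2 := ha
    simp only [hb, Function.uncurry_def]
    fun_prop
  have hbα : ∀ t ξ, ‖b t ξ‖ ≤ α t := by
    intro t ξ
    rw [hb]
    simp only [norm_mul, Complex.norm_exp_ofReal_mul_I, one_mul, Complex.norm_real,
      Real.norm_eq_abs]
    exact (mul_le_of_le_one_left (norm_nonneg _) (hη1 t)).trans (haα t ξ)
  have hα2 : Integrable fun z : ℝ × ℝ => α z.1 * α z.2 := hα.mul_prod hα
  set Q : Euc d → ℝ × ℝ → ℂ := fun ξ z =>
    (w ξ : ℂ) * (b z.1 ξ * (starRingEnd ℂ) (b z.2 ξ)) with hQ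
  have hQm : Measurable (Function.uncurry Q) := by
    have e1 : Measurable fun p : Euc d × ℝ × ℝ => b p.2.1 p.1 :=
      hbm.comp (by fun_prop : Measurable fun p : Euc d × ℝ × ℝ => (p.2.1, p.1))
    have e2 : Measurable fun p : Euc d × ℝ × ℝ => b p.2.2 p.1 :=
      hbm.comp (by fun_prop : Measurable fun p : Euc d × ℝ × ℝ => (p.2.2, p.1))
    have e3 : Measurable fun p : Euc d × ℝ × ℝ => (starRingEnd ℂ) (b p.2.2 p.1) :=
      Complex.continuous_conj.measurable.comp e2
    simp only [hQ, Function.uncurry_def]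
    fun_prop
  have hQi : Integrable (Function.uncurry Q) := by
    refine (hw.mul_prod hα2).mono' hQm.aestronglyMeasurable (Filter.Eventually.of_forall fun p => ?_)
    simp only [hQ, Function.uncurry_def, norm_mul, RCLike.norm_conj, Complex.norm_real,
      Real.norm_of_nonneg (hw0 _)]
    exact mul_le_mul_of_nonneg_left (mul_le_mul (hbα _ _) (hbα _ _) (norm_nonneg _)
      ((norm_nonneg _).trans (hbα _ p.1))) (hw0 _)
  have e1 : ∀ ξ, ((w ξ * ‖∫ t, b t ξ‖ ^ 2 : ℝ) : ℂ) = ∫ z, Q ξ z := by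
    intro ξ
    rw [hQ]
    beta_reduce
    rw [integral_const_mul, Measure.volume_eq_prod,
      integral_prod_mul (fun t => b t ξ) (fun t => (starRingEnd ℂ) (b t ξ)), integral_conj,
      Complex.mul_conj, Complex.normSq_eq_norm_sq]
    push_cast
    rfl
  have e2 : ((∫ ξ, w ξ * ‖∫ t, b t ξ‖ ^ 2 : ℝ) : ℂ) = ∫ z, ∫ ξ, Q ξ z := by
    rw [← integral_complex_ofReal, integral_congr_ae (Filter.Eventually.of_forall e1),
      integral_integral_swap hQi]
  have hnn : 0 ≤ ∫ ξ, w ξ * ‖∫ t, b t ξ‖ ^ 2 :=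
    integral_nonneg fun ξ => mul_nonneg (hw0 ξ) (by positivity)
  have e3 : ‖((∫ ξ, w ξ * ‖∫ t, b t ξ‖ ^ 2 : ℝ) : ℂ)‖ₑ =
      ENNReal.ofReal (∫ ξ, w ξ * ‖∫ t, b t ξ‖ ^ 2) := by
    rw [← ofReal_norm, Complex.norm_real, Real.norm_of_nonneg hnn]
  have hQz : ∀ t t', t ≠ t' → ‖∫ ξ, Q ξ (t, t')‖ ≤ A * (θ t * θ t' * |t - t'| ^ (-γ)) := by
    intro t t' htt
    have : ∀ ξ, Q ξ (t, t') = (η t * η t' : ℝ) * ((w ξ * cexp (((t - t') * φ ξ : ℝ) * I)) *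
      a t ξ * (starRingEnd ℂ) (a t' ξ)) := by
      intro ξ
      have : (((t - t') * φ ξ : ℝ) : ℂ) * I = (t * φ ξ : ℝ) * I + -((t' * φ ξ : ℝ) * I) := by
        push_cast; ring
      simp only [hQ, hb, map_mul, Complex.conj_ofReal, ← Complex.exp_conj, Complex.conj_I]
      rw [this, Complex.exp_add]
      push_cast
      ring_nf
    simp only [this]
    rw [integral_const_mul, norm_mul, Complex.norm_real, Real.norm_eq_abs, abs_mul]
    refine (mul_le_of_le_one_left (norm_nonneg _)
      (mul_le_one₀ (hη1 t) (abs_nonneg _) (hη1 t'))).trans ((hker t t' htt).trans (le_of_eq ?_))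
    ring
  rw [← ENNReal.ofReal_le_ofReal_iff (by positivity)]
  change ENNReal.ofReal (∫ ξ, w ξ * ‖∫ t, b t ξ‖ ^ 2) ≤ _
  rw [← e3, e2]
  refine (enorm_integral_le_lintegral_enorm _).trans ?_
  have hKm : Measurable fun z : ℝ × ℝ => ‖∫ ξ, Q ξ z‖ₑ :=
    (hQm.stronglyMeasurable.integral_prod_left').measurable.enorm
  rw [Measure.volume_eq_prod, lintegral_prod _ hKm.aemeasurable, ENNReal.ofReal_mul hA]
  refine le_trans ?_ (mul_le_mul_right (lintegral_lintegral_mul_rpow_neg_le h0 h1 hθ hθ0 hi) _)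
  rw [← lintegral_const_mul _ (by fun_prop)]
  refine lintegral_mono fun t => ?_
  rw [← lintegral_const_mul _ (by fun_prop)]
  refine lintegral_mono_ae ?_
  have hne : ∀ᵐ t' : ℝ, t' ≠ t := by
    simp [ae_iff]
  filter_upwards [hne] with t' ht'
  rw [← ofReal_norm, ← ENNReal.ofReal_mul hA]
  exact ENNReal.ofReal_le_ofReal (hQz t t' ht'.symm)

end Duality

section Strichartz

variable {d : ℕ}

/-- Standing assumptions on a superposition of plane waves with phase `φ`: the frequency window
`w` equals one on the frequency support of the amplitude `G`, which is dominated by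
`g(s) w(ξ)`. -/
structure IsWavePacket (φ w : Euc d → ℝ) (ε : ℝ → ℝ → ℝ) (G : ℝ × Euc d → ℂ) (g : ℝ → ℝ) :
    Prop where
  measurable_phase : Measurable φ
  measurable_coeff : Measurable (Function.uncurry ε)
  abs_coeff_le : ∀ s t, |ε s t| ≤ 1
  integrable_window : Integrable w
  measurable_window : Measurable w
  window_mem : ∀ ξ, 0 ≤ w ξ ∧ w ξ ≤ 1
  integrable_majorant : Integrable g
  majorant_nonneg : ∀ s, 0 ≤ g s
  measurable_amplitude : Measurable G
  norm_amplitude_le : ∀ s ξ, ‖G (s, ξ)‖ ≤ g s * w ξ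
  window_eq_one : ∀ s ξ, G (s, ξ) ≠ 0 → w ξ = 1

variable {φ w : Euc d → ℝ} {ε : ℝ → ℝ → ℝ} {G : ℝ × Euc d → ℂ} {g : ℝ → ℝ}

namespace IsWavePacket

theorem integrable_amplitude (h : IsWavePacket φ w ε G g) : Integrable G :=
  integrable_of_norm_le_mul h.integrable_window h.integrable_majorant h.measurable_amplitude
    h.norm_amplitude_le

theorem norm_integrand_le (h : IsWavePacket φ w ε G g) (t : ℝ) (x : Euc d) (z : ℝ × Euc d) :
    ‖(ε z.1 t : ℂ) * planeWave φ t x z.2 * G z‖ ≤ ‖G z‖ := by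
  rw [norm_mul, norm_mul, norm_planeWave, mul_one, Complex.norm_real, Real.norm_eq_abs]
  exact mul_le_of_le_one_left (norm_nonneg _) (h.abs_coeff_le _ _)

theorem norm_superposition_le (h : IsWavePacket φ w ε G g) (t : ℝ) (x : Euc d) :
    ‖superposition φ ε G t x‖ ≤ ∫ z, ‖G z‖ :=
  norm_integral_le_of_norm_le h.integrable_amplitude.norm
    (Filter.Eventually.of_forall fun z => h.norm_integrand_le t x z)

theorem measurable_superposition (h : IsWavePacket φ w ε G g) :
    Measurable (Function.uncurry (superposition φ ε G)) := by
  have : Measurable fun q : (ℝ × Euc d) × ℝ × Euc d =>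
      (ε q.2.1 q.1.1 : ℂ) * planeWave φ q.1.1 q.1.2 q.2.2 * G q.2 := by
    have h1 : Measurable fun q : (ℝ × Euc d) × ℝ × Euc d => ε q.2.1 q.1.1 :=
      h.measurable_coeff.comp
        (by fun_prop : Measurable fun q : (ℝ × Euc d) × ℝ × Euc d => (q.2.1, q.1.1))
    have h2 : Measurable fun q : (ℝ × Euc d) × ℝ × Euc d => planeWave φ q.1.1 q.1.2 q.2.2 :=
      measurable_planeWave h.measurable_phase (by fun_prop) (by fun_prop) (by fun_prop)
    exact ((Complex.measurable_ofReal.comp h1).mul h2).mul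
      (h.measurable_amplitude.comp measurable_snd)
  exact this.stronglyMeasurable.integral_prod_right'.measurable

theorem continuous_superposition (h : IsWavePacket φ w ε G g) (t : ℝ) :
    Continuous (superposition φ ε G t) := by
  refine continuous_of_dominated (bound := fun z => ‖G z‖) (fun x => ?_)
    (fun x => Filter.Eventually.of_forall fun z => h.norm_integrand_le t x z)
    h.integrable_amplitude.norm (Filter.Eventually.of_forall fun z => ?_)
  · have h1 : Measurable fun z : ℝ × Euc d => ε z.1 t :=
      h.measurable_coeff.comp (by fun_prop : Measurable fun z : ℝ × Euc d => (z.1, t))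
    have h2 : Measurable fun z : ℝ × Euc d => planeWave φ t x z.2 :=
      measurable_planeWave h.measurable_phase (by fun_prop) (by fun_prop) (by fun_prop)
    exact (((Complex.measurable_ofReal.comp h1).mul h2).mul
      h.measurable_amplitude).aestronglyMeasurable
  · unfold planeWave
    fun_prop

theorem norm_integral_mul_conj_le (h : IsWavePacket φ w ε G g)
    {P : Type*} [MeasurableSpace P] {μ : Measure P} [SFinite μ] {τ : P → ℝ} {e : P → Euc d}
    {Φ : P → ℂ} (hτ : Measurable τ) (he : Measurable e) (hΦm : Measurable Φ)
    (hΦ : Integrable Φ μ) {K : ℝ}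
    (hK : ∀ s, ∫ ξ, w ξ * ‖∫ p, (ε s (τ p) : ℂ) * (starRingEnd ℂ) (planeWave φ (τ p) (e p) ξ) *
      Φ p ∂μ‖ ^ 2 ≤ K) :
    ‖∫ p, superposition φ ε G (τ p) (e p) * (starRingEnd ℂ) (Φ p) ∂μ‖ ≤
      √K * ∫ s, √(∫ ξ, ‖G (s, ξ)‖ ^ 2) :=
  norm_integral_superposition_mul_conj_le h.measurable_phase h.measurable_coeff h.abs_coeff_le
    h.integrable_window h.measurable_window h.window_mem h.integrable_majorant h.majorant_nonneg
    h.measurable_amplitude h.norm_amplitude_le h.window_eq_one hτ he hΦm hΦ hK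

theorem conj_planeWave (φ : Euc d → ℝ) (t : ℝ) (x ξ : Euc d) :
    (starRingEnd ℂ) (planeWave φ t x ξ) =
      cexp ((t * φ ξ : ℝ) * I) * (𝐞 (-inner ℝ x ξ) : ℂ) := by
  rw [planeWave, map_mul, ← Circle.coe_inv_eq_conj, AddChar.map_neg_eq_inv, ← Complex.exp_conj,
    map_mul, Complex.conj_I, map_neg, Complex.conj_ofReal, real_inner_comm, mul_comm, neg_mul_neg]

theorem eLpNorm_two_le_of_forall_ball {f : Euc d → ℂ} {S : ℝ}
    (h : ∀ n : ℕ, ∫⁻ x in Metric.closedBall 0 n, ‖f x‖ₑ ^ 2 ≤ ENNReal.ofReal (S ^ 2))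
    (hS : 0 ≤ S) : eLpNorm f 2 ≤ ENNReal.ofReal S := by
  have hle : ∫⁻ x, ‖f x‖ₑ ^ 2 ≤ ENNReal.ofReal (S ^ 2) := by
    have hU : (⋃ n : ℕ, Metric.closedBall (0 : Euc d) n) = Set.univ := Metric.iUnion_closedBall_nat 0
    rw [← setLIntegral_univ, ← hU, setLIntegral_iUnion_of_directed]
    · exact iSup_le h
    · exact (monotone_nat_of_le_succ fun n =>
        Metric.closedBall_subset_closedBall (by push_cast; linarith)).directed_le
  rw [eLpNorm_eq_lintegral_rpow_enorm_toReal (by norm_num) (by norm_num)]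
  calc _ ≤ (ENNReal.ofReal (S ^ 2)) ^ (1 / (2 : ℝ≥0∞).toReal) := by
        refine ENNReal.rpow_le_rpow ?_ (by simp)
        simpa using hle
    _ = _ := by
        rw [ENNReal.ofReal_rpow_of_nonneg (by positivity) (by simp)]
        congr 1
        rw [← Real.rpow_natCast, ← Real.rpow_mul hS]
        simp

/-- The energy estimate. -/
theorem eLpNorm_two_superposition_le (h : IsWavePacket φ w ε G g) (t : ℝ) :
    eLpNorm (superposition φ ε G t) 2 ≤ ENNReal.ofReal (∫ s, √(∫ ξ, ‖G (s, ξ)‖ ^ 2)) := by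
  set S := ∫ s, √(∫ ξ, ‖G (s, ξ)‖ ^ 2) with hS
  have hS0 : 0 ≤ S := integral_nonneg fun s => Real.sqrt_nonneg _
  set U := superposition φ ε G t with hU
  have hUm : Measurable U := h.measurable_superposition.of_uncurry_left
  refine eLpNorm_two_le_of_forall_ball (fun n => ?_) hS0
  have hB : MeasurableSet (Metric.closedBall (0 : Euc d) n) := measurableSet_closedBall
  set Φ : Euc d → ℂ := (Metric.closedBall (0 : Euc d) n).indicator U with hΦ
  have hΦm : Measurable Φ := hUm.indicator hB
  have hΦb : ∀ x, ‖Φ x‖ ≤ ∫ z, ‖G z‖ := fun x =>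
    (norm_indicator_le_norm_self _ _).trans (h.norm_superposition_le t x)
  have hΦi : Integrable Φ := by
    rw [integrable_indicator_iff hB]
    exact Measure.integrableOn_of_bounded (M := ∫ z, ‖G z‖)
      (measure_closedBall_lt_top).ne hUm.aestronglyMeasurable
      (Filter.Eventually.of_forall fun x => h.norm_superposition_le t x)
  have hΦ2 : MemLp Φ 2 := memLp_two_of_integrable_of_bounded hΦi hΦb
  have hΦsq : Integrable fun x => ‖Φ x‖ ^ 2 := (memLp_two_iff_integrable_sq_norm hΦ2.1).1 hΦ2
  have hFm : Measurable (𝓕 Φ) := (continuous_fourier_of_integrable hΦi).measurable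
  have hPl := eLpNorm_fourier_eq hΦi hΦ2
  have hF2 : MemLp (𝓕 Φ) 2 := ⟨hFm.aestronglyMeasurable, hPl ▸ hΦ2.2⟩
  have hFsq : Integrable fun x => ‖𝓕 Φ x‖ ^ 2 := (memLp_two_iff_integrable_sq_norm hF2.1).1 hF2
  have hPl2 : ∫ ξ, ‖𝓕 Φ ξ‖ ^ 2 = ∫ x, ‖Φ x‖ ^ 2 := by
    have e : ∀ f : Euc d → ℂ, MemLp f 2 → ∫ x, ‖f x‖ ^ 2 = (eLpNorm f 2).toReal ^ 2 := by
      intro f hf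
      rw [hf.eLpNorm_eq_integral_rpow_norm (by norm_num) (by norm_num),
        ENNReal.toReal_ofReal (by positivity), ← Real.rpow_natCast, ← Real.rpow_mul
          (integral_nonneg fun x => by positivity)]
      simp
    rw [e _ hF2, e _ hΦ2, hPl]
  have key := h.norm_integral_mul_conj_le (P := Euc d) (μ := volume) (τ := fun _ => t)
    (e := fun x => x) measurable_const measurable_id hΦm hΦi (K := ∫ x, ‖Φ x‖ ^ 2) ?_
  · set X := ∫ x, ‖Φ x‖ ^ 2 with hX
    have hX0 : 0 ≤ X := integral_nonneg fun x => by positivity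
    have e1 : ∀ x, superposition φ ε G t x * (starRingEnd ℂ) (Φ x) = ((‖Φ x‖ ^ 2 : ℝ) : ℂ) := by
      intro x
      by_cases hx : x ∈ Metric.closedBall (0 : Euc d) n
      · rw [hΦ, Set.indicator_of_mem hx, Complex.mul_conj, Complex.normSq_eq_norm_sq]
      · rw [hΦ, Set.indicator_of_notMem hx]
        simp
    simp only [e1] at key
    rw [integral_complex_ofReal, Complex.norm_real, Real.norm_of_nonneg hX0] at key
    have hXS : X ≤ S ^ 2 := by
      have hsq := Real.mul_self_sqrt hX0
      rcases (Real.sqrt_nonneg X).eq_or_lt with h0 | h0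
      · nlinarith [sq_nonneg S]
      · have : √X ≤ S := by
          nlinarith
        nlinarith
    calc ∫⁻ x in Metric.closedBall 0 n, ‖U x‖ₑ ^ 2 = ∫⁻ x, ENNReal.ofReal (‖Φ x‖ ^ 2) := by
          rw [← lintegral_indicator hB]
          refine lintegral_congr fun x => ?_
          by_cases hx : x ∈ Metric.closedBall (0 : Euc d) n
          · rw [hΦ, Set.indicator_of_mem hx, Set.indicator_of_mem hx, ← ofReal_norm,
              ENNReal.ofReal_pow (norm_nonneg _)]
          · rw [hΦ, Set.indicator_of_notMem hx, Set.indicator_of_notMem hx]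
            simp
      _ = ENNReal.ofReal X := by
          rw [← ofReal_integral_eq_lintegral_ofReal hΦsq
            (Filter.Eventually.of_forall fun x => by positivity)]
      _ ≤ _ := ENNReal.ofReal_le_ofReal hXS
  · intro s
    rw [← hPl2]
    refine integral_mono_of_nonneg (Filter.Eventually.of_forall fun ξ =>
      mul_nonneg (h.window_mem ξ).1 (by positivity)) hFsq (Filter.Eventually.of_forall fun ξ => ?_)
    beta_reduce
    have e2 : ∫ p, (ε s t : ℂ) * (starRingEnd ℂ) (planeWave φ t p ξ) * Φ p =
        (ε s t : ℂ) * cexp ((t * φ ξ : ℝ) * I) * 𝓕 Φ ξ := by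
      rw [Real.fourier_eq, ← integral_const_mul]
      refine integral_congr_ae (Filter.Eventually.of_forall fun x => ?_)
      simp only [conj_planeWave, Circle.smul_def, smul_eq_mul]
      ring
    rw [e2, norm_mul, norm_mul, Complex.norm_exp_ofReal_mul_I, mul_one, Complex.norm_real,
      Real.norm_eq_abs]
    refine (mul_le_of_le_one_left (by positivity) (h.window_mem ξ).2).trans ?_
    exact pow_le_pow_left₀ (by positivity)
      (mul_le_of_le_one_left (norm_nonneg _) (h.abs_coeff_le _ _)) 2

end IsWavePacket

end Strichartz

section DualTest

variable {d : ℕ}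

theorem integrable_of_bounded_of_support {X : Type*} [MeasurableSpace X] {μ : Measure X}
    {E : Type*} [NormedAddCommGroup E] {f : X → E}
    {B : Set X} (hBf : μ B ≠ ∞) (hf : AEStronglyMeasurable f μ) {C : ℝ} (hC : ∀ x, ‖f x‖ ≤ C)
    (h0 : ∀ x, x ∉ B → f x = 0) : Integrable f μ :=
  (Measure.integrableOn_of_bounded (M := C) hBf hf
    (Filter.Eventually.of_forall hC)).integrable_of_forall_notMem_eq_zero h0

/-- The spatial `L^r` norm of a time slice. -/
def sliceNorm (r : ℝ) (W : ℝ × Euc d → ℂ) (t : ℝ) : ℝ := (∫ x, ‖W (t, x)‖ ^ r) ^ (1 / r)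

/-- The extremiser in the duality between `L^q L^r` and its conjugate space. -/
def dualTest (q r : ℝ) (W : ℝ × Euc d → ℂ) (z : ℝ × Euc d) : ℂ :=
  ((sliceNorm r W z.1 ^ (q - r) * ‖W z‖ ^ (r - 2) : ℝ) : ℂ) * W z

variable {q r M : ℝ} {W : ℝ × Euc d → ℂ} {B : Set (Euc d)} {T : Set ℝ}

theorem sliceNorm_nonneg (r : ℝ) (W : ℝ × Euc d → ℂ) (t : ℝ) : 0 ≤ sliceNorm r W t :=
  Real.rpow_nonneg (integral_nonneg fun _ => by positivity) _

theorem sliceNorm_rpow (hr : 2 < r) (W : ℝ × Euc d → ℂ) (t : ℝ) :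
    sliceNorm r W t ^ r = ∫ x, ‖W (t, x)‖ ^ r := by
  rw [sliceNorm, one_div,
    Real.rpow_inv_rpow (integral_nonneg fun _ => by positivity) (by linarith)]

theorem measurable_sliceNorm (hW : Measurable W) : Measurable (sliceNorm r W) := by
  have : Measurable fun z => ‖W z‖ ^ r := hW.norm.pow_const r
  exact this.stronglyMeasurable.integral_prod_right'.measurable.pow_const _

theorem measurable_dualTest (hW : Measurable W) : Measurable (dualTest q r W) :=
  (Complex.measurable_ofReal.comp ((((measurable_sliceNorm hW).comp measurable_fst).pow_const _).mul
    (hW.norm.pow_const _))).mul hW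

theorem norm_dualTest (hr : 2 < r) (W : ℝ × Euc d → ℂ) (z : ℝ × Euc d) :
    ‖dualTest q r W z‖ = sliceNorm r W z.1 ^ (q - r) * ‖W z‖ ^ (r - 1) := by
  have hN : 0 ≤ sliceNorm r W z.1 ^ (q - r) := Real.rpow_nonneg (sliceNorm_nonneg _ _ _) _
  rw [dualTest, norm_mul, Complex.norm_real, Real.norm_of_nonneg (by positivity), mul_assoc]
  congr 1
  nth_rw 2 [← Real.rpow_one ‖W z‖]
  rw [← Real.rpow_add_of_nonneg (norm_nonneg _) (by linarith) (by linarith)]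
  congr 1
  ring

theorem mul_conj_dualTest (hr : 2 < r) {U : ℝ × Euc d → ℂ} {z : ℝ × Euc d}
    (h : W z = U z ∨ W z = 0) : U z * (starRingEnd ℂ) (dualTest q r W z) =
      ((sliceNorm r W z.1 ^ (q - r) * ‖W z‖ ^ r : ℝ) : ℂ) := by
  rcases h with h | h
  · rw [dualTest, map_mul, Complex.conj_ofReal, ← h, mul_left_comm, Complex.mul_conj,
      Complex.normSq_eq_norm_sq, ← Complex.ofReal_mul, mul_assoc, ← Real.rpow_natCast ‖W z‖,
      ← Real.rpow_add_of_nonneg (norm_nonneg _) (by linarith) (by norm_num)]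
    norm_num
  · rw [dualTest, h, norm_zero, Real.zero_rpow (by linarith : r ≠ 0)]
    simp

theorem integrable_slice_rpow (hW : Measurable W) (hM : ∀ z, ‖W z‖ ≤ M) (hB : volume B ≠ ∞)
    (hWB : ∀ t x, x ∉ B → W (t, x) = 0) {p : ℝ} (hp : 0 < p) (t : ℝ) :
    Integrable fun x => ‖W (t, x)‖ ^ p := by
  refine integrable_of_bounded_of_support (C := M ^ p) hB
    ((hW.comp measurable_prodMk_left).norm.pow_const p).aestronglyMeasurable (fun x => ?_)
    (fun x hx => ?_)
  · rw [Real.norm_of_nonneg (by positivity)]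
    exact Real.rpow_le_rpow (norm_nonneg _) (hM _) hp.le
  · rw [hWB t x hx, norm_zero, Real.zero_rpow hp.ne']

theorem sliceNorm_le (hW : Measurable W) (hM : ∀ z, ‖W z‖ ≤ M) (hBm : MeasurableSet B)
    (hB : volume B ≠ ∞)
    (hWB : ∀ t x, x ∉ B → W (t, x) = 0) (hr : 2 < r) (t : ℝ) :
    sliceNorm r W t ≤ (M ^ r * volume.real B) ^ (1 / r) := by
  refine Real.rpow_le_rpow (integral_nonneg fun _ => by positivity) ?_ (by positivity)
  have hi : Integrable (B.indicator fun _ => M ^ r) :=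
    (integrable_indicator_iff hBm).2 (integrableOn_const hB)
  refine (integral_mono (integrable_slice_rpow hW hM hB hWB (by linarith) t) hi
    (fun x => ?_)).trans_eq ?_
  · by_cases hx : x ∈ B
    · rw [Set.indicator_of_mem hx]
      exact Real.rpow_le_rpow (norm_nonneg _) (hM _) (by linarith)
    · simp only [Set.indicator_of_notMem hx, hWB t x hx, norm_zero]
      rw [Real.zero_rpow (by linarith)]
  · rw [integral_indicator hBm, setIntegral_const, smul_eq_mul, mul_comm]

theorem sliceNorm_eq_zero (hr : 2 < r) {t : ℝ} (h : ∀ x, W (t, x) = 0) : sliceNorm r W t = 0 := by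
  have : ∀ x, ‖W (t, x)‖ ^ r = 0 := fun x => by
    rw [h x, norm_zero, Real.zero_rpow (by linarith)]
  rw [sliceNorm]
  simp only [this, integral_zero]
  exact Real.zero_rpow (by positivity)

theorem rpow_sub_mul_rpow {N a b : ℝ} (hN : 0 ≤ N) (ha : b ≠ 0) (hab : a + b ≠ 0) :
    N ^ a * N ^ b = N ^ (a + b) := by
  rcases hN.eq_or_lt with h | h
  · rw [← h, Real.zero_rpow ha, Real.zero_rpow hab, mul_zero]
  · rw [Real.rpow_add h]

theorem integral_dualTest_rpow (hq : 2 < q) (hr : 2 < r) (W : ℝ × Euc d → ℂ) (t : ℝ) :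
    (∫ x, ‖dualTest q r W (t, x)‖ ^ (r / (r - 1))) ^ (1 / (r / (r - 1))) =
      sliceNorm r W t ^ (q - 1) := by
  have hN := sliceNorm_nonneg r W t
  have h1 : (r - 1) * (r / (r - 1)) = r := mul_div_cancel₀ _ (by linarith)
  have h2 : (r / (r - 1)) * (1 / (r / (r - 1))) = 1 := by
    have : r - 1 ≠ 0 := by linarith
    field_simp
  have h3 : r * (1 / (r / (r - 1))) = r - 1 := by
    have : r - 1 ≠ 0 := by linarith
    field_simp
  have e : ∀ x, ‖dualTest q r W (t, x)‖ ^ (r / (r - 1)) =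
      (sliceNorm r W t ^ (q - r)) ^ (r / (r - 1)) * ‖W (t, x)‖ ^ r := by
    intro x
    rw [norm_dualTest hr, Real.mul_rpow (by positivity) (by positivity),
      ← Real.rpow_mul (norm_nonneg _), h1]
  simp only [e]
  rw [integral_const_mul, ← sliceNorm_rpow hr, Real.mul_rpow (by positivity) (by positivity),
    ← Real.rpow_mul (by positivity), h2, Real.rpow_one, ← Real.rpow_mul hN, h3,
    rpow_sub_mul_rpow hN (by linarith) (by linarith)]
  congr 1
  ring

theorem integral_norm_dualTest_le (hW : Measurable W) (hM : ∀ z, ‖W z‖ ≤ M) (hBm : MeasurableSet B)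
    (hB : volume B ≠ ∞) (hWB : ∀ t x, x ∉ B → W (t, x) = 0) (hr : 2 < r) (t : ℝ) :
    ∫ x, ‖dualTest q r W (t, x)‖ ≤ sliceNorm r W t ^ (q - 1) * (volume.real B + 1) := by
  set N := sliceNorm r W t with hNdef
  have hN : 0 ≤ N := sliceNorm_nonneg r W t
  have hir := integrable_slice_rpow hW hM hB hWB (by linarith : 0 < r) t
  simp only [norm_dualTest hr, ← hNdef]
  rw [integral_const_mul]
  rcases hN.eq_or_lt with h | h
  · have h0 : ∫ x, ‖W (t, x)‖ ^ r = 0 := by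
      rw [← sliceNorm_rpow hr, ← hNdef, ← h, Real.zero_rpow (by linarith)]
    rw [integral_eq_zero_iff_of_nonneg (fun x => by positivity) hir] at h0
    have h1 : ∫ x, ‖W (t, x)‖ ^ (r - 1) = 0 := by
      refine integral_eq_zero_of_ae ?_
      filter_upwards [h0] with x hx
      simp only [Pi.zero_apply] at hx ⊢
      rw [Real.rpow_eq_zero (norm_nonneg _) (by linarith)] at hx
      rw [hx, Real.zero_rpow (by linarith)]
    rw [h1, mul_zero]
    positivity
  · have hi : Integrable (B.indicator fun _ => N ^ (r - 1)) :=
      (integrable_indicator_iff hBm).2 (integrableOn_const hB)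
    have hb : ∫ x, ‖W (t, x)‖ ^ (r - 1) ≤ N ^ (r - 1) * (volume.real B + 1) := by
      refine (integral_mono (integrable_slice_rpow hW hM hB hWB (by linarith) t)
        (hi.add (hir.const_mul N⁻¹)) (fun x => ?_)).trans_eq ?_
      · simp only [Pi.add_apply]
        by_cases hx : x ∈ B
        · rw [Set.indicator_of_mem hx]
          rcases le_total ‖W (t, x)‖ N with hle | hle
          · have := Real.rpow_le_rpow (norm_nonneg _) hle (by linarith : 0 ≤ r - 1)
            have h2 : 0 ≤ N⁻¹ * ‖W (t, x)‖ ^ r := by positivity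
            linarith
          · have hp : 0 < ‖W (t, x)‖ := h.trans_le hle
            have h2 : ‖W (t, x)‖ ^ (r - 1) ≤ N⁻¹ * ‖W (t, x)‖ ^ r := by
              rw [Real.rpow_sub hp, Real.rpow_one, div_eq_inv_mul]
              gcongr
            have h3 : 0 ≤ N ^ (r - 1) := by positivity
            linarith
        · simp only [Set.indicator_of_notMem hx, hWB t x hx, norm_zero]
          rw [Real.zero_rpow (by linarith), Real.zero_rpow (by linarith)]
          simp
      · simp only [Pi.add_apply]
        rw [integral_add hi (hir.const_mul N⁻¹), integral_indicator hBm, setIntegral_const,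
          smul_eq_mul, integral_const_mul, ← sliceNorm_rpow hr, ← hNdef, Real.rpow_sub h,
          Real.rpow_one]
        field_simp
    calc _ ≤ N ^ (q - r) * (N ^ (r - 1) * (volume.real B + 1)) := by gcongr
      _ = _ := by
        rw [← mul_assoc, ← Real.rpow_add h]
        congr 2
        ring

theorem integrable_dualTest (hW : Measurable W) (hM : ∀ z, ‖W z‖ ≤ M) (hBm : MeasurableSet B)
    (hB : volume B ≠ ∞) (hWB : ∀ t x, x ∉ B → W (t, x) = 0)
    (hT : volume T ≠ ∞) (hWT : ∀ t x, t ∉ T → W (t, x) = 0) (hq : 2 < q) (hr : 2 < r) :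
    Integrable (dualTest q r W) := by
  have hm := measurable_dualTest (q := q) (r := r) hW
  rw [Measure.volume_eq_prod, integrable_prod_iff hm.aestronglyMeasurable]
  constructor
  · refine Filter.Eventually.of_forall fun t => ?_
    have hmt : Measurable fun x => dualTest q r W (t, x) := hm.comp measurable_prodMk_left
    rw [← integrable_norm_iff hmt.aestronglyMeasurable]
    simp only [norm_dualTest hr]
    exact (integrable_slice_rpow hW hM hB hWB (by linarith) t).const_mul _
  · refine integrable_of_bounded_of_support
      (C := ((M ^ r * volume.real B) ^ (1 / r)) ^ (q - 1) * (volume.real B + 1)) hT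
      hm.norm.stronglyMeasurable.integral_prod_right'.aestronglyMeasurable (fun t => ?_)
      (fun t ht => ?_)
    · rw [Real.norm_of_nonneg (integral_nonneg fun _ => norm_nonneg _)]
      refine (integral_norm_dualTest_le hW hM hBm hB hWB hr t).trans ?_
      gcongr
      · exact sliceNorm_nonneg _ _ _
      · linarith
      · exact sliceNorm_le hW hM hBm hB hWB hr t
    · simp [dualTest, hWT t _ ht]

theorem integrable_sliceNorm_rpow (hW : Measurable W) (hM : ∀ z, ‖W z‖ ≤ M) (hBm : MeasurableSet B)
    (hB : volume B ≠ ∞) (hWB : ∀ t x, x ∉ B → W (t, x) = 0)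
    (hT : volume T ≠ ∞) (hWT : ∀ t x, t ∉ T → W (t, x) = 0) (hq : 0 < q) (hr : 2 < r) :
    Integrable fun t => sliceNorm r W t ^ q := by
  refine integrable_of_bounded_of_support (C := ((M ^ r * volume.real B) ^ (1 / r)) ^ q) hT
    ((measurable_sliceNorm hW).pow_const q).aestronglyMeasurable (fun t => ?_) (fun t ht => ?_)
  · have hN := sliceNorm_nonneg r W t
    rw [Real.norm_of_nonneg (by positivity)]
    exact Real.rpow_le_rpow hN (sliceNorm_le hW hM hBm hB hWB hr t) hq.le
  · rw [sliceNorm_eq_zero hr fun x => hWT t x ht, Real.zero_rpow hq.ne']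

end DualTest

section Truncated

variable {d : ℕ} {φ w : Euc d → ℝ} {ε : ℝ → ℝ → ℝ} {G : ℝ × Euc d → ℂ} {g : ℝ → ℝ}

theorem le_rpow_of_le_sqrt_mul {X K S γ : ℝ} (hX : 0 ≤ X) (hK : 0 ≤ K) (hS : 0 ≤ S) (h0 : 0 < γ)
    (h : X ≤ √(K * X ^ (2 - γ)) * S) : X ≤ (√K * S) ^ (2 / γ) := by
  rcases hX.eq_or_lt with h' | h'
  · rw [← h']
    positivity
  · have e : √(X ^ (2 - γ)) = X * X ^ (-(γ / 2)) := by
      nth_rw 2 [← Real.rpow_one X]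
      rw [Real.sqrt_eq_rpow, ← Real.rpow_mul hX, ← Real.rpow_add h']
      congr 1
      ring
    rw [Real.sqrt_mul hK, e] at h
    have h2 : X ^ (γ / 2) ≤ √K * S := by
      rw [Real.rpow_neg hX] at h
      have hp : 0 < X ^ (γ / 2) := by positivity
      have h3 : X * X ^ (γ / 2) ≤ X * (√K * S) := by
        calc X * X ^ (γ / 2) ≤ (√K * (X * (X ^ (γ / 2))⁻¹) * S) * X ^ (γ / 2) := by gcongr
          _ = X * (√K * S) := by field_simp
      exact le_of_mul_le_mul_left h3 h'
    calc X = (X ^ (γ / 2)) ^ (2 / γ) := by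
          rw [← Real.rpow_mul hX, div_mul_div_cancel₀ (by norm_num), div_self h0.ne', Real.rpow_one]
      _ ≤ _ := Real.rpow_le_rpow (by positivity) h2 (by positivity)

/-- The dispersive bound for the kernel of the frequency localised group. -/
def IsDispersive (φ w : Euc d → ℝ) (A δ : ℝ) : Prop :=
  ∀ t : ℝ, t ≠ 0 → ∀ x, ‖𝓕⁻ (fun ξ => (w ξ : ℂ) * cexp ((t * φ ξ : ℝ) * I)) x‖ ≤ A * |t| ^ (-δ)

namespace IsWavePacket

/-- The dual estimate applied to the extremiser of a truncated wave packet. -/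
theorem integral_sliceNorm_rpow_le (h : IsWavePacket φ w ε G g) {A δ γ q r : ℝ} (hA : 0 < A)
    (hdisp : IsDispersive φ w A δ) (hr : 2 < r) (h0 : 0 < γ) (h1 : γ < 1)
    (hγ : γ = δ * ((r - 2) / r)) (hq : q = 2 / γ) {W : ℝ × Euc d → ℂ} {M : ℝ} {B : Set (Euc d)}
    {T : Set ℝ} (hW : Measurable W) (hM : ∀ z, ‖W z‖ ≤ M) (hBm : MeasurableSet B)
    (hB : volume B ≠ ∞) (hWB : ∀ t x, x ∉ B → W (t, x) = 0)
    (hT : volume T ≠ ∞) (hWT : ∀ t x, t ∉ T → W (t, x) = 0)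
    (hWU : ∀ z, W z = superposition φ ε G z.1 z.2 ∨ W z = 0) :
    ∫ t, sliceNorm r W t ^ q ≤
      (√((4 * r / (r - 2) * (2 * A) ^ (r - 2)) ^ (1 / r) * (6 + 4 / (1 - γ))) *
        ∫ s, √(∫ ξ, ‖G (s, ξ)‖ ^ 2)) ^ q := by
  have hq2 : 2 < q := by
    rw [hq, lt_div_iff₀ h0]
    linarith
  have hr2 : 0 < r - 2 := by linarith
  set S := ∫ s, √(∫ ξ, ‖G (s, ξ)‖ ^ 2) with hS
  have hS0 : 0 ≤ S := integral_nonneg fun s => Real.sqrt_nonneg _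
  set A' := (4 * r / (r - 2) * (2 * A) ^ (r - 2)) ^ (1 / r) with hA'
  have hA'0 : 0 ≤ A' := by positivity
  set Φ := dualTest q r W with hΦ
  have hΦm : Measurable Φ := measurable_dualTest hW
  have hΦi : Integrable Φ := integrable_dualTest hW hM hBm hB hWB hT hWT hq2 hr
  have hΦmt : ∀ t, Measurable fun x => Φ (t, x) := fun t => hΦm.comp measurable_prodMk_left
  have hΦb : ∀ t x, ‖Φ (t, x)‖ ≤ sliceNorm r W t ^ (q - r) * M ^ (r - 1) := by
    intro t x
    have hN := sliceNorm_nonneg r W t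
    rw [hΦ, norm_dualTest hr]
    have := hM (t, x)
    gcongr
    linarith
  have hΦit : ∀ t, Integrable fun x => Φ (t, x) := fun t =>
    integrable_of_bounded_of_support hB (hΦmt t).aestronglyMeasurable (hΦb t)
      fun x hx => by simp [hΦ, dualTest, hWB t x hx]
  set X := ∫ t, sliceNorm r W t ^ q with hX
  have hX0 : 0 ≤ X := integral_nonneg fun t => Real.rpow_nonneg (sliceNorm_nonneg _ _ _) _
  have hγq : ∀ t, (sliceNorm r W t ^ (q - 1)) ^ (2 / (2 - γ)) = sliceNorm r W t ^ q := by
    intro t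
    rw [← Real.rpow_mul (sliceNorm_nonneg _ _ _)]
    congr 1
    have : 2 - γ ≠ 0 := by linarith
    rw [hq]
    field_simp
  have key := h.norm_integral_mul_conj_le (P := ℝ × Euc d) (μ := volume) (τ := Prod.fst)
    (e := Prod.snd) measurable_fst measurable_snd hΦm hΦi
    (K := A' * ((6 + 4 / (1 - γ)) * X ^ (2 - γ))) ?_
  · have e1 : ∀ z : ℝ × Euc d, superposition φ ε G z.1 z.2 * (starRingEnd ℂ) (Φ z) =
        ((sliceNorm r W z.1 ^ (q - r) * ‖W z‖ ^ r : ℝ) : ℂ) := fun z =>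
      mul_conj_dualTest (U := fun z => superposition φ ε G z.1 z.2) hr (hWU z)
    have hint : Integrable fun z : ℝ × Euc d => sliceNorm r W z.1 ^ (q - r) * ‖W z‖ ^ r := by
      have : Integrable fun z => superposition φ ε G z.1 z.2 * (starRingEnd ℂ) (Φ z) := by
        refine ((hΦi.norm.const_mul (∫ z, ‖G z‖))).mono'
          (h.measurable_superposition.mul
            (Complex.continuous_conj.measurable.comp hΦm)).aestronglyMeasurable
          (Filter.Eventually.of_forall fun z => ?_)
        rw [norm_mul, RCLike.norm_conj]
        exact mul_le_mul_of_nonneg_right (h.norm_superposition_le _ _) (norm_nonneg _)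
      simp only [e1] at this
      simpa using this.re
    have e2 : ∫ z : ℝ × Euc d, sliceNorm r W z.1 ^ (q - r) * ‖W z‖ ^ r = X := by
      rw [Measure.volume_eq_prod] at hint ⊢
      rw [integral_prod _ hint]
      refine integral_congr_ae (Filter.Eventually.of_forall fun t => ?_)
      dsimp only
      rw [integral_const_mul, ← sliceNorm_rpow hr,
        rpow_sub_mul_rpow (sliceNorm_nonneg _ _ _) (by linarith) (by linarith)]
      congr 1
      ring
    simp only [e1] at key
    rw [integral_complex_ofReal, e2, Complex.norm_real, Real.norm_of_nonneg hX0, ← mul_assoc]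
      at key
    have h1γ : 0 < 1 - γ := by linarith
    rw [hq]
    exact le_rpow_of_le_sqrt_mul hX0 (by positivity) hS0 h0 key
  · intro s
    set a : ℝ → Euc d → ℂ := fun t => 𝓕 fun x => Φ (t, x) with ha
    have ham : Measurable (Function.uncurry a) := by
      have : Measurable fun p : (ℝ × Euc d) × Euc d =>
          (𝐞 (-inner ℝ p.2 p.1.2) : ℂ) * Φ (p.1.1, p.2) :=
        ((Continuous.measurable (by fun_prop : Continuous fun s : ℝ => (𝐞 s : ℂ))).comp
          (by fun_prop : Measurable fun p : (ℝ × Euc d) × Euc d => -inner ℝ p.2 p.1.2)).mul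
          (hΦm.comp (by fun_prop))
      have h2 := (this.stronglyMeasurable.integral_prod_right' (ν := volume)).measurable
      convert h2 using 1
      ext z
      simp only [Function.uncurry, ha, Real.fourier_eq, Circle.smul_def, smul_eq_mul]
    have hmi : ∀ u : ℝ, Integrable fun ξ => (w ξ : ℂ) * cexp ((u * φ ξ : ℝ) * I) := by
      intro u
      have hp := h.measurable_phase
      refine h.integrable_window.mono' ((Complex.measurable_ofReal.comp h.measurable_window).mul
        (by fun_prop)).aestronglyMeasurable (Filter.Eventually.of_forall fun ξ => ?_)
      rw [norm_mul, Complex.norm_exp_ofReal_mul_I, mul_one, Complex.norm_real,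
        Real.norm_of_nonneg (h.window_mem ξ).1]
    have hα : Integrable fun t => ∫ x, ‖Φ (t, x)‖ := by
      have := hΦi.norm
      rw [Measure.volume_eq_prod] at this
      exact this.integral_prod_left
    have hXi := integrable_sliceNorm_rpow (q := q) hW hM hBm hB hWB hT hWT (by linarith) hr
    have TT := integral_mul_norm_integral_sq_le h.measurable_phase h.integrable_window
      h.measurable_window (fun ξ => (h.window_mem ξ).1) ham
      hα (fun t ξ => norm_fourier_le_integral_norm _ ξ)
      (θ := fun t => sliceNorm r W t ^ (q - 1)) hA'0 h0 h1
      ((measurable_sliceNorm hW).pow_const _)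
      (fun t => Real.rpow_nonneg (sliceNorm_nonneg _ _ _) _) (by simpa only [hγq] using hXi)
      (fun t t' htt => ?_) (η := ε s) h.measurable_coeff.of_uncurry_left (h.abs_coeff_le s)
    · simp only [hγq] at TT
      refine le_trans (le_of_eq ?_) TT
      refine integral_congr_ae (Filter.Eventually.of_forall fun ξ => ?_)
      beta_reduce
      congr 3
      have hi : Integrable (fun p : ℝ × Euc d => (ε s p.1 : ℂ) *
          (starRingEnd ℂ) (planeWave φ p.1 p.2 ξ) * Φ p) := by
        have m1 : Measurable fun p : ℝ × Euc d => ε s p.1 :=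
          (h.measurable_coeff.of_uncurry_left (x := s)).comp measurable_fst
        have m2 : Measurable fun p : ℝ × Euc d => planeWave φ p.1 p.2 ξ :=
          measurable_planeWave h.measurable_phase measurable_fst measurable_snd measurable_const
        refine hΦi.norm.mono' (((Complex.measurable_ofReal.comp m1).mul
          (Complex.continuous_conj.measurable.comp m2)).mul hΦm).aestronglyMeasurable
          (Filter.Eventually.of_forall fun p => ?_)
        rw [norm_mul, norm_mul, RCLike.norm_conj, norm_planeWave, mul_one, Complex.norm_real,
          Real.norm_eq_abs]
        exact mul_le_of_le_one_left (norm_nonneg _) (h.abs_coeff_le _ _)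
      rw [Measure.volume_eq_prod] at hi ⊢
      rw [integral_prod _ hi]
      refine integral_congr_ae (Filter.Eventually.of_forall fun t => ?_)
      beta_reduce
      rw [ha]
      beta_reduce
      rw [Real.fourier_eq, ← integral_const_mul, ← integral_const_mul]
      refine integral_congr_ae (Filter.Eventually.of_forall fun x => ?_)
      simp only [conj_planeWave, Circle.smul_def, smul_eq_mul]
      ring
    · have htt' : t - t' ≠ 0 := sub_ne_zero.2 htt
      have hpos : 0 < |t - t'| := abs_pos.2 htt'
      have := norm_integral_mul_fourier_mul_conj_le (hmi (t - t')) (fun ξ => ?_)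
        (by positivity : 0 < A * |t - t'| ^ (-δ)) (hdisp _ htt') (hΦmt t) (hΦit t) (hΦb t)
        (hΦit t') (hΦb t') hr
      · rw [integral_dualTest_rpow hq2 hr, integral_dualTest_rpow hq2 hr] at this
        convert this using 3
        rw [hA', ← mul_assoc 2 A, Real.mul_rpow (by positivity : 0 ≤ 2 * A) (by positivity),
          ← mul_assoc, Real.mul_rpow (x := 4 * r / (r - 2) * (2 * A) ^ (r - 2)) (by positivity)
          (by positivity)]
        congr 1
        rw [← Real.rpow_mul hpos.le, ← Real.rpow_mul hpos.le, hγ]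
        congr 1
        field_simp
      · rw [norm_mul, Complex.norm_exp_ofReal_mul_I, mul_one, Complex.norm_real,
          Real.norm_of_nonneg (h.window_mem ξ).1]
        exact (h.window_mem ξ).2

end IsWavePacket

end Truncated

section Selected

variable {d : ℕ} {φ w : Euc d → ℝ} {ε : ℝ → ℝ → ℝ} {G : ℝ × Euc d → ℂ} {g : ℝ → ℝ}

/-- Measurable choice of a point at which `‖U t ·‖` is largest among finitely many candidates. -/
theorem exists_measurable_maximizing {U : ℝ → Euc d → ℂ} (hU : Measurable (Function.uncurry U))
    (x : ℕ → Euc d) : ∃ e : ℕ → ℝ → Euc d, (∀ k, Measurable (e k)) ∧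
      (∀ k t, ‖U t (e k t)‖ ≤ ‖U t (e (k + 1) t)‖) ∧ ∀ k t, ‖U t (x k)‖ ≤ ‖U t (e k t)‖ := by
  classical
  let e : ℕ → ℝ → Euc d := fun k => Nat.rec (fun _ => x 0)
    (fun k f t => if ‖U t (f t)‖ < ‖U t (x (k + 1))‖ then x (k + 1) else f t) k
  have he : ∀ k t, e (k + 1) t =
      if ‖U t (e k t)‖ < ‖U t (x (k + 1))‖ then x (k + 1) else e k t := fun k t => rfl
  have hcomp : ∀ f : ℝ → Euc d, Measurable f → Measurable fun t => ‖U t (f t)‖ := fun f hf =>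
    (hU.comp (measurable_id.prodMk hf)).norm
  refine ⟨e, fun k => ?_, fun k t => ?_, fun k t => ?_⟩
  · induction k with
    | zero => exact measurable_const
    | succ k ih =>
      exact Measurable.ite (measurableSet_lt (hcomp _ ih) (hcomp _ measurable_const))
        measurable_const ih
  · rw [he]
    split_ifs with hlt
    · exact hlt.le
    · exact le_rfl
  · cases k with
    | zero => exact le_rfl
    | succ k =>
      rw [he]
      split_ifs with hlt
      · exact le_rfl
      · exact not_lt.1 hlt

namespace IsWavePacket

/-- The dual estimate along a measurable curve of points. -/
theorem integral_norm_rpow_selected_le (h : IsWavePacket φ w ε G g) {A γ q : ℝ} (hA : 0 < A)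
    (hdisp : IsDispersive φ w A γ) (h0 : 0 < γ) (h1 : γ < 1)
    (hq : q = 2 / γ) {V : ℝ → ℂ} {M : ℝ} {T : Set ℝ} {e : ℝ → Euc d} (he : Measurable e)
    (hV : Measurable V) (hM : ∀ t, ‖V t‖ ≤ M)
    (hT : volume T ≠ ∞) (hVT : ∀ t, t ∉ T → V t = 0)
    (hVU : ∀ t, V t = superposition φ ε G t (e t) ∨ V t = 0) :
    ∫ t, ‖V t‖ ^ q ≤ (√(A * (6 + 4 / (1 - γ))) * ∫ s, √(∫ ξ, ‖G (s, ξ)‖ ^ 2)) ^ q := by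
  have hq2 : 2 < q := by
    rw [hq, lt_div_iff₀ h0]
    linarith
  set S := ∫ s, √(∫ ξ, ‖G (s, ξ)‖ ^ 2) with hS
  have hS0 : 0 ≤ S := integral_nonneg fun s => Real.sqrt_nonneg _
  set Φ : ℝ → ℂ := fun t => ((‖V t‖ ^ (q - 2) : ℝ) : ℂ) * V t with hΦ
  have hΦm : Measurable Φ := (Complex.measurable_ofReal.comp (hV.norm.pow_const _)).mul hV
  have hΦn : ∀ t, ‖Φ t‖ = ‖V t‖ ^ (q - 1) := by
    intro t
    rw [hΦ]
    beta_reduce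
    rw [norm_mul, Complex.norm_real, Real.norm_of_nonneg (by positivity)]
    nth_rw 2 [← Real.rpow_one ‖V t‖]
    rw [← Real.rpow_add_of_nonneg (norm_nonneg _) (by linarith) (by linarith)]
    congr 1
    ring
  have hΦi : Integrable Φ := by
    refine integrable_of_bounded_of_support (C := M ^ (q - 1)) hT hΦm.aestronglyMeasurable
      (fun t => ?_) (fun t ht => by simp [hΦ, hVT t ht])
    rw [hΦn]
    exact Real.rpow_le_rpow (norm_nonneg _) (hM t) (by linarith)
  have hVi : Integrable fun t => ‖V t‖ ^ q := by
    refine integrable_of_bounded_of_support (C := M ^ q) hT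
      (hV.norm.pow_const _).aestronglyMeasurable (fun t => ?_) (fun t ht => ?_)
    · rw [Real.norm_of_nonneg (by positivity)]
      exact Real.rpow_le_rpow (norm_nonneg _) (hM t) (by linarith)
    · rw [hVT t ht, norm_zero, Real.zero_rpow (by linarith)]
  set X := ∫ t, ‖V t‖ ^ q with hX
  have hX0 : 0 ≤ X := integral_nonneg fun t => by positivity
  have hγq : ∀ t, (‖V t‖ ^ (q - 1)) ^ (2 / (2 - γ)) = ‖V t‖ ^ q := by
    intro t
    rw [← Real.rpow_mul (norm_nonneg _)]
    congr 1
    have : 2 - γ ≠ 0 := by linarith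
    rw [hq]
    field_simp
  have key := h.norm_integral_mul_conj_le (P := ℝ) (μ := volume) (τ := fun t => t)
    (e := e) measurable_id he hΦm hΦi (K := A * ((6 + 4 / (1 - γ)) * X ^ (2 - γ))) ?_
  · have e1 : ∀ t, superposition φ ε G t (e t) * (starRingEnd ℂ) (Φ t) =
        ((‖V t‖ ^ q : ℝ) : ℂ) := by
      intro t
      rcases hVU t with h | h
      · rw [hΦ]
        beta_reduce
        rw [map_mul, Complex.conj_ofReal, ← h, mul_left_comm, Complex.mul_conj,
          Complex.normSq_eq_norm_sq, ← Complex.ofReal_mul, ← Real.rpow_natCast ‖V t‖,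
          ← Real.rpow_add_of_nonneg (norm_nonneg _) (by linarith) (by norm_num)]
        norm_num
      · rw [hΦ]
        beta_reduce
        rw [h, norm_zero, Real.zero_rpow (by linarith : q ≠ 0)]
        simp
    simp only [e1] at key
    rw [integral_complex_ofReal, Complex.norm_real, Real.norm_of_nonneg hX0, ← mul_assoc] at key
    have h1γ : 0 < 1 - γ := by linarith
    rw [hq]
    exact le_rpow_of_le_sqrt_mul hX0 (by positivity) hS0 h0 key
  · intro s
    set a : ℝ → Euc d → ℂ := fun t ξ => (𝐞 (-inner ℝ (e t) ξ) : ℂ) * Φ t with ha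
    have ham : Measurable (Function.uncurry a) :=
      ((Continuous.measurable (by fun_prop : Continuous fun s : ℝ => (𝐞 s : ℂ))).comp
        (by fun_prop : Measurable fun p : ℝ × Euc d => -inner ℝ (e p.1) p.2)).mul
        (hΦm.comp measurable_fst)
    have TT := integral_mul_norm_integral_sq_le h.measurable_phase h.integrable_window
      h.measurable_window (fun ξ => (h.window_mem ξ).1) ham
      hΦi.norm (fun t ξ => ?_)
      (θ := fun t => ‖V t‖ ^ (q - 1)) hA.le h0 h1 (hV.norm.pow_const _)
      (fun t => by positivity) (by simpa only [hγq] using hVi)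
      (fun t t' htt => ?_) (η := ε s) h.measurable_coeff.of_uncurry_left (h.abs_coeff_le s)
    · simp only [hγq] at TT
      refine le_trans (le_of_eq ?_) TT
      refine integral_congr_ae (Filter.Eventually.of_forall fun ξ => ?_)
      beta_reduce
      congr 3
      refine integral_congr_ae (Filter.Eventually.of_forall fun t => ?_)
      simp only [conj_planeWave, ha]
      ring
    · simp [ha, Circle.norm_coe]
    · have e2 : ∫ ξ, ((w ξ : ℂ) * cexp (((t - t') * φ ξ : ℝ) * I)) * a t ξ *
          (starRingEnd ℂ) (a t' ξ) =
          Φ t * (starRingEnd ℂ) (Φ t') *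
            𝓕⁻ (fun ξ => (w ξ : ℂ) * cexp (((t - t') * φ ξ : ℝ) * I)) (e t' - e t) := by
        rw [Real.fourierInv_eq, ← integral_const_mul]
        refine integral_congr_ae (Filter.Eventually.of_forall fun ξ => ?_)
        simp only [ha, map_mul, Circle.smul_def, smul_eq_mul, ← Circle.coe_inv_eq_conj,
          ← AddChar.map_neg_eq_inv, neg_neg]
        have : inner ℝ ξ (e t' - e t) = -inner ℝ (e t) ξ + inner ℝ (e t') ξ := by
          rw [inner_sub_right, real_inner_comm ξ, real_inner_comm ξ]
          ring
        rw [this, AddChar.map_add_eq_mul, Circle.coe_mul]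
        ring
      rw [e2, norm_mul, norm_mul, RCLike.norm_conj, hΦn, hΦn]
      calc _ ≤ ‖V t‖ ^ (q - 1) * ‖V t'‖ ^ (q - 1) * (A * |t - t'| ^ (-γ)) :=
            mul_le_mul_of_nonneg_left (hdisp _ (sub_ne_zero.2 htt) _) (by positivity)
        _ = _ := by ring

/-- Strichartz estimate for a wave packet with values in `L^∞`. -/
theorem lintegral_eLpNorm_top_rpow_le (h : IsWavePacket φ w ε G g) {A γ q : ℝ} (hA : 0 < A)
    (hdisp : IsDispersive φ w A γ) (h0 : 0 < γ) (h1 : γ < 1) (hq : q = 2 / γ) :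
    ∫⁻ t, eLpNorm (superposition φ ε G t) ∞ ^ q ≤ ENNReal.ofReal
      ((√(A * (6 + 4 / (1 - γ))) * ∫ s, √(∫ ξ, ‖G (s, ξ)‖ ^ 2)) ^ q) := by
  have hq0 : 0 < q := by
    rw [hq]
    positivity
  have hU := h.measurable_superposition
  obtain ⟨e, hem, hmono, hmax⟩ := exists_measurable_maximizing hU (TopologicalSpace.denseSeq (Euc d))
  set f : ℕ → ℝ → ℝ≥0∞ := fun n => (Set.Icc (-n : ℝ) n).indicator
    fun t => ‖superposition φ ε G t (e n t)‖ₑ ^ q with hf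
  have hVm : ∀ n, Measurable fun t => superposition φ ε G t (e n t) := fun n =>
    hU.comp (measurable_id.prodMk (hem n))
  have hfm : ∀ n, Measurable (f n) := fun n =>
    ((hVm n).enorm.pow_const _).indicator measurableSet_Icc
  have hmono' : ∀ t, Monotone fun n => ‖superposition φ ε G t (e n t)‖ₑ := fun t =>
    monotone_nat_of_le_succ fun n => by
      rw [← ofReal_norm, ← ofReal_norm]
      exact ENNReal.ofReal_le_ofReal (hmono n t)
  have hfmono : Monotone f := by
    intro m n hmn t
    have hsub : Set.Icc (-m : ℝ) m ⊆ Set.Icc (-n : ℝ) n := by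
      have : (m : ℝ) ≤ n := by exact_mod_cast hmn
      exact Set.Icc_subset_Icc (by linarith) this
    simp only [hf]
    refine (Set.indicator_le_indicator_of_subset hsub (fun _ => zero_le) t).trans ?_
    refine Set.indicator_le_indicator ?_
    exact ENNReal.rpow_le_rpow (hmono' t hmn) hq0.le
  have hle : ∀ t, eLpNorm (superposition φ ε G t) ∞ ^ q ≤ ⨆ n, f n t := by
    intro t
    have hsup : eLpNorm (superposition φ ε G t) ∞ ≤ ⨆ n, ‖superposition φ ε G t (e n t)‖ₑ := by
      rw [eLpNorm_exponent_top]
      refine essSup_le_of_ae_le _ (Filter.Eventually.of_forall fun x => ?_)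
      have hcl : IsClosed {x | ‖superposition φ ε G t x‖ₑ ≤
          ⨆ n, ‖superposition φ ε G t (e n t)‖ₑ} :=
        isClosed_le (h.continuous_superposition t).enorm continuous_const
      have := (TopologicalSpace.denseRange_denseSeq (Euc d)).induction_on
        (p := fun x => ‖superposition φ ε G t x‖ₑ ≤ ⨆ n, ‖superposition φ ε G t (e n t)‖ₑ) x hcl
        (fun k => ?_)
      · exact this
      · refine le_iSup_of_le k ?_
        rw [← ofReal_norm, ← ofReal_norm]
        exact ENNReal.ofReal_le_ofReal (hmax k t)
    refine (ENNReal.rpow_le_rpow hsup hq0.le).trans ?_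
    have := (ENNReal.orderIsoRpow q hq0).map_iSup fun n => ‖superposition φ ε G t (e n t)‖ₑ
    simp only [ENNReal.orderIsoRpow_apply] at this
    rw [this]
    refine iSup_le fun m => ?_
    obtain ⟨k, hk⟩ := exists_nat_ge |t|
    refine le_iSup_of_le (max m k) ?_
    have hmem : t ∈ Set.Icc (-((max m k : ℕ) : ℝ)) (max m k : ℕ) := by
      rw [Set.mem_Icc, ← abs_le]
      exact hk.trans (by exact_mod_cast le_max_right m k)
    simp only [hf, Set.indicator_of_mem hmem]
    exact ENNReal.rpow_le_rpow (hmono' t (le_max_left m k)) hq0.le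
  refine (lintegral_mono hle).trans ?_
  rw [lintegral_iSup hfm hfmono]
  refine iSup_le fun n => ?_
  set V : ℝ → ℂ := (Set.Icc (-n : ℝ) n).indicator fun t => superposition φ ε G t (e n t) with hV
  have hVn : ∀ t, ‖V t‖ ≤ ∫ z, ‖G z‖ := fun t =>
    (norm_indicator_le_norm_self _ _).trans (h.norm_superposition_le _ _)
  have hTf : volume (Set.Icc (-n : ℝ) n) ≠ ∞ := by simp
  have hV0 : ∀ t, t ∉ Set.Icc (-n : ℝ) n → V t = 0 := fun t ht => by
    rw [hV, Set.indicator_of_notMem ht]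
  have hVm' : Measurable V := (hVm n).indicator measurableSet_Icc
  have key := h.integral_norm_rpow_selected_le hA hdisp h0 h1 hq (hem n) hVm' hVn hTf hV0
    (fun t => ?_)
  · refine le_trans (le_of_eq ?_) (ENNReal.ofReal_le_ofReal key)
    have hVi : Integrable fun t => ‖V t‖ ^ q := by
      refine integrable_of_bounded_of_support (C := (∫ z, ‖G z‖) ^ q) hTf
        (hVm'.norm.pow_const _).aestronglyMeasurable (fun t => ?_) (fun t ht => ?_)
      · rw [Real.norm_of_nonneg (by positivity)]
        exact Real.rpow_le_rpow (norm_nonneg _) (hVn t) hq0.le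
      · rw [hV0 t ht, norm_zero, Real.zero_rpow hq0.ne']
    rw [ofReal_integral_eq_lintegral_ofReal hVi
      (Filter.Eventually.of_forall fun x => by positivity)]
    refine lintegral_congr fun t => ?_
    simp only [hf, hV]
    by_cases ht : t ∈ Set.Icc (-n : ℝ) n
    · rw [Set.indicator_of_mem ht, Set.indicator_of_mem ht, ← ofReal_norm,
        ENNReal.ofReal_rpow_of_nonneg (norm_nonneg _) hq0.le]
    · rw [Set.indicator_of_notMem ht, Set.indicator_of_notMem ht, norm_zero,
        Real.zero_rpow hq0.ne', ENNReal.ofReal_zero]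
  · by_cases ht : t ∈ Set.Icc (-n : ℝ) n
    · left
      rw [hV, Set.indicator_of_mem ht]
    · right
      exact hV0 t ht

/-- Strichartz estimate for a wave packet with values in `L^r`, `2 < r < ∞`. -/
theorem lintegral_eLpNorm_rpow_le (h : IsWavePacket φ w ε G g) {A δ γ q r : ℝ} (hA : 0 < A)
    (hdisp : IsDispersive φ w A δ) (hr : 2 < r) (h0 : 0 < γ) (h1 : γ < 1)
    (hγ : γ = δ * ((r - 2) / r)) (hq : q = 2 / γ) :
    ∫⁻ t, eLpNorm (superposition φ ε G t) (ENNReal.ofReal r) ^ q ≤ ENNReal.ofReal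
      ((√((4 * r / (r - 2) * (2 * A) ^ (r - 2)) ^ (1 / r) * (6 + 4 / (1 - γ))) *
        ∫ s, √(∫ ξ, ‖G (s, ξ)‖ ^ 2)) ^ q) := by
  have hq0 : 0 < q := by
    rw [hq]
    positivity
  have hr0 : 0 < r := by linarith
  have hU := h.measurable_superposition
  set f : ℕ → ℝ → ℝ≥0∞ := fun n => (Set.Icc (-n : ℝ) n).indicator
    fun t => (∫⁻ x in Metric.closedBall 0 n, ‖superposition φ ε G t x‖ₑ ^ r) ^ (q / r) with hf
  have hfm : ∀ n, Measurable (f n) := fun n => by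
    have : Measurable fun z : ℝ × Euc d => ‖superposition φ ε G z.1 z.2‖ₑ ^ r :=
      hU.enorm.pow_const _
    exact ((this.lintegral_prod_right').pow_const _).indicator measurableSet_Icc
  have hball : Monotone fun n : ℕ => Metric.closedBall (0 : Euc d) n := fun m n hmn =>
    Metric.closedBall_subset_closedBall (by exact_mod_cast hmn)
  have hmono' : ∀ t, Monotone fun n : ℕ =>
      ∫⁻ x in Metric.closedBall 0 n, ‖superposition φ ε G t x‖ₑ ^ r := fun t m n hmn =>
    lintegral_mono_set (hball hmn)
  have hfmono : Monotone f := by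
    intro m n hmn t
    have hsub : Set.Icc (-m : ℝ) m ⊆ Set.Icc (-n : ℝ) n := by
      have : (m : ℝ) ≤ n := by exact_mod_cast hmn
      exact Set.Icc_subset_Icc (by linarith) this
    simp only [hf]
    refine (Set.indicator_le_indicator_of_subset hsub (fun _ => zero_le) t).trans ?_
    refine Set.indicator_le_indicator ?_
    exact ENNReal.rpow_le_rpow (hmono' t hmn) (by positivity)
  have hle : ∀ t, eLpNorm (superposition φ ε G t) (ENNReal.ofReal r) ^ q ≤ ⨆ n, f n t := by
    intro t
    have hsup : ∫⁻ x, ‖superposition φ ε G t x‖ₑ ^ r =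
        ⨆ n : ℕ, ∫⁻ x in Metric.closedBall 0 n, ‖superposition φ ε G t x‖ₑ ^ r := by
      have hun : (⋃ n : ℕ, Metric.closedBall (0 : Euc d) n) = Set.univ :=
        Metric.iUnion_closedBall_nat 0
      rw [← setLIntegral_univ, ← hun, setLIntegral_iUnion_of_directed _ hball.directed_le]
    rw [eLpNorm_eq_lintegral_rpow_enorm_toReal (by simpa using hr0) ENNReal.ofReal_ne_top,
      ENNReal.toReal_ofReal hr0.le, ← ENNReal.rpow_mul, hsup, one_div_mul_eq_div]
    have := (ENNReal.orderIsoRpow (q / r) (by positivity)).map_iSup fun n : ℕ =>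
      ∫⁻ x in Metric.closedBall 0 n, ‖superposition φ ε G t x‖ₑ ^ r
    simp only [ENNReal.orderIsoRpow_apply] at this
    rw [this]
    refine iSup_le fun m => ?_
    obtain ⟨k, hk⟩ := exists_nat_ge |t|
    refine le_iSup_of_le (max m k) ?_
    have hmem : t ∈ Set.Icc (-((max m k : ℕ) : ℝ)) (max m k : ℕ) := by
      rw [Set.mem_Icc, ← abs_le]
      exact hk.trans (by exact_mod_cast le_max_right m k)
    simp only [hf, Set.indicator_of_mem hmem]
    exact ENNReal.rpow_le_rpow (hmono' t (le_max_left m k)) (by positivity)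
  refine (lintegral_mono hle).trans ?_
  rw [lintegral_iSup hfm hfmono]
  refine iSup_le fun n => ?_
  set B := Metric.closedBall (0 : Euc d) n with hBdef
  set T := Set.Icc (-n : ℝ) n with hTdef
  set W : ℝ × Euc d → ℂ := (T ×ˢ B).indicator fun z => superposition φ ε G z.1 z.2 with hW
  have hBm : MeasurableSet B := measurableSet_closedBall
  have hBf : volume B ≠ ∞ := measure_closedBall_lt_top.ne
  have hTf : volume T ≠ ∞ := by simp [hTdef]
  have hWm : Measurable W := hU.indicator (measurableSet_Icc.prod hBm)
  have hWn : ∀ z, ‖W z‖ ≤ ∫ z, ‖G z‖ := fun z =>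
    (norm_indicator_le_norm_self _ _).trans (h.norm_superposition_le _ _)
  have hWB : ∀ t x, x ∉ B → W (t, x) = 0 := fun t x hx => by
    rw [hW, Set.indicator_of_notMem fun hz => hx hz.2]
  have hWT : ∀ t x, t ∉ T → W (t, x) = 0 := fun t x ht => by
    rw [hW, Set.indicator_of_notMem fun hz => ht hz.1]
  have key := h.integral_sliceNorm_rpow_le hA hdisp hr h0 h1 hγ hq hWm hWn hBm hBf hWB hTf hWT
    (fun z => ?_)
  · refine le_trans (le_of_eq ?_) (ENNReal.ofReal_le_ofReal key)
    rw [ofReal_integral_eq_lintegral_ofReal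
      (integrable_sliceNorm_rpow hWm hWn hBm hBf hWB hTf hWT hq0 hr)
      (Filter.Eventually.of_forall fun t => Real.rpow_nonneg (sliceNorm_nonneg _ _ _) _)]
    refine lintegral_congr fun t => ?_
    simp only [hf]
    by_cases ht : t ∈ T
    · have hI : 0 ≤ ∫ x, ‖W (t, x)‖ ^ r := integral_nonneg fun x => by positivity
      rw [Set.indicator_of_mem ht, sliceNorm, ← Real.rpow_mul hI, one_div_mul_eq_div,
        ← ENNReal.ofReal_rpow_of_nonneg hI (by positivity), ofReal_integral_eq_lintegral_ofReal
          (integrable_slice_rpow hWm hWn hBf hWB hr0 t)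
          (Filter.Eventually.of_forall fun x => by positivity), ← lintegral_indicator hBm]
      congr 1
      refine lintegral_congr fun x => ?_
      by_cases hx : x ∈ B
      · rw [Set.indicator_of_mem hx, hW,
          Set.indicator_of_mem (show (t, x) ∈ T ×ˢ B from ⟨ht, hx⟩), ← ofReal_norm,
          ENNReal.ofReal_rpow_of_nonneg (norm_nonneg _) hr0.le]
      · rw [Set.indicator_of_notMem hx, hWB t x hx, norm_zero, Real.zero_rpow hr0.ne',
          ENNReal.ofReal_zero]
    · rw [Set.indicator_of_notMem ht, sliceNorm_eq_zero hr fun x => hWT t x ht,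
        Real.zero_rpow hq0.ne', ENNReal.ofReal_zero]
  · by_cases hz : z ∈ T ×ˢ B
    · left
      rw [hW, Set.indicator_of_mem hz]
    · right
      rw [hW, Set.indicator_of_notMem hz]

end IsWavePacket

end Selected

section Duhamel

variable {d : ℕ} {χ : ℝ → ℝ} {l : ℝ}

theorem continuous_rho (hχ : IsCutoff χ) : Continuous (rho χ) := by
  have := hχ.1.continuous
  unfold rho
  fun_prop

theorem abs_rho_le (hχ : IsCutoff χ) (s : ℝ) : |rho χ s| ≤ 1 := by
  have h1 := hχ.2.2.1 s
  have h2 := hχ.2.2.1 (2 * s)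
  rw [rho, abs_le]
  constructor <;> linarith

theorem rho_eq_zero_of_le (hχ : IsCutoff χ) {s : ℝ} (h0 : 0 ≤ s) (hs : s ≤ 1 / 2) :
    rho χ s = 0 := by
  rw [rho, hχ.2.2.2.1 s ⟨by linarith, by linarith⟩,
    hχ.2.2.2.1 (2 * s) ⟨by linarith, by linarith⟩, sub_self]

theorem rho_eq_zero_of_lt (hχ : IsCutoff χ) {s : ℝ} (hs : 2 < s) : rho χ s = 0 := by
  have hz : ∀ u, 2 < u → χ u = 0 := fun u hu => by
    by_contra h
    exact absurd (hχ.2.2.2.2 h).2 (not_le.2 hu)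
  rw [rho, hz s hs, hz (2 * s) (by linarith), sub_self]

theorem rho_eq_zero_of_notMem (hχ : IsCutoff χ) {s : ℝ} (h0 : 0 ≤ s)
    (hs : s ∉ Set.Icc (1 / 2 : ℝ) 2) : rho χ s = 0 := by
  rcases le_or_gt s (1 / 2) with h | h
  · exact rho_eq_zero_of_le hχ h0 h
  · exact rho_eq_zero_of_lt hχ (not_le.1 fun h2 => hs ⟨h.le, h2⟩)

theorem contDiff_rho_norm (hχ : IsCutoff χ) (hl : 0 < l) :
    ContDiff ℝ (⊤ : ℕ∞) fun ξ : Euc d => rho χ (‖ξ‖ / l) := by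
  rw [contDiff_iff_contDiffAt]
  intro ξ
  by_cases h : ξ = 0
  · refine (contDiffAt_const (c := (0 : ℝ))).congr_of_eventuallyEq ?_
    have : ∀ᶠ η : Euc d in nhds ξ, ‖η‖ < l / 2 :=
      continuous_norm.continuousAt.eventually_lt continuousAt_const (by simpa [h] using hl)
    filter_upwards [this] with η hη
    refine rho_eq_zero_of_le hχ (by positivity) ?_
    rw [div_le_iff₀ hl]
    linarith
  · have hn : ContDiffAt ℝ (⊤ : ℕ∞) (fun η : Euc d => ‖η‖ / l) ξ :=
      (contDiffAt_norm ℝ h).div_const l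
    have hr : ContDiff ℝ (⊤ : ℕ∞) (rho χ) := by
      unfold rho
      exact hχ.1.sub (hχ.1.comp (contDiff_const.mul contDiff_id))
    exact hr.contDiffAt.comp ξ hn

/-- The slice `y ↦ F (s, y)` of a Schwartz function. -/
theorem exists_schwartz_slice (F : SchwartzMap (ℝ × Euc d) ℂ) (s : ℝ) :
    ∃ f : SchwartzMap (Euc d) ℂ, ⇑f = fun y => F (s, y) := by
  have h1 : Function.HasTemperateGrowth fun y : Euc d => (s, y) := by
    have := (Function.HasTemperateGrowth.const (E := Euc d) ((s, 0) : ℝ × Euc d)).add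
      (ContinuousLinearMap.inr ℝ ℝ (Euc d)).hasTemperateGrowth
    convert this using 1
    ext y <;> simp
  exact ⟨SchwartzMap.compCLM ℝ h1 ⟨1, 1, fun y => by
    have : ‖y‖ ≤ ‖(s, y)‖ := le_max_right _ _
    rw [pow_one, one_mul]
    linarith⟩ F, rfl⟩

theorem exists_schwartz_rho_mul (hχ : IsCutoff χ) (hl : 0 < l) (f : SchwartzMap (Euc d) ℂ) :
    ∃ h : SchwartzMap (Euc d) ℂ, ⇑h = fun ξ => (rho χ (‖ξ‖ / l) : ℂ) * 𝓕 (⇑f) ξ := by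
  have hc : ContDiff ℝ (⊤ : ℕ∞) fun ξ : Euc d => (rho χ (‖ξ‖ / l) : ℂ) * 𝓕 (⇑f) ξ := by
    refine (Complex.ofRealCLM.contDiff.comp (contDiff_rho_norm hχ hl)).mul ?_
    rw [← SchwartzMap.fourier_coe]
    exact (𝓕 f).smooth _
  have hs : HasCompactSupport fun ξ : Euc d => (rho χ (‖ξ‖ / l) : ℂ) * 𝓕 (⇑f) ξ := by
    refine HasCompactSupport.intro (isCompact_closedBall (0 : Euc d) (2 * l)) fun ξ hξ => ?_
    rw [mem_closedBall_zero_iff, not_le] at hξ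
    rw [rho_eq_zero_of_lt hχ (by rwa [lt_div_iff₀ hl])]
    simp
  exact ⟨hs.toSchwartzMap hc, rfl⟩

theorem fourier_proj (hχ : IsCutoff χ) (hl : 0 < l) (f : SchwartzMap (Euc d) ℂ) :
    𝓕 (proj χ l ⇑f) = fun ξ => (rho χ (‖ξ‖ / l) : ℂ) * 𝓕 (⇑f) ξ := by
  obtain ⟨h, hh⟩ := exists_schwartz_rho_mul hχ hl f
  rw [proj, mulOp, ← hh]
  refine Continuous.fourier_fourierInv_eq h.continuous h.integrable ?_
  rw [← SchwartzMap.fourier_coe]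
  exact (𝓕 h).integrable

theorem eLpNorm_proj (hχ : IsCutoff χ) (hl : 0 < l) (f : SchwartzMap (Euc d) ℂ) :
    eLpNorm (proj χ l ⇑f) 2 =
      ENNReal.ofReal √(∫ ξ, ‖(rho χ (‖ξ‖ / l) : ℂ) * 𝓕 (⇑f) ξ‖ ^ 2) := by
  obtain ⟨h, hh⟩ := exists_schwartz_rho_mul hχ hl f
  have e : ∀ ξ, (rho χ (‖ξ‖ / l) : ℂ) * 𝓕 (⇑f) ξ = h ξ := fun ξ => (congrFun hh ξ).symm
  simp only [e]
  rw [proj, mulOp, ← hh, eLpNorm_fourierInv_eq h.integrable (h.memLp 2),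
    (h.memLp 2 volume).eLpNorm_eq_integral_rpow_norm (by norm_num) (by norm_num), Real.sqrt_eq_rpow]
  simp

/-- The oriented indicator of `(0, t]`. -/
def orientedIndicator (s t : ℝ) : ℝ :=
  (if 0 < s ∧ s ≤ t then 1 else 0) - (if t < s ∧ s ≤ 0 then 1 else 0)

theorem measurable_orientedIndicator : Measurable (Function.uncurry orientedIndicator) := by
  unfold orientedIndicator
  refine Measurable.sub (Measurable.ite ?_ measurable_const measurable_const)
    (Measurable.ite ?_ measurable_const measurable_const)
  · exact (measurableSet_lt measurable_const measurable_fst).inter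
      (measurableSet_le measurable_fst measurable_snd)
  · exact (measurableSet_lt measurable_snd measurable_fst).inter
      (measurableSet_le measurable_fst measurable_const)

theorem abs_orientedIndicator_le (s t : ℝ) : |orientedIndicator s t| ≤ 1 := by
  unfold orientedIndicator
  split_ifs <;> norm_num

theorem intervalIntegral_eq_integral_orientedIndicator (f : ℝ → ℂ) (t : ℝ) :
    ∫ s in (0 : ℝ)..t, f s = ∫ s, (orientedIndicator s t : ℂ) * f s := by
  rcases le_total 0 t with h | h
  · rw [intervalIntegral.integral_of_le h, ← integral_indicator measurableSet_Ioc]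
    refine integral_congr_ae (Filter.Eventually.of_forall fun s => ?_)
    have h2 : ¬ (t < s ∧ s ≤ 0) := fun hs => by linarith [hs.1, hs.2]
    by_cases hs : s ∈ Set.Ioc 0 t
    · simp only [Set.indicator_of_mem hs, orientedIndicator, if_neg h2, if_pos (Set.mem_Ioc.1 hs)]
      simp
    · simp only [Set.indicator_of_notMem hs, orientedIndicator, if_neg h2,
        if_neg (fun h => hs (Set.mem_Ioc.2 h))]
      simp
  · rw [intervalIntegral.integral_of_ge h, ← integral_indicator measurableSet_Ioc, ← integral_neg]
    refine integral_congr_ae (Filter.Eventually.of_forall fun s => ?_)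
    have h2 : ¬ (0 < s ∧ s ≤ t) := fun hs => by linarith [hs.1, hs.2]
    by_cases hs : s ∈ Set.Ioc t 0
    · simp only [Set.indicator_of_mem hs, orientedIndicator, if_neg h2, if_pos (Set.mem_Ioc.1 hs)]
      simp
    · simp only [Set.indicator_of_notMem hs, orientedIndicator, if_neg h2,
        if_neg (fun h => hs (Set.mem_Ioc.2 h))]
      simp

/-- The space-time amplitude of the Duhamel integral of a localised forcing. -/
def duhamelAmplitude (φ : Euc d → ℝ) (χ : ℝ → ℝ) (l : ℝ) (F : SchwartzMap (ℝ × Euc d) ℂ)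
    (z : ℝ × Euc d) : ℂ :=
  cexp ((z.1 * φ z.2 : ℝ) * I) * ((rho χ (‖z.2‖ / l) : ℂ) * 𝓕 (fun y => F (z.1, y)) z.2)

theorem norm_duhamelAmplitude (φ : Euc d → ℝ) (χ : ℝ → ℝ) (l : ℝ)
    (F : SchwartzMap (ℝ × Euc d) ℂ) (z : ℝ × Euc d) : ‖duhamelAmplitude φ χ l F z‖ =
      ‖(rho χ (‖z.2‖ / l) : ℂ) * 𝓕 (fun y => F (z.1, y)) z.2‖ := by
  rw [duhamelAmplitude, norm_mul, Complex.norm_exp_ofReal_mul_I, one_mul]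

theorem measurable_duhamelAmplitude {φ : Euc d → ℝ} (hφ : Measurable φ) (hχ : IsCutoff χ) (l : ℝ)
    (F : SchwartzMap (ℝ × Euc d) ℂ) : Measurable (duhamelAmplitude φ χ l F) := by
  have h1 : Measurable fun z : ℝ × Euc d => 𝓕 (fun y => F (z.1, y)) z.2 := by
    have : Measurable fun p : (ℝ × Euc d) × Euc d =>
        (𝐞 (-inner ℝ p.2 p.1.2) : ℂ) * F (p.1.1, p.2) :=
      ((Continuous.measurable (by fun_prop : Continuous fun s : ℝ => (𝐞 s : ℂ))).comp
        (by fun_prop : Measurable fun p : (ℝ × Euc d) × Euc d => -inner ℝ p.2 p.1.2)).mul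
        (F.continuous.measurable.comp (by fun_prop))
    have h2 := (this.stronglyMeasurable.integral_prod_right' (ν := volume)).measurable
    convert h2 using 1
    ext z
    simp only [Real.fourier_eq, Circle.smul_def, smul_eq_mul]
  have h2 : Measurable fun z : ℝ × Euc d => rho χ (‖z.2‖ / l) :=
    (continuous_rho hχ).measurable.comp (by fun_prop)
  have h3 : Measurable fun z : ℝ × Euc d => φ z.2 := hφ.comp measurable_snd
  exact Measurable.mul (by fun_prop) ((Complex.measurable_ofReal.comp h2).mul h1)

theorem isWavePacket_duhamel {φ : Euc d → ℝ} (hφ : Measurable φ) (hχ : IsCutoff χ) (hl : 0 < l)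
    (F : SchwartzMap (ℝ × Euc d) ℂ) {ψ : ℝ → ℝ} (hψ : Continuous ψ)
    (hψ01 : ∀ s, 0 ≤ ψ s ∧ ψ s ≤ 1) (hψ1 : ∀ s ∈ Set.Icc (1 / 2 : ℝ) 2, ψ s = 1)
    (hψ0 : ∀ s ∉ Set.Icc (1 / 4 : ℝ) 4, ψ s = 0) :
    IsWavePacket φ (fun ξ : Euc d => ψ (‖ξ‖ / l)) orientedIndicator (duhamelAmplitude φ χ l F)
      (fun s => ∫ y, ‖F (s, y)‖) where
  measurable_phase := hφ
  measurable_coeff := measurable_orientedIndicator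
  abs_coeff_le := abs_orientedIndicator_le
  integrable_window := by
    refine integrable_of_bounded_of_support (C := 1) (B := Metric.closedBall 0 (4 * l))
      measure_closedBall_lt_top.ne
      (Continuous.aestronglyMeasurable (by fun_prop)) (fun ξ => ?_) fun ξ hξ => ?_
    · rw [Real.norm_of_nonneg (hψ01 _).1]
      exact (hψ01 _).2
    · rw [mem_closedBall_zero_iff, not_le] at hξ
      refine hψ0 _ fun h => ?_
      have := h.2
      rw [div_le_iff₀ hl] at this
      linarith
  measurable_window := Continuous.measurable (by fun_prop)
  window_mem := fun ξ => hψ01 _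
  integrable_majorant := by
    have : (volume : Measure (ℝ × Euc d)).IsAddHaarMeasure :=
      Measure.prod.instIsAddHaarMeasure volume volume
    have : Integrable (fun z => ‖F z‖) (volume : Measure (ℝ × Euc d)) := F.integrable.norm
    rw [Measure.volume_eq_prod] at this
    exact this.integral_prod_left
  majorant_nonneg := fun s => integral_nonneg fun y => norm_nonneg _
  measurable_amplitude := measurable_duhamelAmplitude hφ hχ l F
  norm_amplitude_le := fun s ξ => by
    rw [norm_duhamelAmplitude, norm_mul, Complex.norm_real, Real.norm_eq_abs, mul_comm]
    refine mul_le_mul (norm_fourier_le_integral_norm _ ξ) ?_ (abs_nonneg _)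
      (integral_nonneg fun y => norm_nonneg _)
    dsimp only
    by_cases h : ‖ξ‖ / l ∈ Set.Icc (1 / 2 : ℝ) 2
    · rw [hψ1 _ h]
      exact abs_rho_le hχ _
    · rw [rho_eq_zero_of_notMem hχ (by positivity) h, abs_zero]
      exact (hψ01 _).1
  window_eq_one := fun s ξ hG => by
    by_contra hne
    refine hG ?_
    have h : ‖ξ‖ / l ∉ Set.Icc (1 / 2 : ℝ) 2 := fun h => hne (hψ1 _ h)
    rw [duhamelAmplitude]
    dsimp only
    rw [rho_eq_zero_of_notMem hχ (by positivity) h]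
    simp

theorem ofReal_integral_sqrt_duhamelAmplitude_le (φ : Euc d → ℝ) (hχ : IsCutoff χ) (hl : 0 < l)
    (F : SchwartzMap (ℝ × Euc d) ℂ) :
    ENNReal.ofReal (∫ s, √(∫ ξ, ‖duhamelAmplitude φ χ l F (s, ξ)‖ ^ 2)) ≤
      ∫⁻ s, eLpNorm (proj χ l fun y => F (s, y)) 2 := by
  have e : ∀ s, eLpNorm (proj χ l fun y => F (s, y)) 2 =
      ENNReal.ofReal √(∫ ξ, ‖duhamelAmplitude φ χ l F (s, ξ)‖ ^ 2) := by
    intro s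
    obtain ⟨f, hf⟩ := exists_schwartz_slice F s
    simp only [norm_duhamelAmplitude]
    rw [← hf, eLpNorm_proj hχ hl f]
  simp only [e]
  by_cases hi : Integrable fun s => √(∫ ξ, ‖duhamelAmplitude φ χ l F (s, ξ)‖ ^ 2)
  · rw [ofReal_integral_eq_lintegral_ofReal hi
      (Filter.Eventually.of_forall fun s => Real.sqrt_nonneg _)]
  · rw [integral_undef hi, ENNReal.ofReal_zero]
    exact zero_le

theorem duhamel_eq_superposition {β σ : ℝ} (hχ : IsCutoff χ) (hl : 0 < l)
    (F : SchwartzMap (ℝ × Euc d) ℂ) {w : Euc d → ℝ} {g : ℝ → ℝ}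
    (hp : IsWavePacket (fun ξ : Euc d => σ * mSymb β ‖ξ‖) w orientedIndicator
      (duhamelAmplitude (fun ξ : Euc d => σ * mSymb β ‖ξ‖) χ l F) g) (t : ℝ) (x : Euc d) :
    ∫ s in (0 : ℝ)..t, propg β (σ * (t - s)) (proj χ l fun y => F (s, y)) x =
      superposition (fun ξ : Euc d => σ * mSymb β ‖ξ‖) orientedIndicator
        (duhamelAmplitude (fun ξ : Euc d => σ * mSymb β ‖ξ‖) χ l F) t x := by
  set φ : Euc d → ℝ := fun ξ => σ * mSymb β ‖ξ‖ with hφ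
  have hi : Integrable fun z : ℝ × Euc d => (orientedIndicator z.1 t : ℂ) * planeWave φ t x z.2 *
      duhamelAmplitude φ χ l F z := by
    have h1 : Measurable fun z : ℝ × Euc d => orientedIndicator z.1 t :=
      measurable_orientedIndicator.comp (by fun_prop : Measurable fun z : ℝ × Euc d => (z.1, t))
    have h2 : Measurable fun z : ℝ × Euc d => planeWave φ t x z.2 :=
      measurable_planeWave hp.measurable_phase (by fun_prop) (by fun_prop) (by fun_prop)
    exact hp.integrable_amplitude.norm.mono' (((Complex.measurable_ofReal.comp h1).mul h2).mul
      hp.measurable_amplitude).aestronglyMeasurable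
      (Filter.Eventually.of_forall fun z => hp.norm_integrand_le t x z)
  rw [intervalIntegral_eq_integral_orientedIndicator, superposition]
  rw [Measure.volume_eq_prod] at hi ⊢
  rw [integral_prod _ hi]
  refine integral_congr_ae (Filter.Eventually.of_forall fun s => ?_)
  simp only [mul_assoc]
  rw [integral_const_mul]
  congr 1
  obtain ⟨f, hf⟩ := exists_schwartz_slice F s
  rw [propg, mulOp, Real.fourierInv_eq, ← hf, fourier_proj hχ hl f]
  refine integral_congr_ae (Filter.Eventually.of_forall fun ξ => ?_)
  simp only [duhamelAmplitude, ← hf, planeWave, Circle.smul_def, smul_eq_mul, hφ]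
  have e : cexp (-I * ((σ * (t - s) : ℝ) * mSymb β ‖ξ‖)) =
      cexp (-(t * (σ * mSymb β ‖ξ‖) : ℝ) * I) * cexp ((s * (σ * mSymb β ‖ξ‖) : ℝ) * I) := by
    rw [← Complex.exp_add]
    congr 1
    push_cast
    ring
  rw [e]
  ring

theorem isDispersive_mSymb {β σ A δ : ℝ} (hσ : σ = 1 ∨ σ = -1) {ψ : ℝ → ℝ}
    (h : ∀ t : ℝ, t ≠ 0 → ∀ x : Euc d,
      ‖𝓕⁻ (fun ξ : Euc d => cexp (-(t * mSymb β ‖ξ‖) * I) * ψ (‖ξ‖ / l)) x‖ ≤ A * |t| ^ (-δ)) :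
    IsDispersive (fun ξ : Euc d => σ * mSymb β ‖ξ‖) (fun ξ => ψ (‖ξ‖ / l)) A δ := by
  intro t ht x
  have hσ0 : σ ≠ 0 := by rcases hσ with rfl | rfl <;> norm_num
  have hσ1 : |σ| = 1 := by rcases hσ with rfl | rfl <;> norm_num
  have := h (-(t * σ)) (neg_ne_zero.2 (mul_ne_zero ht hσ0)) x
  rw [abs_neg, abs_mul, hσ1, mul_one] at this
  convert this using 4 with ξ
  rw [mul_comm]
  congr 2
  push_cast
  ring

theorem timeLp_le_of_lintegral_le {q : ℝ≥0∞} (hq : q ≠ ∞) (hq0 : 0 < q.toReal) {u : ℝ → ℝ≥0∞}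
    {D : ℝ} (hD : 0 ≤ D) (h : ∫⁻ t, u t ^ q.toReal ≤ ENNReal.ofReal (D ^ q.toReal)) :
    timeLp q u ≤ ENNReal.ofReal D := by
  rw [timeLp, if_neg hq]
  refine (ENNReal.rpow_le_rpow h (by positivity)).trans_eq ?_
  rw [ENNReal.ofReal_rpow_of_nonneg (by positivity) (by positivity), one_div,
    Real.rpow_rpow_inv hD hq0.ne']

end Duhamel

theorem measurable_mSymb (β : ℝ) : Measurable (mSymb β) := by
  have h : Measurable Real.tanh := by
    have : Real.tanh = fun x => Real.sinh x / Real.cosh x := by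
      ext x
      exact Real.tanh_eq_sinh_div_cosh x
    rw [this]
    exact Real.continuous_sinh.measurable.div Real.continuous_cosh.measurable
  unfold mSymb
  fun_prop

theorem toReal_admissible {d : ℕ} {q r : ℝ≥0∞} (hq0 : q ≠ 0) (hr0 : r ≠ 0)
    (hadm : 2 / q + (d : ℝ≥0∞) / r = (d : ℝ≥0∞) / 2) :
    2 / q.toReal + d / r.toReal = d / 2 := by
  have h := congrArg ENNReal.toReal hadm
  rw [ENNReal.toReal_add (ENNReal.div_ne_top (by norm_num) hq0)
    (ENNReal.div_ne_top (by simp) hr0)] at h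
  simpa [ENNReal.toReal_div] using h

theorem eq_two_of_admissible_top {d : ℕ} (hd : 1 ≤ d) {r : ℝ≥0∞}
    (hadm : 2 / (∞ : ℝ≥0∞) + (d : ℝ≥0∞) / r = (d : ℝ≥0∞) / 2) : r = 2 := by
  rw [ENNReal.div_top, zero_add] at hadm
  have hd0 : (d : ℝ≥0∞) ≠ 0 := by
    simp only [ne_eq, Nat.cast_eq_zero]
    omega
  rw [div_eq_mul_inv, div_eq_mul_inv,
    ENNReal.mul_right_inj hd0 (ENNReal.natCast_ne_top d)] at hadm
  exact inv_inj.1 hadm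

theorem sqrt_kernel_top {C c K : ℝ} (hC : 0 < C) (hK : 0 < K) :
    √(C * c * K) = √(C * K) * c ^ (1 / 2 : ℝ) := by
  rw [mul_right_comm, Real.sqrt_mul (by positivity), Real.sqrt_eq_rpow c]

theorem sqrt_kernel {C c K B r : ℝ} (hC : 0 < C) (hc : 0 < c) (hB : 0 < B) (hK : 0 < K) :
    √((B * (2 * (C * c)) ^ (r - 2)) ^ (1 / r) * K) =
      √((B * (2 * C) ^ (r - 2)) ^ (1 / r) * K) * c ^ ((r - 2) / r / 2) := by
  have e : (B * (2 * (C * c)) ^ (r - 2)) ^ (1 / r) * K =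
      ((B * (2 * C) ^ (r - 2)) ^ (1 / r) * K) * c ^ ((r - 2) / r) := by
    rw [← mul_assoc 2 C c, Real.mul_rpow (by positivity) hc.le, ← mul_assoc,
      Real.mul_rpow (x := B * (2 * C) ^ (r - 2)) (by positivity) (by positivity),
      ← Real.rpow_mul hc.le]
    ring_nf
  rw [e, Real.sqrt_mul (by positivity), Real.sqrt_eq_rpow (c ^ _), ← Real.rpow_mul hc.le]
  ring_nf

/-- Theorem 2, inhomogeneous (retarded) localised Strichartz estimate: for `β ∈ {0,1}`,
`d ≥ 1`, `λ = 2^n ∈ 2^ℤ` and an admissible pair `2 < q ≤ ∞`, `2 ≤ r ≤ ∞`,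
`2/q + d/r = d/2`, one has
`‖∫_0^t S_{m_β}(±(t-s)) P_λ F(s) ds‖_{L^q_t L^r_x} ≲ [c_{β,d}(λ)]^{2/(qd)} ‖P_λ F‖_{L^1_t L^2_x}`
for every Schwartz function `F` on `ℝ^{d+1}`, with implicit constant independent of
`λ` and `F`. -/
theorem strichartz_inhomogeneous
    (β : ℝ) (hβ : β = 0 ∨ β = 1) (d : ℕ) (hd : 1 ≤ d)
    (q r : ℝ≥0∞) (hq : 2 < q) (hr : 2 ≤ r)
    (hadm : 2 / q + (d : ℝ≥0∞) / r = (d : ℝ≥0∞) / 2)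
    (χ : ℝ → ℝ) (hχ : IsCutoff χ) :
    ∃ C > 0, ∀ (n : ℤ) (σ : ℝ), σ = 1 ∨ σ = -1 →
      ∀ F : SchwartzMap (ℝ × Euc d) ℂ,
        mixedNorm q r
            (fun t x => ∫ s in (0 : ℝ)..t,
              propg β (σ * (t - s)) (proj χ ((2 : ℝ) ^ n) (fun y => F (s, y))) x) ≤
          ENNReal.ofReal (C * cFactor β d ((2 : ℝ) ^ n) ^ (2 / (q.toReal * d))) *
            ∫⁻ s, eLpNorm (proj χ ((2 : ℝ) ^ n) (fun y => F (s, y))) 2 volume := by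
  obtain ⟨ψ, C₀, hC₀, hψ, hψ01, hψ1, hψ0, hdisp⟩ := dispersive_estimate hβ hd
  have hd0 : (0 : ℝ) < d := by exact_mod_cast hd
  have hpacket : ∀ (n : ℤ) (σ : ℝ) (F : SchwartzMap (ℝ × Euc d) ℂ),
      IsWavePacket (fun ξ : Euc d => σ * mSymb β ‖ξ‖) (fun ξ => ψ (‖ξ‖ / (2 : ℝ) ^ n))
        orientedIndicator
        (duhamelAmplitude (fun ξ : Euc d => σ * mSymb β ‖ξ‖) χ ((2 : ℝ) ^ n) F)
        (fun s => ∫ y, ‖F (s, y)‖) := fun n σ F =>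
    isWavePacket_duhamel (((measurable_mSymb β).comp measurable_norm).const_mul σ) hχ
      (by positivity) F hψ hψ01 hψ1 hψ0
  have hdisp' : ∀ (n : ℤ) (σ : ℝ), σ = 1 ∨ σ = -1 →
      IsDispersive (fun ξ : Euc d => σ * mSymb β ‖ξ‖) (fun ξ => ψ (‖ξ‖ / (2 : ℝ) ^ n))
        (C₀ * cFactor β d ((2 : ℝ) ^ n)) (d / 2) := fun n σ hσ =>
    isDispersive_mSymb hσ (hdisp _ (by positivity))
  have hc : ∀ n : ℤ, 0 < cFactor β d ((2 : ℝ) ^ n) := fun n => cFactor_pos β d (by positivity)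
  suffices H : ∃ C > 0, ∀ (n : ℤ) (σ : ℝ), σ = 1 ∨ σ = -1 → ∀ F : SchwartzMap (ℝ × Euc d) ℂ,
      mixedNorm q r (superposition (fun ξ : Euc d => σ * mSymb β ‖ξ‖) orientedIndicator
        (duhamelAmplitude (fun ξ : Euc d => σ * mSymb β ‖ξ‖) χ ((2 : ℝ) ^ n) F)) ≤
      ENNReal.ofReal (C * cFactor β d ((2 : ℝ) ^ n) ^ (2 / (q.toReal * d)) *
        ∫ s, √(∫ ξ, ‖duhamelAmplitude (fun ξ : Euc d => σ * mSymb β ‖ξ‖) χ ((2 : ℝ) ^ n) F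
          (s, ξ)‖ ^ 2)) by
    obtain ⟨C, hC, h⟩ := H
    refine ⟨C, hC, fun n σ hσ F => ?_⟩
    have hl : (0 : ℝ) < 2 ^ n := by positivity
    have hcn := hc n
    simp only [duhamel_eq_superposition hχ hl F (hpacket n σ F)]
    refine (h n σ hσ F).trans ?_
    rw [ENNReal.ofReal_mul (by positivity)]
    exact mul_le_mul_right (ofReal_integral_sqrt_duhamelAmplitude_le _ hχ hl F) _
  have hS : ∀ (n : ℤ) (σ : ℝ) (F : SchwartzMap (ℝ × Euc d) ℂ),
      0 ≤ ∫ s, √(∫ ξ, ‖duhamelAmplitude (fun ξ : Euc d => σ * mSymb β ‖ξ‖) χ ((2 : ℝ) ^ n) F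
          (s, ξ)‖ ^ 2) := fun n σ F => integral_nonneg fun s => Real.sqrt_nonneg _
  by_cases hqt : q = ∞
  · subst hqt
    obtain rfl := eq_two_of_admissible_top hd hadm
    refine ⟨1, one_pos, fun n σ hσ F => ?_⟩
    rw [mixedNorm, timeLp, if_pos rfl, ENNReal.toReal_top, zero_mul, div_zero, Real.rpow_zero,
      one_mul, one_mul]
    exact essSup_le_of_ae_le _
      (Filter.Eventually.of_forall (hpacket n σ F).eLpNorm_two_superposition_le)
  have hq0 : q ≠ 0 := (lt_trans (by norm_num) hq).ne'
  have hr0 : r ≠ 0 := (lt_of_lt_of_le (by norm_num) hr).ne'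
  have hadmR := toReal_admissible hq0 hr0 hadm
  have hQ : 2 < q.toReal := by
    rw [← ENNReal.toReal_ofNat]
    exact (ENNReal.toReal_lt_toReal (by norm_num) hqt).2 hq
  have hQ0 : 0 < q.toReal := by linarith
  set γ := 2 / q.toReal with hγ
  have h0 : 0 < γ := by positivity
  have h1 : γ < 1 := by
    rw [hγ, div_lt_one hQ0]
    exact hQ
  have h1γ : 0 < 1 - γ := by linarith
  have hqγ : q.toReal = 2 / γ := by
    rw [hγ]
    field_simp
  by_cases hrt : r = ∞
  · subst hrt
    rw [ENNReal.toReal_top, div_zero, add_zero] at hadmR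
    refine ⟨√(C₀ * (6 + 4 / (1 - γ))), by positivity, fun n σ hσ F => ?_⟩
    have hcn := hc n
    have he : 2 / (q.toReal * d) = 1 / 2 := by
      rw [← div_div, ← hγ, hadmR]
      field_simp
    rw [mixedNorm, he, ← sqrt_kernel_top hC₀ (by positivity)]
    have hSn := hS n σ F
    refine timeLp_le_of_lintegral_le hqt hQ0 (by positivity) ?_
    exact (hpacket n σ F).lintegral_eLpNorm_top_rpow_le (by positivity)
      (hadmR ▸ hdisp' n σ hσ) h0 h1 hqγ
  · have hR2 : 2 ≤ r.toReal := by
      rw [← ENNReal.toReal_ofNat]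
      exact (ENNReal.toReal_le_toReal (by norm_num) hrt).2 hr
    have hR0 : 0 < r.toReal := by linarith
    have hγR : γ = d / 2 * ((r.toReal - 2) / r.toReal) := by
      have : γ = d / 2 - d / r.toReal := by linarith
      rw [this]
      field_simp
    have hR : 2 < r.toReal := by
      refine lt_of_le_of_ne hR2 fun h => ?_
      rw [← h] at hγR
      norm_num at hγR
      linarith
    have hR' : 0 < r.toReal - 2 := by linarith
    refine ⟨√((4 * r.toReal / (r.toReal - 2) * (2 * C₀) ^ (r.toReal - 2)) ^ (1 / r.toReal) *
      (6 + 4 / (1 - γ))), by positivity, fun n σ hσ F => ?_⟩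
    have hcn := hc n
    have he : 2 / (q.toReal * d) = (r.toReal - 2) / r.toReal / 2 := by
      rw [← div_div, ← hγ, hγR]
      field_simp
    rw [mixedNorm, he, ← sqrt_kernel hC₀ hcn (by positivity) (by positivity)]
    have hSn := hS n σ F
    refine timeLp_le_of_lintegral_le hqt hQ0 (by positivity) ?_
    have key := (hpacket n σ F).lintegral_eLpNorm_rpow_le (by positivity) (hdisp' n σ hσ) hR h0 h1
      hγR hqγ
    rwa [ENNReal.ofReal_toReal hrt] at key
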